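/- arXiv:1602.04731 — 2 statements merged into one kernel-verified Lean document; each statement's English description precedes it below -/
import Mathlib

section
/- Let ζ be an extremal number and ε > 0. Then the inequality |Q(ζ)| ≤ H(Q)^{−3+ε} has solutions in polynomials Q ∈ ℤ[T] that are irreducible of degree exactly three with arbitrarily large height H(Q). -/
open Polynomial

/-- Height of an integer polynomial: the maximum absolute value of its coefficients. -/
noncomputable def polyH (P : Polynomial ℤ) : ℝ :=
  (((P.support.sup fun i => (P.coeff i).natAbs) : ℕ) : ℝ)

/-- Evaluation of an integer polynomial at a real number. -/
noncomputable def pev (ζ : ℝ) (P : Polynomial ℤ) : ℝ := Polynomial.aeval ζ P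

/-- Set of exponents η such that for arbitrarily large X the system
    H(P) ≤ X, 0 < |P(ζ)| ≤ X^(−η) has a solution of degree at most n. -/
def wSet (n : ℕ) (ζ : ℝ) : Set ℝ :=
  {η | ∀ X₀ : ℝ, ∃ X : ℝ, X₀ ≤ X ∧ ∃ P : Polynomial ℤ,
    P.natDegree ≤ n ∧ polyH P ≤ X ∧ 0 < |pev ζ P| ∧ |pev ζ P| ≤ X ^ (-η)}

/-- The exponent w_n(ζ). -/
noncomputable def wExp (n : ℕ) (ζ : ℝ) : ℝ := sSup (wSet n ζ)

/-- Set of exponents η such that for all sufficiently large X the system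
    H(P) ≤ X, 0 < |P(ζ)| ≤ X^(−η) has a solution of degree at most n. -/
def whSet (n : ℕ) (ζ : ℝ) : Set ℝ :=
  {η | ∃ X₀ : ℝ, ∀ X : ℝ, X₀ ≤ X → ∃ P : Polynomial ℤ,
    P.natDegree ≤ n ∧ polyH P ≤ X ∧ 0 < |pev ζ P| ∧ |pev ζ P| ≤ X ^ (-η)}

/-- The uniform exponent ŵ_n(ζ). -/
noncomputable def whExp (n : ℕ) (ζ : ℝ) : ℝ := sSup (whSet n ζ)

/-- Set of exponents η such that for arbitrarily large X the system
    |x| ≤ X, max_{1≤i≤n} |ζ^i x − y_i| ≤ X^(−η) has a nonzero integer solution. -/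
def lamSet (n : ℕ) (ζ : ℝ) : Set ℝ :=
  {η | ∀ X₀ : ℝ, ∃ X : ℝ, X₀ ≤ X ∧ ∃ x : ℤ, ∃ y : Fin n → ℤ,
    (x ≠ 0 ∨ y ≠ 0) ∧ ((|x| : ℤ) : ℝ) ≤ X ∧
    ∀ i : Fin n, |ζ ^ ((i : ℕ) + 1) * (x : ℝ) - (y i : ℝ)| ≤ X ^ (-η)}

/-- The exponent λ_n(ζ). -/
noncomputable def lamExp (n : ℕ) (ζ : ℝ) : ℝ := sSup (lamSet n ζ)

/-- Set of exponents η such that for all sufficiently large X the system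
    |x| ≤ X, max_{1≤i≤n} |ζ^i x − y_i| ≤ X^(−η) has a nonzero integer solution. -/
def lamhSet (n : ℕ) (ζ : ℝ) : Set ℝ :=
  {η | ∃ X₀ : ℝ, ∀ X : ℝ, X₀ ≤ X → ∃ x : ℤ, ∃ y : Fin n → ℤ,
    (x ≠ 0 ∨ y ≠ 0) ∧ ((|x| : ℤ) : ℝ) ≤ X ∧
    ∀ i : Fin n, |ζ ^ ((i : ℕ) + 1) * (x : ℝ) - (y i : ℝ)| ≤ X ^ (-η)}

/-- The uniform exponent λ̂_n(ζ). -/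
noncomputable def lamhExp (n : ℕ) (ζ : ℝ) : ℝ := sSup (lamhSet n ζ)

/-- Set of exponents η such that for arbitrarily large X the polynomial system has
    at least j linearly independent solutions of degree at most n. -/
def wSetJ (n j : ℕ) (ζ : ℝ) : Set ℝ :=
  {η | ∀ X₀ : ℝ, ∃ X : ℝ, X₀ ≤ X ∧ ∃ P : Fin j → Polynomial ℤ,
    LinearIndependent ℤ P ∧ ∀ i : Fin j,
      (P i).natDegree ≤ n ∧ polyH (P i) ≤ X ∧ 0 < |pev ζ (P i)| ∧ |pev ζ (P i)| ≤ X ^ (-η)}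

/-- The exponent w_{n,j}(ζ). -/
noncomputable def wExpJ (n j : ℕ) (ζ : ℝ) : ℝ := sSup (wSetJ n j ζ)

/-- Set of exponents η such that for all sufficiently large X the polynomial system has
    at least j linearly independent solutions of degree at most n. -/
def whSetJ (n j : ℕ) (ζ : ℝ) : Set ℝ :=
  {η | ∃ X₀ : ℝ, ∀ X : ℝ, X₀ ≤ X → ∃ P : Fin j → Polynomial ℤ,
    LinearIndependent ℤ P ∧ ∀ i : Fin j,
      (P i).natDegree ≤ n ∧ polyH (P i) ≤ X ∧ 0 < |pev ζ (P i)| ∧ |pev ζ (P i)| ≤ X ^ (-η)}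

/-- The uniform exponent ŵ_{n,j}(ζ). -/
noncomputable def whExpJ (n j : ℕ) (ζ : ℝ) : ℝ := sSup (whSetJ n j ζ)

/-- Set of exponents η such that for arbitrarily large X the simultaneous approximation
    system has at least j linearly independent integer vector solutions. -/
def lamSetJ (n j : ℕ) (ζ : ℝ) : Set ℝ :=
  {η | ∀ X₀ : ℝ, ∃ X : ℝ, X₀ ≤ X ∧ ∃ v : Fin j → (Fin (n + 1) → ℤ),
    LinearIndependent ℤ v ∧ ∀ i : Fin j,
      ((|v i 0| : ℤ) : ℝ) ≤ X ∧
      ∀ t : Fin n, |ζ ^ ((t : ℕ) + 1) * ((v i 0 : ℤ) : ℝ) - ((v i t.succ : ℤ) : ℝ)| ≤ X ^ (-η)}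

/-- The exponent λ_{n,j}(ζ). -/
noncomputable def lamExpJ (n j : ℕ) (ζ : ℝ) : ℝ := sSup (lamSetJ n j ζ)

/-- Set of exponents η such that for all sufficiently large X the simultaneous approximation
    system has at least j linearly independent integer vector solutions. -/
def lamhSetJ (n j : ℕ) (ζ : ℝ) : Set ℝ :=
  {η | ∃ X₀ : ℝ, ∀ X : ℝ, X₀ ≤ X → ∃ v : Fin j → (Fin (n + 1) → ℤ),
    LinearIndependent ℤ v ∧ ∀ i : Fin j,
      ((|v i 0| : ℤ) : ℝ) ≤ X ∧
      ∀ t : Fin n, |ζ ^ ((t : ℕ) + 1) * ((v i 0 : ℤ) : ℝ) - ((v i t.succ : ℤ) : ℝ)| ≤ X ^ (-η)}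

/-- The uniform exponent λ̂_{n,j}(ζ). -/
noncomputable def lamhExpJ (n j : ℕ) (ζ : ℝ) : ℝ := sSup (lamhSetJ n j ζ)

/-- An extremal number: a real transcendental number with ŵ₂(ζ) = (3+√5)/2. -/
def IsExtremal (ζ : ℝ) : Prop :=
  Transcendental ℚ ζ ∧ whExp 2 ζ = (3 + Real.sqrt 5) / 2

namespace ExtremalCubic

/-- Value at `ζ` of the quadratic polynomial with coefficient vector `a`. -/
def val (ζ : ℝ) (a : Fin 3 → ℤ) : ℝ := a 0 + a 1 * ζ + a 2 * ζ ^ 2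

/-- Determinant of three coefficient vectors. -/
def det3 (a b c : Fin 3 → ℤ) : ℤ :=
  a 0 * (b 1 * c 2 - b 2 * c 1) - b 0 * (a 1 * c 2 - a 2 * c 1) + c 0 * (a 1 * b 2 - a 2 * b 1)

/-- Resultant of two quadratic polynomials (as binary forms). -/
def res (a b : Fin 3 → ℤ) : ℤ :=
  (a 0 * b 2 - a 2 * b 0) ^ 2 - (a 0 * b 1 - a 1 * b 0) * (a 1 * b 2 - a 2 * b 1)

/-- Resultant of the linear form `r₀ + r₁ T` and a quadratic polynomial. -/
def linRes (r₀ r₁ : ℤ) (a : Fin 3 → ℤ) : ℤ := a 0 * r₁ ^ 2 - a 1 * r₀ * r₁ + a 2 * r₀ ^ 2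

/-- Linear dependence of two coefficient vectors. -/
def Par (a b : Fin 3 → ℤ) : Prop :=
  a 0 * b 1 - a 1 * b 0 = 0 ∧ a 0 * b 2 - a 2 * b 0 = 0 ∧ a 1 * b 2 - a 2 * b 1 = 0

/-- Every large height `X` has a quadratic polynomial with nonzero value at most `X ^ (-η)`. -/
def Unif (ζ η : ℝ) : Prop :=
  ∃ X₀ : ℝ, ∀ X : ℝ, X₀ ≤ X → ∃ a : Fin 3 → ℤ, ‖a‖ ≤ X ∧ val ζ a ≠ 0 ∧ |val ζ a| ≤ X ^ (-η)

lemma abs_coord_le (a : Fin 3 → ℤ) (i : Fin 3) : |(a i : ℝ)| ≤ ‖a‖ := by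
  have := norm_le_pi_norm a i
  rwa [Int.norm_eq_abs] at this

lemma norm_le_of_abs {a : Fin 3 → ℤ} {M : ℝ} (h0 : |(a 0 : ℝ)| ≤ M) (h1 : |(a 1 : ℝ)| ≤ M)
    (h2 : |(a 2 : ℝ)| ≤ M) : ‖a‖ ≤ M := by
  refine (pi_norm_le_iff_of_nonneg ((abs_nonneg _).trans h0)).2 fun i => ?_
  rw [Int.norm_eq_abs]
  fin_cases i <;> assumption

lemma exists_abs_coord_eq (a : Fin 3 → ℤ) : ∃ i, |(a i : ℝ)| = ‖a‖ := by
  obtain ⟨i, -, hi⟩ := Finset.exists_max_image (Finset.univ : Finset (Fin 3))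
    (fun i => |(a i : ℝ)|) Finset.univ_nonempty
  exact ⟨i, le_antisymm (abs_coord_le a i) (norm_le_of_abs (hi 0 (Finset.mem_univ _))
    (hi 1 (Finset.mem_univ _)) (hi 2 (Finset.mem_univ _)))⟩

lemma abs_two_minor_le {x y z w p q : ℝ} (hx : |x| ≤ p) (hy : |y| ≤ q) (hz : |z| ≤ p)
    (hw : |w| ≤ q) : |x * y - z * w| ≤ 2 * (p * q) := by
  have h1 : |x * y| ≤ p * q := by
    rw [abs_mul]; exact mul_le_mul hx hy (abs_nonneg _) ((abs_nonneg _).trans hx)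
  have h2 : |z * w| ≤ p * q := by
    rw [abs_mul]; exact mul_le_mul hz hw (abs_nonneg _) ((abs_nonneg _).trans hz)
  linarith [abs_sub (x * y) (z * w)]

lemma one_le_abs_cast {n : ℤ} (h : n ≠ 0) : (1 : ℝ) ≤ |(n : ℝ)| := by
  exact_mod_cast Int.one_le_abs h

lemma one_le_of_det3_ne_zero (ζ : ℝ) {a b c : Fin 3 → ℤ} (h : det3 a b c ≠ 0) :
    1 ≤ 2 * (|val ζ a| * (‖b‖ * ‖c‖) + |val ζ b| * (‖a‖ * ‖c‖) + |val ζ c| * (‖a‖ * ‖b‖)) := by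
  refine (one_le_abs_cast h).trans ?_
  have e : ((det3 a b c : ℤ) : ℝ) = val ζ a * ((b 1 : ℝ) * c 2 - b 2 * c 1)
      - val ζ b * ((a 1 : ℝ) * c 2 - a 2 * c 1) + val ζ c * ((a 1 : ℝ) * b 2 - a 2 * b 1) := by
    simp only [det3, val]; push_cast; ring
  have m (x y : Fin 3 → ℤ) : |(x 1 : ℝ) * y 2 - x 2 * y 1| ≤ 2 * (‖x‖ * ‖y‖) :=
    abs_two_minor_le (abs_coord_le _ _) (abs_coord_le _ _) (abs_coord_le _ _) (abs_coord_le _ _)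
  have k1 := mul_le_mul_of_nonneg_left (m b c) (abs_nonneg (val ζ a))
  have k2 := mul_le_mul_of_nonneg_left (m a c) (abs_nonneg (val ζ b))
  have k3 := mul_le_mul_of_nonneg_left (m a b) (abs_nonneg (val ζ c))
  rw [← abs_mul] at k1 k2 k3
  rw [e]
  refine (abs_add_le _ _).trans ((add_le_add_left (abs_sub _ _) _).trans ?_)
  linarith

/-- A cofactor of the Bézout relation for `res`. -/
lemma abs_cofactor_le (ζ : ℝ) (a b x : Fin 3 → ℤ) :
    |((a 0 : ℝ) * b 2 - a 2 * b 0) * x 2 - ((a 1 : ℝ) * b 2 - a 2 * b 1) * (x 2 * ζ + x 1)| ≤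
      2 * (2 + |ζ|) * (‖a‖ * ‖b‖ * ‖x‖) := by
  have m (i j : Fin 3) : |(a i : ℝ) * b j - a j * b i| ≤ 2 * (‖a‖ * ‖b‖) :=
    abs_two_minor_le (abs_coord_le _ _) (abs_coord_le _ _) (abs_coord_le _ _) (abs_coord_le _ _)
  have k : |(x 2 : ℝ) * ζ + x 1| ≤ (1 + |ζ|) * ‖x‖ := by
    refine (abs_add_le _ _).trans ?_
    rw [abs_mul]
    nlinarith [abs_coord_le x 2, abs_coord_le x 1, abs_nonneg ζ]
  refine (abs_sub _ _).trans ?_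
  rw [abs_mul, abs_mul]
  have k1 := mul_le_mul (m 0 2) (abs_coord_le x 2) (abs_nonneg _) (by positivity)
  have k2 := mul_le_mul (m 1 2) k (abs_nonneg _) (by positivity)
  linarith

lemma one_le_of_res_ne_zero (ζ : ℝ) {a b : Fin 3 → ℤ} (h : res a b ≠ 0) :
    1 ≤ 2 * (2 + |ζ|) * (|val ζ a| * (‖a‖ * ‖b‖ ^ 2) + |val ζ b| * (‖a‖ ^ 2 * ‖b‖)) := by
  refine (one_le_abs_cast h).trans ?_
  have e : ((res a b : ℤ) : ℝ) =
      val ζ a * (((a 0 : ℝ) * b 2 - a 2 * b 0) * b 2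
        - ((a 1 : ℝ) * b 2 - a 2 * b 1) * (b 2 * ζ + b 1))
      - val ζ b * (((a 0 : ℝ) * b 2 - a 2 * b 0) * a 2
        - ((a 1 : ℝ) * b 2 - a 2 * b 1) * (a 2 * ζ + a 1)) := by
    simp only [res, val]; push_cast; ring
  rw [e]
  refine (abs_sub _ _).trans ?_
  rw [abs_mul, abs_mul]
  have k1 := mul_le_mul_of_nonneg_left (abs_cofactor_le ζ a b b) (abs_nonneg (val ζ a))
  have k2 := mul_le_mul_of_nonneg_left (abs_cofactor_le ζ a b a) (abs_nonneg (val ζ b))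
  linarith

lemma one_le_of_linRes_ne_zero (ζ : ℝ) {r₀ r₁ : ℤ} {a : Fin 3 → ℤ} {h : ℝ}
    (h0 : |(r₀ : ℝ)| ≤ h) (h1 : |(r₁ : ℝ)| ≤ h) (hr : linRes r₀ r₁ a ≠ 0) :
    1 ≤ |val ζ a| * h ^ 2 + (2 + |ζ|) * (|(r₀ : ℝ) + r₁ * ζ| * h * ‖a‖) := by
  refine (one_le_abs_cast hr).trans ?_
  have e : ((linRes r₀ r₁ a : ℤ) : ℝ) = val ζ a * (r₁ : ℝ) ^ 2
      - ((r₀ : ℝ) + r₁ * ζ) * (a 1 * r₁ + a 2 * (r₁ * ζ - r₀)) := by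
    simp only [linRes, val]; push_cast; ring
  have hh : 0 ≤ h := (abs_nonneg _).trans h0
  have k0 : |(r₁ : ℝ) * ζ - r₀| ≤ (1 + |ζ|) * h := by
    refine (abs_sub _ _).trans ?_
    rw [abs_mul]
    nlinarith [abs_nonneg ζ]
  have k : |(a 1 : ℝ) * r₁ + a 2 * (r₁ * ζ - r₀)| ≤ (2 + |ζ|) * (h * ‖a‖) := by
    refine (abs_add_le _ _).trans ?_
    rw [abs_mul, abs_mul]
    have t1 := mul_le_mul (abs_coord_le a 1) h1 (abs_nonneg _) (norm_nonneg _)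
    have t2 := mul_le_mul (abs_coord_le a 2) k0 (abs_nonneg _) (norm_nonneg _)
    linarith
  rw [e]
  refine (abs_sub _ _).trans ?_
  rw [abs_mul, abs_mul, abs_pow]
  have t1 : |(r₁ : ℝ)| ^ 2 ≤ h ^ 2 := pow_le_pow_left₀ (abs_nonneg _) h1 2
  have t2 := mul_le_mul_of_nonneg_left t1 (abs_nonneg (val ζ a))
  have t3 := mul_le_mul_of_nonneg_left k (abs_nonneg ((r₀ : ℝ) + r₁ * ζ))
  linarith

/-- A real function on integer vectors is bounded away from zero on its support in a ball. -/
lemma exists_pos_le_abs {n : ℕ} (f : (Fin n → ℤ) → ℝ) (M : ℝ) :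
    ∃ c > 0, ∀ v, ‖v‖ ≤ M → f v ≠ 0 → c ≤ |f v| := by
  have hfin : (Metric.closedBall (0 : Fin n → ℤ) M ∩ {v | f v ≠ 0}).Finite :=
    ((isCompact_closedBall _ _).finite_of_discrete).inter_of_left _
  rcases (Metric.closedBall (0 : Fin n → ℤ) M ∩ {v | f v ≠ 0}).eq_empty_or_nonempty with h | h
  · refine ⟨1, one_pos, fun v hv hf => ?_⟩
    have : v ∈ Metric.closedBall (0 : Fin n → ℤ) M ∩ {v | f v ≠ 0} := ⟨by simpa using hv, hf⟩
    simp [h] at this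
  · obtain ⟨w, hw, hmin⟩ := Set.exists_min_image _ (fun v => |f v|) hfin h
    exact ⟨|f w|, abs_pos.2 hw.2, fun v hv hf => hmin v ⟨by simpa using hv, hf⟩⟩

lemma val_ne_zero {ζ : ℝ} (hζ : Transcendental ℚ ζ) {a : Fin 3 → ℤ} (ha : a ≠ 0) :
    val ζ a ≠ 0 := by
  intro h
  have hz : Transcendental ℤ ζ := hζ.restrictScalars (algebraMap ℤ ℚ).injective_int
  rw [transcendental_iff] at hz
  have := hz (C (a 0) + C (a 1) * X + C (a 2) * X ^ 2) (by simpa [val] using h)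
  apply ha
  funext i
  have e (n : ℕ) := congrArg (fun p : ℤ[X] => p.coeff n) this
  fin_cases i
  · simpa [coeff_X, coeff_C, -eq_intCast] using e 0
  · simpa [coeff_X, coeff_C, -eq_intCast] using e 1
  · simpa [coeff_X, coeff_C, -eq_intCast] using e 2

lemma linear_ne_zero {ζ : ℝ} (hζ : Transcendental ℚ ζ) {r₀ r₁ : ℤ} (h : ¬ (r₀ = 0 ∧ r₁ = 0)) :
    (r₀ : ℝ) + r₁ * ζ ≠ 0 := by
  have := val_ne_zero hζ (a := ![r₀, r₁, 0]) (fun e => h ⟨by simpa using congrFun e 0,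
    by simpa using congrFun e 1⟩)
  simpa [val] using this

lemma norm_pos_of_val_ne_zero {ζ : ℝ} {a : Fin 3 → ℤ} (h : val ζ a ≠ 0) : 1 ≤ ‖a‖ := by
  have : a ≠ 0 := by rintro rfl; simp [val] at h
  obtain ⟨i, hi⟩ := Function.ne_iff.1 this
  exact (one_le_abs_cast hi).trans (abs_coord_le a i)

/-- A coprime linear form sharing a root with a nonzero quadratic form has no larger height. -/
lemma le_norm_of_linRes_eq_zero {r₀ r₁ : ℤ} (hc : IsCoprime r₀ r₁) {a : Fin 3 → ℤ} (ha : a ≠ 0)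
    (h : linRes r₀ r₁ a = 0) : |(r₀ : ℝ)| ≤ ‖a‖ ∧ |(r₁ : ℝ)| ≤ ‖a‖ := by
  have key {x : ℤ} (i : Fin 3) (hd : x ∣ a i) (hi : a i ≠ 0) : |(x : ℝ)| ≤ ‖a‖ := by
    refine le_trans ?_ (abs_coord_le a i)
    have := Int.natAbs_le_of_dvd_ne_zero hd hi
    have h2 : |x| ≤ |a i| := by rw [Int.abs_eq_natAbs, Int.abs_eq_natAbs]; exact_mod_cast this
    exact_mod_cast h2
  have nz : ¬ (a 0 = 0 ∧ a 1 = 0 ∧ a 2 = 0) := fun ⟨h0, h1, h2⟩ => ha <| by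
    funext i; fin_cases i <;> assumption
  unfold linRes at h
  constructor
  · rcases eq_or_ne r₀ 0 with h0 | h0
    · simp [h0]
    · have d0 : r₀ ∣ a 0 := by
        have : r₀ ∣ a 0 * r₁ ^ 2 := ⟨a 1 * r₁ - a 2 * r₀, by linear_combination h⟩
        exact (hc.pow_right).dvd_of_dvd_mul_right this
      rcases eq_or_ne (a 0) 0 with e0 | e0
      · have e : a 1 * r₁ = a 2 * r₀ := by
          apply mul_left_cancel₀ h0
          linear_combination (-1 : ℤ) * h + r₁ ^ 2 * e0
        have d1 : r₀ ∣ a 1 := hc.dvd_of_dvd_mul_right ⟨a 2, by rw [e]; ring⟩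
        refine key 1 d1 fun e1 => nz ⟨e0, e1, ?_⟩
        rw [e1, zero_mul] at e
        exact (mul_eq_zero.1 e.symm).resolve_right h0
      · exact key 0 d0 e0
  · rcases eq_or_ne r₁ 0 with h0 | h0
    · simp [h0]
    · have d0 : r₁ ∣ a 2 := by
        have : r₁ ∣ a 2 * r₀ ^ 2 := ⟨a 1 * r₀ - a 0 * r₁, by linear_combination h⟩
        exact (hc.symm.pow_right).dvd_of_dvd_mul_right this
      rcases eq_or_ne (a 2) 0 with e0 | e0
      · have e : a 1 * r₀ = a 0 * r₁ := by
          apply mul_left_cancel₀ h0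
          linear_combination (-1 : ℤ) * h + r₀ ^ 2 * e0
        have d1 : r₁ ∣ a 1 := hc.symm.dvd_of_dvd_mul_right ⟨a 0, by rw [e]; ring⟩
        refine key 1 d1 fun e1 => nz ⟨?_, e1, e0⟩
        rw [e1, zero_mul] at e
        exact (mul_eq_zero.1 e.symm).resolve_right h0
      · exact key 2 d0 e0

/-- `K * x ^ (-s)` is eventually small. -/
lemma eventually_mul_rpow_neg_lt (K : ℝ) {s t : ℝ} (hs : 0 < s) (ht : 0 < t) :
    ∀ᶠ x : ℝ in Filter.atTop, K * x ^ (-s) < t := by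
  have := (tendsto_rpow_neg_atTop hs).const_mul K
  rw [mul_zero] at this
  exact this.eventually_lt_const ht

/-- Rational approximations to `ζ` have exponent at most `2`: coprime case. -/
lemma exists_le_linear_of_isCoprime {ζ η : ℝ} (hζ : Transcendental ℚ ζ) (hη : 2 < η)
    (hu : Unif ζ η) : ∃ c > 0, ∀ r₀ r₁ : ℤ, IsCoprime r₀ r₁ → ∀ h : ℝ, |(r₀ : ℝ)| ≤ h →
      |(r₁ : ℝ)| ≤ h → c ≤ |(r₀ : ℝ) + r₁ * ζ| * h ^ 2 := by
  obtain ⟨X₀, hX₀⟩ := hu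
  obtain ⟨M, hM⟩ := Filter.eventually_atTop.1
    (eventually_mul_rpow_neg_lt 4 (sub_pos.2 hη) (show (0 : ℝ) < 1 / 2 by norm_num))
  set N := max (max X₀ M) 1 with hN
  obtain ⟨c₁, hc₁, hf⟩ := exists_pos_le_abs (n := 2) (fun v => (v 0 : ℝ) + v 1 * ζ) (2 * N)
  have hz : 0 ≤ |ζ| := abs_nonneg ζ
  refine ⟨min c₁ (1 / (2 * (2 + |ζ|))), by positivity, fun r₀ r₁ hc h h0 h1 => ?_⟩
  have hne : ¬ (r₀ = 0 ∧ r₁ = 0) := fun e => hc.ne_zero_or_ne_zero.elim (· e.1) (· e.2)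
  have main (g : ℝ) (g0 : |(r₀ : ℝ)| ≤ g) (g1 : |(r₁ : ℝ)| ≤ g)
      (gm : |(r₀ : ℝ)| = g ∨ |(r₁ : ℝ)| = g) :
      min c₁ (1 / (2 * (2 + |ζ|))) ≤ |(r₀ : ℝ) + r₁ * ζ| * g ^ 2 := by
    have gone : 1 ≤ g := by
      by_cases e : r₀ = 0
      · exact (one_le_abs_cast fun e' => hne ⟨e, e'⟩).trans g1
      · exact (one_le_abs_cast e).trans g0
    rcases le_or_gt g (2 * N) with hg | hg
    · refine (min_le_left _ _).trans ?_
      have := hf ![r₀, r₁] ((pi_norm_le_iff_of_nonneg (by linarith)).2 fun i => by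
        rw [Int.norm_eq_abs]; fin_cases i
        · simpa using g0.trans hg
        · simpa using g1.trans hg) (by simpa using linear_ne_zero hζ hne)
      simp only [Matrix.cons_val_zero, Matrix.cons_val_one] at this
      exact this.trans (le_mul_of_one_le_right (abs_nonneg _) (one_le_pow₀ gone))
    · refine (min_le_right _ _).trans ?_
      have hg2 : N ≤ g / 2 := by linarith
      obtain ⟨a, ha, hv0, hv⟩ := hX₀ (g / 2)
        (((le_max_left _ _).trans (le_max_left _ _)).trans hg2)
      have hsm := hM (g / 2) (((le_max_right _ _).trans (le_max_left _ _)).trans hg2)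
      have hgp : 0 < g / 2 := by linarith
      have ha0 : a ≠ 0 := by rintro rfl; simp [val] at hv0
      have hres : linRes r₀ r₁ a ≠ 0 := by
        intro e
        obtain ⟨e0, e1⟩ := le_norm_of_linRes_eq_zero hc ha0 e
        rcases gm with e' | e' <;> linarith
      have k := one_le_of_linRes_ne_zero ζ g0 g1 hres
      have k1 : |val ζ a| * g ^ 2 ≤ 4 * (g / 2) ^ (-(η - 2)) := by
        have : (g / 2) ^ (-(η - 2)) = (g / 2) ^ (-η) * (g / 2) ^ 2 := by
          rw [← Real.rpow_natCast, ← Real.rpow_add hgp]; congr 1; push_cast; ring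
        rw [this]
        nlinarith [sq_nonneg g]
      have k2 : |(r₀ : ℝ) + r₁ * ζ| * g * ‖a‖ ≤ |(r₀ : ℝ) + r₁ * ζ| * g ^ 2 := by
        rw [pow_two, ← mul_assoc]
        exact mul_le_mul_of_nonneg_left (by linarith) (by positivity)
      rw [div_le_iff₀ (by positivity)]
      nlinarith
  refine (main (max |(r₀ : ℝ)| |(r₁ : ℝ)|) (le_max_left _ _) (le_max_right _ _) ?_).trans ?_
  · rcases max_choice |(r₀ : ℝ)| |(r₁ : ℝ)| with e | e <;> rw [e] <;> simp
  · have : max |(r₀ : ℝ)| |(r₁ : ℝ)| ≤ h := max_le h0 h1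
    gcongr

lemma exists_le_linear {ζ η : ℝ} (hζ : Transcendental ℚ ζ) (hη : 2 < η)
    (hu : Unif ζ η) : ∃ c > 0, ∀ r₀ r₁ : ℤ, ¬ (r₀ = 0 ∧ r₁ = 0) → ∀ h : ℝ, |(r₀ : ℝ)| ≤ h →
      |(r₁ : ℝ)| ≤ h → c ≤ |(r₀ : ℝ) + r₁ * ζ| * h ^ 2 := by
  obtain ⟨c, hc, H⟩ := exists_le_linear_of_isCoprime hζ hη hu
  refine ⟨c, hc, fun r₀ r₁ hr h h0 h1 => ?_⟩
  obtain ⟨g, u, v, hg, huv, rfl, rfl⟩ : ∃ g u v : ℤ, g ≠ 0 ∧ IsCoprime u v ∧ r₀ = u * g ∧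
      r₁ = v * g := by
    have hpos : 0 < Int.gcd r₀ r₁ := Int.gcd_pos_iff.2 (by tauto)
    obtain ⟨u, v, huv, e0, e1⟩ := Int.exists_gcd_one hpos
    exact ⟨_, u, v, by exact_mod_cast hpos.ne', Int.isCoprime_iff_gcd_eq_one.2 huv, e0, e1⟩
  have hg1 := one_le_abs_cast hg
  push_cast at h0 h1 ⊢
  rw [abs_mul] at h0 h1
  have := H u v huv h (by nlinarith [abs_nonneg (u : ℝ)]) (by nlinarith [abs_nonneg (v : ℝ)])
  refine this.trans ?_
  have e : (u : ℝ) * g + v * g * ζ = (u + v * ζ) * g := by ring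
  rw [e, abs_mul]
  have : |(u : ℝ) + v * ζ| ≤ |(u : ℝ) + v * ζ| * |(g : ℝ)| :=
      le_mul_of_one_le_right (abs_nonneg _) hg1
  gcongr

lemma exists_square_param {m₀ m₁ m₂ : ℤ} (h : m₁ ^ 2 = m₀ * m₂)
    (hne : ¬ (m₀ = 0 ∧ m₁ = 0 ∧ m₂ = 0)) :
    ∃ t u v : ℤ, t ≠ 0 ∧ ¬ (u = 0 ∧ v = 0) ∧ m₂ = t * v ^ 2 ∧ m₁ = t * u * v ∧ m₀ = t * u ^ 2 := by
  rcases eq_or_ne m₂ 0 with e | e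
  · have e1 : m₁ = 0 := by simpa [e] using h
    exact ⟨m₀, 1, 0, by tauto, by simp, by simp [e], by simp [e1], by simp⟩
  · obtain ⟨v, u, huv, e2, e1⟩ := Int.exists_gcd_one (m := m₂) (n := m₁)
      (Int.gcd_pos_of_ne_zero_left _ e)
    set g : ℤ := (Int.gcd m₂ m₁ : ℤ)
    have hg : g ≠ 0 := by rintro h0; rw [h0, mul_zero] at e2; exact e e2
    have hv : v ≠ 0 := by rintro rfl; rw [zero_mul] at e2; exact e e2
    have hgu : g * u ^ 2 = m₀ * v := by
      apply mul_left_cancel₀ hg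
      rw [e1, e2] at h; linear_combination h
    have hd : v ∣ g := by
      have : v ∣ g * u ^ 2 := ⟨m₀, by rw [hgu]; ring⟩
      exact ((Int.isCoprime_iff_gcd_eq_one.2 huv).pow_right).dvd_of_dvd_mul_right this
    obtain ⟨t, ht⟩ := hd
    refine ⟨t, u, v, ?_, fun h => hv h.2, ?_, ?_, ?_⟩
    · rintro rfl; simp at ht; exact hg ht
    · rw [e2, ht]; ring
    · rw [e1, ht]; ring
    · apply mul_left_cancel₀ hv
      rw [ht] at hgu; linear_combination -hgu

/-- Two independent quadratics with a common root cannot both be very small at `ζ`. -/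
lemma exists_le_of_res_eq_zero {ζ η : ℝ} (hζ : Transcendental ℚ ζ) (hη : 2 < η)
    (hu : Unif ζ η) : ∃ c > 0, ∀ a b : Fin 3 → ℤ, ¬ Par a b → res a b = 0 →
      c ≤ ‖a‖ * ‖b‖ * (|val ζ a| * ‖b‖ + |val ζ b| * ‖a‖) ^ 2 := by
  obtain ⟨c, hc, H⟩ := exists_le_linear hζ hη hu
  have hz : 0 ≤ |ζ| := abs_nonneg ζ
  refine ⟨c ^ 2 / (2 * (2 + |ζ|) ^ 2), by positivity, fun a b hp hr => ?_⟩
  obtain ⟨t, u, v, ht, huv, e2, e1, e0⟩ := exists_square_param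
    (m₀ := a 0 * b 1 - a 1 * b 0) (m₁ := a 0 * b 2 - a 2 * b 0) (m₂ := a 1 * b 2 - a 2 * b 1)
    (by unfold res at hr; linear_combination hr) (by unfold Par at hp; tauto)
  set E := |val ζ a| * ‖b‖ + |val ζ b| * ‖a‖
  have hE : 0 ≤ E := by positivity
  have m (i j : Fin 3) : |(a i : ℝ) * b j - a j * b i| ≤ 2 * (‖a‖ * ‖b‖) :=
    abs_two_minor_le (abs_coord_le _ _) (abs_coord_le _ _) (abs_coord_le _ _) (abs_coord_le _ _)
  have e0' : (a 0 : ℝ) * b 1 - a 1 * b 0 = t * u ^ 2 := by exact_mod_cast e0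
  have e1' : (a 0 : ℝ) * b 2 - a 2 * b 0 = t * u * v := by exact_mod_cast e1
  have e2' : (a 1 : ℝ) * b 2 - a 2 * b 1 = t * v ^ 2 := by exact_mod_cast e2
  have ht1 := one_le_abs_cast ht
  have hcoord (x : Fin 3 → ℤ) : |(x 2 : ℝ) * ζ + x 1| ≤ (2 + |ζ|) * ‖x‖ := by
    refine (abs_add_le _ _).trans ?_
    rw [abs_mul]
    nlinarith [abs_coord_le x 2, abs_coord_le x 1, norm_nonneg x]
  have b1 : |(t : ℝ)| * |(v : ℝ)| * |(u : ℝ) + v * ζ| ≤ (2 + |ζ|) * E := by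
    have : (t : ℝ) * v * (u + v * ζ) = b 2 * val ζ a - a 2 * val ζ b := by
      simp only [val]; linear_combination (-ζ) * e2' - e1'
    rw [← abs_mul, ← abs_mul, this]
    refine (abs_sub _ _).trans ?_
    rw [abs_mul, abs_mul]
    have k1 := mul_le_mul_of_nonneg_right (abs_coord_le b 2) (abs_nonneg (val ζ a))
    have k2 := mul_le_mul_of_nonneg_right (abs_coord_le a 2) (abs_nonneg (val ζ b))
    nlinarith
  have b0 : |(t : ℝ)| * |(u : ℝ)| * |(u : ℝ) + v * ζ| ≤ (2 + |ζ|) * E := by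
    have : (t : ℝ) * u * (u + v * ζ) =
        (b 2 * ζ + b 1) * val ζ a - (a 2 * ζ + a 1) * val ζ b := by
      simp only [val]; linear_combination -e0' - ζ * e1'
    rw [← abs_mul, ← abs_mul, this]
    refine (abs_sub _ _).trans ?_
    rw [abs_mul, abs_mul]
    have k1 := mul_le_mul_of_nonneg_right (hcoord b) (abs_nonneg (val ζ a))
    have k2 := mul_le_mul_of_nonneg_right (hcoord a) (abs_nonneg (val ζ b))
    linarith
  have main (w : ℝ) (hw : |(t : ℝ)| * w ^ 2 ≤ 2 * (‖a‖ * ‖b‖)) (hu : |(u : ℝ)| ≤ w)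
      (hv : |(v : ℝ)| ≤ w) (hb : |(t : ℝ)| * w * |(u : ℝ) + v * ζ| ≤ (2 + |ζ|) * E) :
      c ^ 2 / (2 * (2 + |ζ|) ^ 2) ≤ ‖a‖ * ‖b‖ * E ^ 2 := by
    have h1 := H u v huv w hu hv
    have hw0 : 0 ≤ w := (abs_nonneg _).trans hu
    have h2 : c ≤ (2 + |ζ|) * E * w := by
      refine h1.trans ?_
      have h3 := mul_le_mul_of_nonneg_right hb hw0
      refine le_trans ?_ h3
      have h4 : 0 ≤ |(u : ℝ) + v * ζ| * w ^ 2 := by positivity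
      nlinarith
    have h5 : c ^ 2 ≤ ((2 + |ζ|) * E) ^ 2 * w ^ 2 := by
      rw [← mul_pow]; exact pow_le_pow_left₀ hc.le h2 2
    have h6 : w ^ 2 ≤ 2 * (‖a‖ * ‖b‖) := by
      refine le_trans ?_ hw
      nlinarith [sq_nonneg w]
    rw [div_le_iff₀ (by positivity)]
    have h7 := mul_le_mul_of_nonneg_left h6 (sq_nonneg ((2 + |ζ|) * E))
    nlinarith
  rcases le_total |(u : ℝ)| |(v : ℝ)| with h | h
  · refine main _ ?_ h le_rfl b1
    have := m 1 2
    rwa [e2', abs_mul, abs_pow] at this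
  · refine main _ ?_ le_rfl h b0
    have := m 0 1
    rwa [e0', abs_mul, abs_pow] at this

/-- `b` is a best approximation following `a`: nonzero values below that of `a` need height at
least `‖b‖`. -/
def Next (ζ : ℝ) (a b : Fin 3 → ℤ) : Prop :=
  val ζ b ≠ 0 ∧ |val ζ b| < |val ζ a| ∧
    ∀ y, val ζ y ≠ 0 → |val ζ y| < |val ζ a| → ‖b‖ ≤ ‖y‖

lemma exists_next {ζ η : ℝ} (hη : 0 < η) (hu : Unif ζ η) {a : Fin 3 → ℤ} (ha : val ζ a ≠ 0) :
    ∃ b, Next ζ a b := by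
  obtain ⟨X₀, hX₀⟩ := hu
  obtain ⟨X, hX, hX'⟩ := ((eventually_mul_rpow_neg_lt 1 hη (abs_pos.2 ha)).and
    (Filter.eventually_ge_atTop X₀)).exists
  obtain ⟨y, hy, hy0, hyv⟩ := hX₀ X hX'
  rw [one_mul] at hX
  have hfin : (Metric.closedBall (0 : Fin 3 → ℤ) X ∩
      {v | val ζ v ≠ 0 ∧ |val ζ v| < |val ζ a|}).Finite :=
    ((isCompact_closedBall _ _).finite_of_discrete).inter_of_left _
  obtain ⟨b, hb, hmin⟩ := Set.exists_min_image _ (fun v => ‖v‖) hfin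
    ⟨y, by simpa using hy, hy0, hyv.trans_lt hX⟩
  refine ⟨b, hb.2.1, hb.2.2, fun z hz hz' => ?_⟩
  have hbX : ‖b‖ ≤ X := by simpa using hb.1
  rcases le_or_gt ‖z‖ X with h | h
  · exact hmin z ⟨by simpa using h, hz, hz'⟩
  · linarith

lemma exists_next_seq {ζ η : ℝ} (hη : 0 < η) (hu : Unif ζ η) :
    ∃ P : ℕ → Fin 3 → ℤ, (∀ i, val ζ (P i) ≠ 0) ∧ (∀ i, Next ζ (P i) (P (i + 1))) ∧
      Monotone fun i => ‖P i‖ := by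
  have hex : ∀ a : {a : Fin 3 → ℤ // val ζ a ≠ 0}, ∃ b : {a : Fin 3 → ℤ // val ζ a ≠ 0},
      Next ζ a b := fun a => by
    obtain ⟨b, hb⟩ := exists_next hη hu a.2
    exact ⟨⟨b, hb.1⟩, hb⟩
  choose f hf using hex
  let a₀ : {a : Fin 3 → ℤ // val ζ a ≠ 0} := ⟨![1, 0, 0], by simp [val]⟩
  have hs (i : ℕ) : Next ζ (f^[i + 1] a₀ : Fin 3 → ℤ) (f^[i + 1 + 1] a₀ : Fin 3 → ℤ) := by
    rw [Function.iterate_succ_apply' f (i + 1)]; exact hf _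
  refine ⟨fun i => f^[i + 1] a₀, fun i => (f^[i + 1] a₀).2, hs, monotone_nat_of_le_succ fun i => ?_⟩
  have h1 : Next ζ (f^[i] a₀ : Fin 3 → ℤ) (f^[i + 1] a₀ : Fin 3 → ℤ) := by
    rw [Function.iterate_succ_apply' f i]; exact hf _
  exact h1.2.2 _ (hs i).1 ((hs i).2.1.trans h1.2.1)

lemma not_par_of_abs_val_lt {ζ : ℝ} {a b : Fin 3 → ℤ} (hv : |val ζ b| < |val ζ a|) (hn : ‖a‖ ≤ ‖b‖)
    (ha : val ζ a ≠ 0) : ¬ Par a b := by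
  intro h
  have hm (i j : Fin 3) : (a i : ℝ) * b j = a j * b i := by
    obtain ⟨h0, h1, h2⟩ := h
    have : a i * b j = a j * b i := by
      fin_cases i <;> fin_cases j <;> simp <;> linarith
    exact_mod_cast this
  obtain ⟨j, hj⟩ := exists_abs_coord_eq a
  obtain ⟨l, hl⟩ := exists_abs_coord_eq b
  have ha1 := norm_pos_of_val_ne_zero ha
  have e1 : (b j : ℝ) * val ζ a = a j * val ζ b := by
    simp only [val]
    linear_combination hm 0 j + ζ * hm 1 j + ζ ^ 2 * hm 2 j
  have e1' := congrArg abs e1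
  have e2' := congrArg abs (hm j l)
  rw [abs_mul, abs_mul, hj] at e1'
  rw [abs_mul, abs_mul, hj, hl] at e2'
  have h3 : |(b j : ℝ)| < ‖a‖ := by
    by_contra! hcon
    have := mul_le_mul_of_nonneg_right hcon (abs_nonneg (val ζ a))
    nlinarith
  have h4 := mul_le_mul_of_nonneg_right (abs_coord_le a l) (abs_nonneg (b j : ℝ))
  nlinarith

/-- Consecutive best approximations form a basis of the integer points of their span. -/
lemma Next.exists_coords {ζ : ℝ} (hζ : Transcendental ℚ ζ) {a b p : Fin 3 → ℤ} (h : Next ζ a b)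
    (hn : ‖a‖ < ‖b‖) (ha : val ζ a ≠ 0) (hd : det3 a b p = 0) :
    ∃ s t : ℤ, ∀ i, p i = s * a i + t * b i := by
  have hpar : ¬ Par a b := not_par_of_abs_val_lt h.2.1 hn.le ha
  have main (n s t : ℤ) (hn0 : n ≠ 0) (hp : ∀ i, n * p i = s * a i + t * b i) :
      ∃ s t : ℤ, ∀ i, p i = s * a i + t * b i := by
    have hnr : (n : ℝ) ≠ 0 := by exact_mod_cast hn0
    set σ : ℝ := (s : ℝ) / n
    set τ : ℝ := (t : ℝ) / n
    set y : Fin 3 → ℤ := fun i => p i - round σ * a i - round τ * b i with hy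
    have hyr (i : Fin 3) : (y i : ℝ) = (σ - round σ) * a i + (τ - round τ) * b i := by
      have e : (n : ℝ) * p i = s * a i + t * b i := by exact_mod_cast hp i
      simp only [hy, σ, τ]
      push_cast
      field_simp
      linear_combination e
    have hσ := abs_sub_round σ
    have hτ := abs_sub_round τ
    have hyn (i : Fin 3) : |(y i : ℝ)| ≤ (‖a‖ + ‖b‖) / 2 := by
      rw [hyr]
      refine (abs_add_le _ _).trans ?_
      rw [abs_mul, abs_mul]
      have k1 := mul_le_mul hσ (abs_coord_le a i) (abs_nonneg _) (by norm_num)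
      have k2 := mul_le_mul hτ (abs_coord_le b i) (abs_nonneg _) (by norm_num)
      linarith
    have hyv : |val ζ y| ≤ (|val ζ a| + |val ζ b|) / 2 := by
      have : val ζ y = (σ - round σ) * val ζ a + (τ - round τ) * val ζ b := by
        simp only [val, hyr]; ring
      rw [this]
      refine (abs_add_le _ _).trans ?_
      rw [abs_mul, abs_mul]
      have k1 := mul_le_mul_of_nonneg_right hσ (abs_nonneg (val ζ a))
      have k2 := mul_le_mul_of_nonneg_right hτ (abs_nonneg (val ζ b))
      linarith
    have hy0 : y = 0 := by
      by_contra hne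
      have h1 := h.2.2 y (val_ne_zero hζ hne) (by linarith [h.2.1])
      have h2 := norm_le_of_abs (hyn 0) (hyn 1) (hyn 2)
      linarith
    refine ⟨round σ, round τ, fun i => ?_⟩
    have := congrFun hy0 i
    simp only [hy, Pi.zero_apply] at this
    linarith
  unfold Par at hpar
  unfold det3 at hd
  by_cases h0 : a 0 * b 1 - a 1 * b 0 = 0
  · by_cases h1 : a 0 * b 2 - a 2 * b 0 = 0
    · refine main _ (p 1 * b 2 - p 2 * b 1) (a 1 * p 2 - a 2 * p 1)
        (fun h2 => hpar ⟨h0, h1, h2⟩) fun i => ?_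
      fin_cases i <;> simp <;> linarith
    · refine main _ (p 0 * b 2 - p 2 * b 0) (a 0 * p 2 - a 2 * p 0) h1 fun i => ?_
      fin_cases i <;> simp <;> linarith
  · refine main _ (p 0 * b 1 - p 1 * b 0) (a 0 * p 1 - a 1 * p 0) h0 fun i => ?_
    fin_cases i <;> simp <;> linarith

lemma Next.gap_le {ζ : ℝ} (hζ : Transcendental ℚ ζ) {a b p q : Fin 3 → ℤ} (h : Next ζ a b)
    (hn : ‖a‖ < ‖b‖) (ha : val ζ a ≠ 0) (hp : det3 a b p = 0) (hq : det3 a b q = 0)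
    (hpq : ¬ Par p q) (hpa : |val ζ p| ≤ |val ζ a|) (hqp : |val ζ q| ≤ |val ζ p|)
    (hap : ‖a‖ ≤ ‖p‖) (hnpq : ‖p‖ ≤ ‖q‖) :
    |val ζ a| * ‖b‖ - |val ζ b| * ‖a‖ ≤ 4 * (‖q‖ * |val ζ p|) := by
  obtain ⟨s, t, hst⟩ := h.exists_coords hζ hn ha hp
  obtain ⟨s', t', hst'⟩ := h.exists_coords hζ hn ha hq
  set Δ := |val ζ a| * ‖b‖ - |val ζ b| * ‖a‖ with hΔ
  have hva := abs_pos.2 ha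
  have coef (x : Fin 3 → ℤ) (u w : ℤ) (hx : ∀ i, x i = u * a i + w * b i)
      (hxa : |val ζ x| ≤ |val ζ a|) (hax : ‖a‖ ≤ ‖x‖) : |(w : ℝ)| * Δ ≤ 2 * (|val ζ a| * ‖x‖) := by
    obtain ⟨j, hj⟩ := exists_abs_coord_eq b
    have hxr (i : Fin 3) : (x i : ℝ) = u * a i + w * b i := by exact_mod_cast hx i
    have e : val ζ a * x j - val ζ x * a j = w * (val ζ a * b j - val ζ b * a j) := by
      simp only [val, hxr]; ring
    have e' := congrArg abs e
    rw [abs_mul (w : ℝ)] at e'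
    have k1 : Δ ≤ |val ζ a * b j - val ζ b * a j| := by
      refine le_trans ?_ (abs_sub_abs_le_abs_sub _ _)
      rw [abs_mul, abs_mul, hj]
      have := mul_le_mul_of_nonneg_left (abs_coord_le a j) (abs_nonneg (val ζ b))
      linarith
    have k2 : |val ζ a * x j - val ζ x * a j| ≤ 2 * (|val ζ a| * ‖x‖) := by
      refine (abs_sub _ _).trans ?_
      rw [abs_mul, abs_mul]
      have t1 := mul_le_mul_of_nonneg_left (abs_coord_le x j) (abs_nonneg (val ζ a))
      have t2 := mul_le_mul hxa ((abs_coord_le a j).trans hax) (abs_nonneg _) (abs_nonneg _)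
      linarith
    exact (mul_le_mul_of_nonneg_left k1 (abs_nonneg _)).trans (e' ▸ k2)
  have ct := coef p s t hst hpa hap
  have ct' := coef q s' t' hst' (hqp.trans hpa) (hap.trans hnpq)
  have hD : s * t' - s' * t ≠ 0 := by
    intro hD
    apply hpq
    refine ⟨?_, ?_, ?_⟩ <;> simp only [hst, hst']
    · linear_combination (a 0 * b 1 - a 1 * b 0) * hD
    · linear_combination (a 0 * b 2 - a 2 * b 0) * hD
    · linear_combination (a 1 * b 2 - a 2 * b 1) * hD
  have hpr (i : Fin 3) : (p i : ℝ) = s * a i + t * b i := by exact_mod_cast hst i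
  have hqr (i : Fin 3) : (q i : ℝ) = s' * a i + t' * b i := by exact_mod_cast hst' i
  have e : ((s * t' - s' * t : ℤ) : ℝ) * val ζ a = t' * val ζ p - t * val ζ q := by
    simp only [val, hpr, hqr]; push_cast; ring
  have k : |val ζ a| ≤ (|(t' : ℝ)| + |(t : ℝ)|) * |val ζ p| := by
    have e' := congrArg abs e
    rw [abs_mul] at e'
    have h1 := one_le_abs_cast hD
    have h2 := abs_sub ((t' : ℝ) * val ζ p) (t * val ζ q)
    rw [abs_mul, abs_mul] at h2
    have h3 := mul_le_mul_of_nonneg_left hqp (abs_nonneg (t : ℝ))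
    nlinarith
  have hΔ0 : 0 < Δ := by
    have h1 := norm_pos_of_val_ne_zero ha
    have h2 : |val ζ b| * ‖a‖ ≤ |val ζ a| * ‖a‖ :=
      mul_le_mul_of_nonneg_right h.2.1.le (norm_nonneg _)
    have h3 := mul_lt_mul_of_pos_left hn hva
    linarith
  have k' := mul_le_mul_of_nonneg_right k hΔ0.le
  have hvp := abs_nonneg (val ζ p)
  have h4 : (|(t' : ℝ)| + |(t : ℝ)|) * Δ ≤ 4 * (|val ζ a| * ‖q‖) := by
    have := mul_le_mul_of_nonneg_left hnpq hva.le
    linarith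
  have h5 := mul_le_mul_of_nonneg_right h4 hvp
  have h6 : |val ζ a| * Δ ≤ |val ζ a| * (4 * (‖q‖ * |val ζ p|)) := by linarith
  exact le_of_mul_le_mul_left h6 hva

lemma det3_ne_zero_of_coords {a b p q c : Fin 3 → ℤ} {s t s' t' : ℤ}
    (hp : ∀ i, p i = s * a i + t * b i) (hq : ∀ i, q i = s' * a i + t' * b i) (hpq : ¬ Par p q)
    (h : det3 a b c ≠ 0) : det3 p q c ≠ 0 := by
  have e : det3 p q c = (s * t' - s' * t) * det3 a b c := by
    simp only [det3, hp, hq]; ring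
  rw [e]
  refine mul_ne_zero (fun hD => hpq ?_) h
  refine ⟨?_, ?_, ?_⟩ <;> simp only [hp, hq]
  · linear_combination (a 0 * b 1 - a 1 * b 0) * hD
  · linear_combination (a 0 * b 2 - a 2 * b 0) * hD
  · linear_combination (a 1 * b 2 - a 2 * b 1) * hD

/-- A sequence of successive best quadratic approximations to `ζ`. -/
structure BestSeq (ζ : ℝ) (P : ℕ → Fin 3 → ℤ) : Prop where
  ne : ∀ i, val ζ (P i) ≠ 0
  next : ∀ i, Next ζ (P i) (P (i + 1))
  mono : Monotone fun i => ‖P i‖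

namespace BestSeq

variable {ζ : ℝ} {P : ℕ → Fin 3 → ℤ}

lemma anti (hP : BestSeq ζ P) : StrictAnti fun i => |val ζ (P i)| :=
  strictAnti_nat_of_succ_lt fun i => (hP.next i).2.1

lemma not_par (hP : BestSeq ζ P) {i j : ℕ} (h : i < j) : ¬ Par (P i) (P j) :=
  not_par_of_abs_val_lt (hP.anti h) (hP.mono h.le) (hP.ne i)

lemma one_le (hP : BestSeq ζ P) (i : ℕ) : 1 ≤ ‖P i‖ := norm_pos_of_val_ne_zero (hP.ne i)

lemma tendsto_norm (hP : BestSeq ζ P) :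
    Filter.Tendsto (fun i => ‖P i‖) Filter.atTop Filter.atTop := by
  refine Filter.tendsto_atTop_atTop_of_monotone hP.mono fun M => ?_
  by_contra! hcon
  have hinj : Function.Injective P := fun i j h => hP.anti.injective (by simp only [h])
  refine Set.infinite_range_of_injective hinj
    (((isCompact_closedBall (0 : Fin 3 → ℤ) M).finite_of_discrete).subset ?_)
  rintro _ ⟨i, rfl⟩
  simpa using (hcon i).le

lemma eventually_abs_val_le (hP : BestSeq ζ P) {η η' : ℝ} (h : η' < η)
    (hu : Unif ζ η) : ∀ᶠ i in Filter.atTop, |val ζ (P i)| ≤ ‖P (i + 1)‖ ^ (-η') := by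
  obtain ⟨X₀, hX₀⟩ := hu
  have ht := hP.tendsto_norm.comp (Filter.tendsto_add_atTop_nat 1)
  filter_upwards [ht.eventually_ge_atTop (2 * X₀), ht.eventually (eventually_mul_rpow_neg_lt
    ((1 / 2) ^ (-η)) (sub_pos.2 h) one_pos)] with i h1 h2
  simp only [Function.comp_apply] at h1 h2
  have hx : 0 < ‖P (i + 1)‖ := one_pos.trans_le (hP.one_le _)
  obtain ⟨y, hy, hy0, hyv⟩ := hX₀ (1 / 2 * ‖P (i + 1)‖) (by linarith)
  have h3 : |val ζ (P i)| ≤ |val ζ y| := by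
    by_contra! hcon
    have := (hP.next i).2.2 y hy0 hcon
    linarith
  refine (h3.trans hyv).trans ?_
  rw [Real.mul_rpow (by norm_num) hx.le]
  have h4 : ‖P (i + 1)‖ ^ (-η) = ‖P (i + 1)‖ ^ (-(η - η')) * ‖P (i + 1)‖ ^ (-η') := by
    rw [← Real.rpow_add hx]; congr 1; ring
  rw [h4, ← mul_assoc]
  exact mul_le_of_le_one_left (Real.rpow_nonneg hx.le _) h2.le

/-- After `h`, the first best approximation outside the plane of `P h` and `P (h + 1)`. -/
lemma exists_leave (hP : BestSeq ζ P) (hζ : Transcendental ℚ ζ) {η : ℝ} (hη : 1 < η)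
    (hu : Unif ζ η) {h : ℕ} (hh : ‖P h‖ < ‖P (h + 1)‖) :
    ∃ m ≥ h, det3 (P m) (P (m + 1)) (P (m + 2)) ≠ 0 ∧ det3 (P h) (P (m + 1)) (P (m + 2)) ≠ 0 ∧
      |val ζ (P h)| * ‖P (h + 1)‖ - |val ζ (P (h + 1))| * ‖P h‖ ≤
        4 * (‖P (m + 1)‖ * |val ζ (P m)|) := by
  have gap (m : ℕ) (hm : h ≤ m) (d1 : det3 (P h) (P (h + 1)) (P m) = 0)
      (d2 : det3 (P h) (P (h + 1)) (P (m + 1)) = 0) :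
      |val ζ (P h)| * ‖P (h + 1)‖ - |val ζ (P (h + 1))| * ‖P h‖ ≤
        4 * (‖P (m + 1)‖ * |val ζ (P m)|) :=
    (hP.next h).gap_le hζ hh (hP.ne h) d1 d2 (hP.not_par m.lt_succ_self)
      (hP.anti.antitone hm) (hP.next m).2.1.le (hP.mono hm) (hP.mono m.le_succ)
  have hex : ∃ j, h ≤ j ∧ det3 (P h) (P (h + 1)) (P j) ≠ 0 := by
    by_contra! hcon
    obtain ⟨η', h1, h2⟩ := exists_between hη
    have ht := hP.tendsto_norm.comp (Filter.tendsto_add_atTop_nat 1)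
    have hΔ : 0 < |val ζ (P h)| * ‖P (h + 1)‖ - |val ζ (P (h + 1))| * ‖P h‖ := by
      have h3 := mul_lt_mul_of_pos_left hh (abs_pos.2 (hP.ne h))
      have h4 := mul_le_mul_of_nonneg_right (hP.next h).2.1.le (norm_nonneg (P h))
      linarith
    obtain ⟨m, ⟨hm1, hm2⟩, hm3⟩ := (((hP.eventually_abs_val_le h2 hu).and
      (ht.eventually (eventually_mul_rpow_neg_lt 4 (sub_pos.2 h1) hΔ))).and
      (Filter.eventually_ge_atTop h)).exists
    simp only [Function.comp_apply] at hm2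
    have k := gap m hm3 (hcon m hm3) (hcon (m + 1) (by omega))
    have hx : 0 < ‖P (m + 1)‖ := one_pos.trans_le (hP.one_le _)
    have k2 : ‖P (m + 1)‖ * |val ζ (P m)| ≤ ‖P (m + 1)‖ ^ (-(η' - 1)) := by
      have : ‖P (m + 1)‖ ^ (-(η' - 1)) = ‖P (m + 1)‖ * ‖P (m + 1)‖ ^ (-η') := by
        rw [← Real.rpow_one_add' hx.le (by linarith)]; congr 1; ring
      rw [this]
      gcongr
    linarith
  classical
  obtain ⟨hj, hjd⟩ := Nat.find_spec hex
  set j := Nat.find hex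
  have hmin (i : ℕ) (hi : h ≤ i) (hij : i < j) : det3 (P h) (P (h + 1)) (P i) = 0 := by
    by_contra hcon
    exact Nat.find_min hex hij ⟨hi, hcon⟩
  have hj2 : h + 2 ≤ j := by
    rcases (show j = h ∨ j = h + 1 ∨ h + 2 ≤ j by omega) with e | e | e
    · exact absurd (by rw [e]; unfold det3; ring) hjd
    · exact absurd (by rw [e]; unfold det3; ring) hjd
    · exact e
  obtain ⟨m, hm⟩ : ∃ m, j = m + 2 := ⟨j - 2, by omega⟩
  have hmh : h ≤ m := by omega
  have d1 := hmin m hmh (by omega)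
  have d2 := hmin (m + 1) (by omega) (by omega)
  rw [hm] at hjd
  obtain ⟨s, t, hst⟩ := (hP.next h).exists_coords hζ hh (hP.ne h) d1
  obtain ⟨s', t', hst'⟩ := (hP.next h).exists_coords hζ hh (hP.ne h) d2
  refine ⟨m, hmh, ?_, ?_, gap m hmh d1 d2⟩
  · exact det3_ne_zero_of_coords hst hst' (hP.not_par m.lt_succ_self) hjd
  · exact det3_ne_zero_of_coords (s := 1) (t := 0) (by simp) hst'
      (hP.not_par (by omega : h < m + 1)) hjd

/-- Logarithmic form of the determinant bound for three consecutive best approximations. -/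
lemma log_det3_bound (hP : BestSeq ζ P) {i : ℕ} (h : det3 (P i) (P (i + 1)) (P (i + 2)) ≠ 0) :
    0 ≤ Real.log 6 + Real.log |val ζ (P i)| + Real.log ‖P (i + 1)‖ + Real.log ‖P (i + 2)‖ := by
  have p0 := hP.one_le i
  have p1 := hP.one_le (i + 1)
  have p2 := hP.one_le (i + 2)
  have m0 : ‖P i‖ ≤ ‖P (i + 1)‖ := hP.mono i.le_succ
  have m1 : ‖P (i + 1)‖ ≤ ‖P (i + 2)‖ := hP.mono (i + 1).le_succ
  have v0 := abs_pos.2 (hP.ne i)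
  have v1 : |val ζ (P (i + 1))| ≤ |val ζ (P i)| := (hP.next i).2.1.le
  have v2 : |val ζ (P (i + 2))| ≤ |val ζ (P i)| := (hP.next (i + 1)).2.1.le.trans v1
  have k := one_le_of_det3_ne_zero ζ h
  have k1 : |val ζ (P (i + 1))| * (‖P i‖ * ‖P (i + 2)‖) ≤
      |val ζ (P i)| * (‖P (i + 1)‖ * ‖P (i + 2)‖) := by gcongr
  have k2 : |val ζ (P (i + 2))| * (‖P i‖ * ‖P (i + 1)‖) ≤
      |val ζ (P i)| * (‖P (i + 1)‖ * ‖P (i + 2)‖) := by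
    rw [mul_comm ‖P (i + 1)‖ ‖P (i + 2)‖]; gcongr; linarith
  rw [← Real.log_mul (by norm_num) v0.ne', ← Real.log_mul (by positivity) (by positivity),
    ← Real.log_mul (by positivity) (by positivity)]
  apply Real.log_nonneg
  linarith

/-- Logarithmic form of the resultant bound for consecutive best approximations. -/
lemma exists_log_res_bound (hP : BestSeq ζ P) (hζ : Transcendental ℚ ζ) {η : ℝ} (hη : 2 < η)
    (hu : Unif ζ η) : ∃ K, 0 ≤ K ∧ ∀ᶠ i in Filter.atTop,
      0 ≤ K + Real.log |val ζ (P i)| + Real.log ‖P i‖ + 2 * Real.log ‖P (i + 1)‖ := by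
  obtain ⟨c, hc, H⟩ := exists_le_of_res_eq_zero hζ hη hu
  obtain ⟨η', h1, h2⟩ := exists_between hη
  have hz := abs_nonneg ζ
  have ht := hP.tendsto_norm.comp (Filter.tendsto_add_atTop_nat 1)
  refine ⟨Real.log (4 * (2 + |ζ|)), Real.log_nonneg (by linarith), ?_⟩
  filter_upwards [hP.eventually_abs_val_le h2 hu, ht.eventually
    (eventually_mul_rpow_neg_lt 2 (sub_pos.2 h1) (Real.sqrt_pos.2 hc))] with i hi1 hi2
  simp only [Function.comp_apply] at hi2
  have p0 := hP.one_le i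
  have p1 := hP.one_le (i + 1)
  have hx : 0 < ‖P (i + 1)‖ := by linarith
  have m0 : ‖P i‖ ≤ ‖P (i + 1)‖ := hP.mono i.le_succ
  have v0 := abs_pos.2 (hP.ne i)
  have v1 : |val ζ (P (i + 1))| ≤ |val ζ (P i)| := (hP.next i).2.1.le
  have hres : res (P i) (P (i + 1)) ≠ 0 := by
    intro e
    have k := H _ _ (hP.not_par i.lt_succ_self) e
    have k1 : |val ζ (P i)| * ‖P (i + 1)‖ + |val ζ (P (i + 1))| * ‖P i‖ ≤
        2 * (|val ζ (P i)| * ‖P (i + 1)‖) := by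
      have : |val ζ (P (i + 1))| * ‖P i‖ ≤ |val ζ (P i)| * ‖P (i + 1)‖ := by gcongr
      linarith
    have k2 : |val ζ (P i)| * ‖P (i + 1)‖ ^ 2 ≤ ‖P (i + 1)‖ ^ (-(η' - 2)) := by
      have : ‖P (i + 1)‖ ^ (-(η' - 2)) = ‖P (i + 1)‖ ^ (-η') * ‖P (i + 1)‖ ^ 2 := by
        rw [← Real.rpow_natCast, ← Real.rpow_add hx]; congr 1; push_cast; ring
      rw [this]; gcongr
    have k3 : c ≤ (2 * (|val ζ (P i)| * ‖P (i + 1)‖ ^ 2)) ^ 2 := by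
      calc c ≤ _ := k
        _ ≤ ‖P (i + 1)‖ * ‖P (i + 1)‖ * (2 * (|val ζ (P i)| * ‖P (i + 1)‖)) ^ 2 := by gcongr
        _ = _ := by ring
    have k4 : 2 * (|val ζ (P i)| * ‖P (i + 1)‖ ^ 2) < Real.sqrt c := by linarith
    have k5 : (2 * (|val ζ (P i)| * ‖P (i + 1)‖ ^ 2)) ^ 2 < c := by
      rw [← Real.sq_sqrt hc.le]
      exact pow_lt_pow_left₀ k4 (by positivity) (by norm_num)
    linarith
  have k := one_le_of_res_ne_zero ζ hres
  have k1 : |val ζ (P (i + 1))| * (‖P i‖ ^ 2 * ‖P (i + 1)‖) ≤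
      |val ζ (P i)| * (‖P i‖ * ‖P (i + 1)‖ ^ 2) := by
    have : ‖P i‖ ^ 2 * ‖P (i + 1)‖ ≤ ‖P i‖ * ‖P (i + 1)‖ ^ 2 := by
      rw [pow_two, pow_two, mul_assoc]; gcongr
    gcongr
  have k2 : 1 ≤ 4 * (2 + |ζ|) * |val ζ (P i)| * ‖P i‖ * ‖P (i + 1)‖ ^ 2 := by
    have := mul_le_mul_of_nonneg_left k1 (show 0 ≤ 2 * (2 + |ζ|) by linarith)
    linarith
  have k3 := Real.log_nonneg k2
  rw [Real.log_mul (by positivity) (by positivity), Real.log_mul (by positivity) (by positivity),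
    Real.log_mul (by positivity) (by positivity), Real.log_pow] at k3
  push_cast at k3
  linarith

end BestSeq

lemma golden_log_bounds {g δ a G H c v w u : ℝ} (hg : g ^ 2 = g + 1) (hg1 : 8 / 5 < g)
    (hg2 : g < 5 / 3) (hδ : 0 < δ) (hδ1 : δ ≤ 1 / 100) (ha : 0 ≤ a)
    (haG : a ≤ G) (hGH : G ≤ H) (hHc : H ≤ c)
    (h1 : (g - δ) * a ≤ δ * H + G) (h2 : 0 ≤ δ * H + v + a + 2 * G) (h3 : v + G ≤ δ * H + H + u)
    (hu : u ≤ -(g + 1 - δ) * H) (h4 : (g - 1 - δ) * c ≤ δ * H + H) (h5 : (g - δ) * H ≤ δ * H + c)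
    (hw : w ≤ -(g + 1 - δ) * c) :
    a ≤ (g - 1 + 12 * δ) * H ∧ v ≤ (-(g + 1) + 12 * δ) * H ∧ c ≤ (g + 12 * δ) * H ∧
      w ≤ (-(2 * g + 1) + 12 * δ) * H := by
  have hH : 0 ≤ H := by linarith
  have hδH : 0 ≤ δ * H := by positivity
  have hδδ : δ * (δ * H) ≤ 1 / 100 * (δ * H) := by gcongr
  have c2 : c ≤ 2 * H := by
    have : 1 / 2 * c ≤ (g - 1 - δ) * c := by gcongr; linarith; linarith
    nlinarith
  have c3 : (g - 1) * c ≤ H + 3 * (δ * H) := by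
    have : δ * c ≤ δ * (2 * H) := by gcongr
    linarith
  have c4 : c ≤ g * (H + 3 * (δ * H)) := by
    have := mul_le_mul_of_nonneg_left c3 (show 0 ≤ g by linarith)
    have e : g * ((g - 1) * c) = c := by linear_combination c * hg
    linarith
  have c5 : g * (δ * H) ≤ 5 / 3 * (δ * H) := by gcongr
  have a1 : g * a ≤ G + 2 * (δ * H) := by
    have : δ * a ≤ δ * H := by gcongr; linarith
    linarith
  have a2 : a ≤ (g - 1) * (G + 2 * (δ * H)) := by
    have := mul_le_mul_of_nonneg_left a1 (show 0 ≤ g - 1 by linarith)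
    have e : (g - 1) * (g * a) = a := by linear_combination a * hg
    linarith
  have G1 : H ≤ G + 4 * (δ * H) := by
    have : g * H ≤ g * (G + 4 * (δ * H)) := by nlinarith
    exact le_of_mul_le_mul_left this (by linarith)
  refine ⟨?_, by linarith, by linarith, ?_⟩
  · have : (g - 1) * (G + 2 * (δ * H)) ≤ (g - 1) * (H + 2 * (δ * H)) := by gcongr; linarith
    linarith
  · have h6 : g * H - 2 * (δ * H) ≤ c := by linarith
    have : (g + 1 - δ) * (g * H - 2 * (δ * H)) ≤ (g + 1 - δ) * c := by gcongr; linarith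
    have e : (g + 1 - δ) * (g * H - 2 * (δ * H)) =
      (2 * g + 1) * H - 3 * (g * (δ * H)) - 2 * (δ * H) + 2 * (δ * (δ * H)) := by
      linear_combination H * hg
    have : 0 ≤ δ * (δ * H) := by positivity
    linarith

/-- Three best approximations near an extremal number whose sizes and values are
controlled by the norm of the middle one. -/
lemma BestSeq.exists_triple {ζ g δ : ℝ} {P : ℕ → Fin 3 → ℤ} (hP : BestSeq ζ P)
    (hζ : Transcendental ℚ ζ) (hg : g ^ 2 = g + 1) (hg1 : 8 / 5 < g) (hg2 : g < 5 / 3)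
    (hu : ∀ η < g + 1, Unif ζ η) (hδ : 0 < δ) (hδ1 : δ ≤ 1 / 100) (M : ℝ) :
    ∃ a b c : Fin 3 → ℤ, M ≤ ‖b‖ ∧ det3 a b c ≠ 0 ∧ ‖a‖ ≤ ‖b‖ ^ (g - 1 + 12 * δ) ∧
      |val ζ a| ≤ ‖b‖ ^ (-(g + 1) + 12 * δ) ∧ |val ζ b| ≤ ‖b‖ ^ (-(2 * g + 1) + 12 * δ) ∧
      ‖c‖ ≤ ‖b‖ ^ (g + 12 * δ) ∧ |val ζ c| ≤ ‖b‖ ^ (-(2 * g + 1) + 12 * δ) := by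
  obtain ⟨K, hK, hres⟩ := hP.exists_log_res_bound hζ (η := g + 1 - δ) (by linarith)
    (hu _ (by linarith))
  have hlog := Real.tendsto_log_atTop.comp hP.tendsto_norm
  obtain ⟨n, hn⟩ := Filter.eventually_atTop.1 (((hres.and
    (hP.eventually_abs_val_le (η' := g + 1 - δ) (η := g + 1 - δ / 2) (by linarith)
    (hu _ (by linarith)))).and (hlog.eventually_ge_atTop ((K + Real.log 8) / δ))).and
    (hP.tendsto_norm.eventually_ge_atTop M))
  obtain ⟨h₀, hh₀, hlt⟩ : ∃ h ≥ n, ‖P h‖ < ‖P (h + 1)‖ := by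
    by_contra! hcon
    obtain ⟨i, hi, hi'⟩ := ((hP.tendsto_norm.eventually_gt_atTop ‖P n‖).and
      (Filter.eventually_ge_atTop n)).exists
    have : ∀ j ≥ n, ‖P j‖ ≤ ‖P n‖ := fun j hj => by
      induction j, hj using Nat.le_induction with
      | base => exact le_rfl
      | succ j hj ih => exact (hcon j hj).trans ih
    exact absurd (this i hi') (not_le.2 hi)
  have hl8 : 0 < Real.log 8 := Real.log_pos (by norm_num)
  have hl68 : Real.log 6 ≤ Real.log 8 := Real.log_le_log (by norm_num) (by norm_num)
  have hl28 : Real.log 2 ≤ Real.log 8 := Real.log_le_log (by norm_num) (by norm_num)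
  have pos (i : ℕ) : 0 < ‖P i‖ := one_pos.trans_le (hP.one_le i)
  have vpos (i : ℕ) : 0 < |val ζ (P i)| := abs_pos.2 (hP.ne i)
  have big (i : ℕ) (hi : n ≤ i) : K + Real.log 8 ≤ δ * Real.log ‖P i‖ := by
    have := (div_le_iff₀ hδ).1 (hn i hi).1.2
    simp only [Function.comp_apply] at this
    linarith
  have dec (i : ℕ) (hi : n ≤ i) :
      Real.log |val ζ (P i)| ≤ -(g + 1 - δ) * Real.log ‖P (i + 1)‖ := by
    rw [← Real.log_rpow (pos _)]
    exact Real.log_le_log (vpos i) (hn i hi).1.1.2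
  have mono {i j : ℕ} (hij : i ≤ j) : Real.log ‖P i‖ ≤ Real.log ‖P j‖ :=
    Real.log_le_log (pos i) (hP.mono hij)
  have growth (m : ℕ) (hm : n ≤ m) (hd : det3 (P m) (P (m + 1)) (P (m + 2)) ≠ 0) :
      (g - δ) * Real.log ‖P (m + 1)‖ ≤ Real.log 8 + Real.log ‖P (m + 2)‖ := by
    have := hP.log_det3_bound hd
    have := dec m hm
    linarith
  have h1u := hu 2 (by linarith)
  obtain ⟨m, hm, hd, -, -⟩ := hP.exists_leave hζ one_lt_two h1u hlt
  have gm := growth m (by omega) hd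
  have bm := big (m + 1) (by omega)
  have two : 2 * ‖P (m + 1)‖ ≤ ‖P (m + 2)‖ := by
    rw [← Real.log_le_log_iff (by have := pos (m + 1); positivity) (pos _),
      Real.log_mul (by norm_num) (pos _).ne']
    have : 0 ≤ Real.log ‖P (m + 1)‖ := Real.log_nonneg (hP.one_le _)
    nlinarith
  obtain ⟨m', hm', hd1, hd2, hgap⟩ := hP.exists_leave hζ one_lt_two h1u
    (h := m + 1) (by have := pos (m + 1); change _ < ‖P (m + 2)‖; linarith)
  have gap : Real.log |val ζ (P (m + 1))| + Real.log ‖P (m + 2)‖ ≤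
      Real.log 8 + Real.log ‖P (m' + 1)‖ + Real.log |val ζ (P m')| := by
    rw [← Real.log_mul (vpos _).ne' (pos _).ne', ← Real.log_mul (by norm_num) (pos _).ne',
      ← Real.log_mul (by have := pos (m' + 1); positivity) (vpos _).ne']
    refine Real.log_le_log (mul_pos (vpos _) (pos _)) ?_
    have t1 : |val ζ (P (m + 2))| * ‖P (m + 1)‖ ≤ |val ζ (P (m + 1))| * ‖P (m + 1)‖ :=
      mul_le_mul_of_nonneg_right (hP.next (m + 1)).2.1.le (norm_nonneg _)
    have t2 := mul_le_mul_of_nonneg_left two (vpos (m + 1)).le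
    change |val ζ (P (m + 1))| * ‖P (m + 2)‖ - |val ζ (P (m + 2))| * ‖P (m + 1)‖ ≤ _ at hgap
    linarith
  have bk := big (m' + 1) (by omega)
  have hb1 := (hn (m + 1) (by omega)).1.1.1
  have hb2 := (hn (m' + 1) (by omega)).1.1.1
  have dk := dec (m' + 1) (by omega)
  obtain ⟨r1, r2, r3, r4⟩ := golden_log_bounds (v := Real.log |val ζ (P (m + 1))|) hg hg1 hg2 hδ hδ1
    (Real.log_nonneg (hP.one_le (m + 1))) (mono (by omega : m + 1 ≤ m + 2))
    (mono (by omega : m + 2 ≤ m' + 1)) (mono (by omega : m' + 1 ≤ m' + 2))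
    (by linarith) (by linarith) (by linarith) (dec m' (by omega)) (by linarith)
    (by linarith [growth m' (by omega) hd1]) dk
  have vk : |val ζ (P (m' + 1))| ≤ ‖P (m' + 1)‖ ^ (-(2 * g + 1) + 12 * δ) :=
    (Real.le_rpow_iff_log_le (vpos _) (pos _)).2 r4
  refine ⟨P (m + 1), P (m' + 1), P (m' + 2), (hn _ (by omega)).2, hd2,
    (Real.le_rpow_iff_log_le (pos _) (pos _)).2 r1,
    (Real.le_rpow_iff_log_le (vpos _) (pos _)).2 r2, vk,
    (Real.le_rpow_iff_log_le (pos _) (pos _)).2 r3, (hP.next (m' + 1)).2.1.le.trans vk⟩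

lemma max_mul_norm_le {r₀ r₁ : ℤ} {s : Fin 3 → ℤ} {M : ℝ}
    (h0 : |((r₀ * s 0 : ℤ) : ℝ)| ≤ M) (h1 : |((r₀ * s 1 + r₁ * s 0 : ℤ) : ℝ)| ≤ M)
    (h2 : |((r₀ * s 2 + r₁ * s 1 : ℤ) : ℝ)| ≤ M) (h3 : |((r₁ * s 2 : ℤ) : ℝ)| ≤ M) :
    max |(r₀ : ℝ)| |(r₁ : ℝ)| * ‖s‖ ≤ 3 * M := by
  push_cast at h0 h1 h2 h3
  obtain ⟨i, hi⟩ := exists_abs_coord_eq s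
  rw [← hi]
  have hM := (abs_nonneg _).trans h0
  have t1 : |(r₀ : ℝ)| * |(s 1 : ℝ)| ≤ M + |(r₁ : ℝ)| * |(s 0 : ℝ)| := by
    have := abs_sub (r₀ * s 1 + r₁ * s 0 : ℝ) (r₁ * s 0)
    rw [add_sub_cancel_right, abs_mul, abs_mul] at this
    linarith
  have t1' : |(r₁ : ℝ)| * |(s 0 : ℝ)| ≤ M + |(r₀ : ℝ)| * |(s 1 : ℝ)| := by
    have := abs_sub (r₀ * s 1 + r₁ * s 0 : ℝ) (r₀ * s 1)
    rw [add_sub_cancel_left, abs_mul, abs_mul] at this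
    linarith
  have t2 : |(r₀ : ℝ)| * |(s 2 : ℝ)| ≤ M + |(r₁ : ℝ)| * |(s 1 : ℝ)| := by
    have := abs_sub (r₀ * s 2 + r₁ * s 1 : ℝ) (r₁ * s 1)
    rw [add_sub_cancel_right, abs_mul, abs_mul] at this
    linarith
  have t2' : |(r₁ : ℝ)| * |(s 1 : ℝ)| ≤ M + |(r₀ : ℝ)| * |(s 2 : ℝ)| := by
    have := abs_sub (r₀ * s 2 + r₁ * s 1 : ℝ) (r₀ * s 2)
    rw [add_sub_cancel_left, abs_mul, abs_mul] at this
    linarith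
  rw [abs_mul] at h0 h3
  rcases le_total |(r₀ : ℝ)| |(r₁ : ℝ)| with h | h
  · rw [max_eq_right h]
    have k (j : Fin 3) : |(r₀ : ℝ)| * |(s j : ℝ)| ≤ |(r₁ : ℝ)| * |(s j : ℝ)| := by gcongr
    have k0 := k 0
    have k1 := k 1
    have k2 := k 2
    fin_cases i <;> simp only [Fin.zero_eta, Fin.mk_one, Fin.reduceFinMk] <;> linarith
  · rw [max_eq_left h]
    have k (j : Fin 3) : |(r₁ : ℝ)| * |(s j : ℝ)| ≤ |(r₀ : ℝ)| * |(s j : ℝ)| := by gcongr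
    have k0 := k 0
    have k1 := k 1
    have k2 := k 2
    fin_cases i <;> simp only [Fin.zero_eta, Fin.mk_one, Fin.reduceFinMk] <;> linarith

lemma mul_res_eq_linRes_mul_res {a b s : Fin 3 → ℤ} {l₀ l₁ r₀ r₁ : ℤ} (ha : a 2 ≠ 0)
    (h0 : r₀ * s 0 = l₀ * a 0 + b 0) (h1 : r₀ * s 1 + r₁ * s 0 = l₀ * a 1 + l₁ * a 0 + b 1)
    (h2 : r₀ * s 2 + r₁ * s 1 = l₀ * a 2 + l₁ * a 1 + b 2) (h3 : r₁ * s 2 = l₁ * a 2) :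
    a 2 * res a b = linRes r₀ r₁ a * res s a := by
  have e0 : b 0 = r₀ * s 0 - l₀ * a 0 := by linarith
  have e1 : b 1 = r₀ * s 1 + r₁ * s 0 - l₀ * a 1 - l₁ * a 0 := by linarith
  have e2 : b 2 = r₀ * s 2 + r₁ * s 1 - l₀ * a 2 - l₁ * a 1 := by linarith
  have e3 : (l₁ : ℚ) = r₁ * s 2 / a 2 := by
    rw [eq_div_iff (by exact_mod_cast ha)]; exact_mod_cast h3.symm
  have ha' : (a 2 : ℚ) ≠ 0 := by exact_mod_cast ha
  have : ((a 2 * res a b : ℤ) : ℚ) = (linRes r₀ r₁ a * res s a : ℤ) := by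
    simp only [res, linRes, e0, e1, e2]
    push_cast
    rw [e3]
    field_simp
    ring
  exact_mod_cast this

lemma not_factor_of_det3_eq_zero {a b c s : Fin 3 → ℤ} {l₀ l₁ r₀ r₁ : ℤ} (hs : s 2 ≠ 0)
    (hl : l₁ ≠ 0) (hres : res a b ≠ 0) (hD : det3 a b c ≠ 0) (hsab : det3 s a b = 0)
    (hsbc : det3 s b c = 0) (h0 : r₀ * s 0 = l₀ * a 0 + b 0)
    (h1 : r₀ * s 1 + r₁ * s 0 = l₀ * a 1 + l₁ * a 0 + b 1)
    (h2 : r₀ * s 2 + r₁ * s 1 = l₀ * a 2 + l₁ * a 1 + b 2) (h3 : r₁ * s 2 = l₁ * a 2) :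
    False := by
  obtain ⟨D, hDd⟩ : ∃ D, D = det3 a b c := ⟨_, rfl⟩
  obtain ⟨E, hE⟩ : ∃ E, E = det3 a s c := ⟨_, rfl⟩
  rw [← hDd] at hD
  have cr (i : Fin 3) : D * s i = E * b i := by
    have : det3 a b c * s i = det3 s b c * a i + det3 a s c * b i + det3 s a b * c i := by
      fin_cases i <;> simp only [det3, Fin.zero_eta, Fin.mk_one, Fin.reduceFinMk] <;> ring
    rw [hsbc, hsab, ← hDd, ← hE] at this
    linarith
  have c0 := cr 0
  have c1 := cr 1
  have c2 := cr 2
  have hb : b 2 ≠ 0 := by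
    intro hb
    rw [hb, mul_zero] at c2
    exact mul_ne_zero hD hs c2
  have f0 : (E * r₀ - D) * b 0 = D * (l₀ * a 0) := by linear_combination D * h0 - r₀ * c0
  have f1 : (E * r₀ - D) * b 1 + E * r₁ * b 0 = D * (l₀ * a 1 + l₁ * a 0) := by
    linear_combination D * h1 - r₀ * c1 - r₁ * c0
  have f2 : (E * r₀ - D) * b 2 + E * r₁ * b 1 = D * (l₀ * a 2 + l₁ * a 1) := by
    linear_combination D * h2 - r₀ * c2 - r₁ * c1
  have f3 : E * r₁ * b 2 = D * (l₁ * a 2) := by linear_combination D * h3 - r₁ * c2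
  obtain ⟨u₀, hu0⟩ : ∃ u, u = E * r₀ - D := ⟨_, rfl⟩
  obtain ⟨u₁, hu1⟩ : ∃ u, u = E * r₁ := ⟨_, rfl⟩
  rw [← hu0] at f0 f1 f2
  rw [← hu1] at f1 f2 f3
  obtain ⟨m, hm⟩ : ∃ m, m = a 0 * b 2 - a 2 * b 0 := ⟨_, rfl⟩
  obtain ⟨n, hn⟩ : ∃ n, n = a 1 * b 2 - a 2 * b 1 := ⟨_, rfl⟩
  obtain ⟨n₀, hn0⟩ : ∃ n₀, n₀ = (m * b 2 - n * b 1) * u₀ - D * ((m * a 2 - n * a 1) * l₀) :=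
    ⟨_, rfl⟩
  obtain ⟨n₁, hn1⟩ : ∃ n₁, n₁ = (m * b 2 - n * b 1) * u₁ - n * b 2 * u₀ -
    D * ((m * a 2 - n * a 1) * l₁ - n * a 2 * l₀) := ⟨_, rfl⟩
  obtain ⟨n₂, hn2⟩ : ∃ n₂, n₂ = - (n * b 2 * u₁) + D * (n * a 2 * l₁) := ⟨_, rfl⟩
  have g2 : n₂ = 0 := by linear_combination hn2 - n * f3
  have g1 : b 2 * n₁ = 0 := by
    rw [hn1]
    linear_combination (m * b 2 - n * b 1) * f3 - n * b 2 * f2 + n * f3 * b 1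
  have g1' := (mul_eq_zero.1 g1).resolve_left hb
  have g0 : b 2 * n₀ + b 1 * n₁ = 0 := by
    rw [hn0, hn1, hm, hn]
    linear_combination ((a 0 * b 2 - a 2 * b 0) * b 2 - (a 1 * b 2 - a 2 * b 1) * b 1) * f2 -
      (a 1 * b 2 - a 2 * b 1) * b 2 * f1 + (a 1 * b 2 - a 2 * b 1) * b 0 * f3
  rw [g1', mul_zero, add_zero] at g0
  have g0' := (mul_eq_zero.1 g0).resolve_left hb
  have g : b 1 * n₀ + b 0 * n₁ = res a b * (D * l₁) := by
    rw [hn0, hn1, res, hm, hn]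
    linear_combination ((a 0 * b 2 - a 2 * b 0) * b 2 - (a 1 * b 2 - a 2 * b 1) * b 1) * f1 -
      (a 1 * b 2 - a 2 * b 1) * b 2 * f0
  rw [g0', g1', mul_zero, mul_zero, add_zero] at g
  exact mul_ne_zero hres (mul_ne_zero hD hl) g.symm

lemma log_nonneg_or_of_one_le_add {x y : ℝ} (h : 1 ≤ x + y) :
    0 ≤ Real.log (2 * x) ∨ 0 ≤ Real.log (2 * y) := by
  rcases le_total y x with hx | hx
  · exact Or.inl (Real.log_nonneg (by linarith))
  · exact Or.inr (Real.log_nonneg (by linarith))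

lemma log_res_bound {ζ : ℝ} {a b : Fin 3 → ℤ} (ha : val ζ a ≠ 0) (hb : val ζ b ≠ 0)
    (h : res a b ≠ 0) :
    0 ≤ Real.log (4 * (2 + |ζ|)) + Real.log |val ζ a| + Real.log ‖a‖ + 2 * Real.log ‖b‖ ∨
      0 ≤ Real.log (4 * (2 + |ζ|)) + Real.log |val ζ b| + 2 * Real.log ‖a‖ + Real.log ‖b‖ := by
  have na := one_pos.trans_le (norm_pos_of_val_ne_zero ha)
  have nb := one_pos.trans_le (norm_pos_of_val_ne_zero hb)
  have va := abs_pos.2 ha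
  have vb := abs_pos.2 hb
  have k := one_le_of_res_ne_zero ζ h
  rw [mul_add] at k
  refine (log_nonneg_or_of_one_le_add k).imp (fun t => t.trans_eq ?_) (fun t => t.trans_eq ?_)
  · rw [show 2 * (2 * (2 + |ζ|) * (|val ζ a| * (‖a‖ * ‖b‖ ^ 2))) =
      4 * (2 + |ζ|) * |val ζ a| * ‖a‖ * ‖b‖ ^ 2 by ring,
      Real.log_mul (by positivity) (by positivity),
      Real.log_mul (by positivity) na.ne', Real.log_mul (by positivity) va.ne', Real.log_pow]
    norm_num
  · rw [show 2 * (2 * (2 + |ζ|) * (|val ζ b| * (‖a‖ ^ 2 * ‖b‖))) =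
      4 * (2 + |ζ|) * |val ζ b| * ‖a‖ ^ 2 * ‖b‖ by ring,
      Real.log_mul (by positivity) (by positivity),
      Real.log_mul (by positivity) (by positivity), Real.log_mul (by positivity) vb.ne',
      Real.log_pow]
    norm_num

lemma log_det3_bound {ζ : ℝ} {a b c : Fin 3 → ℤ} (ha : val ζ a ≠ 0) (hb : val ζ b ≠ 0)
    (hc : val ζ c ≠ 0) (h : det3 a b c ≠ 0) :
    0 ≤ Real.log 6 + Real.log |val ζ a| + Real.log ‖b‖ + Real.log ‖c‖ ∨
      0 ≤ Real.log 6 + Real.log |val ζ b| + Real.log ‖a‖ + Real.log ‖c‖ ∨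
      0 ≤ Real.log 6 + Real.log |val ζ c| + Real.log ‖a‖ + Real.log ‖b‖ := by
  have e {x y z : ℝ} (hx : 0 < x) (hy : 0 < y) (hz : 0 < z) :
      Real.log 6 + Real.log x + Real.log y + Real.log z = Real.log (6 * (x * (y * z))) := by
    rw [Real.log_mul (by norm_num) (by positivity), Real.log_mul hx.ne' (by positivity),
      Real.log_mul hy.ne' hz.ne']
    ring
  have na := one_pos.trans_le (norm_pos_of_val_ne_zero ha)
  have nb := one_pos.trans_le (norm_pos_of_val_ne_zero hb)
  have nc := one_pos.trans_le (norm_pos_of_val_ne_zero hc)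
  have k := one_le_of_det3_ne_zero ζ h
  rw [e (abs_pos.2 ha) nb nc, e (abs_pos.2 hb) na nc, e (abs_pos.2 hc) na nb]
  by_contra! hcon
  obtain ⟨h1, h2, h3⟩ := hcon
  rw [Real.log_neg_iff (by have := abs_pos.2 ha; positivity)] at h1
  rw [Real.log_neg_iff (by have := abs_pos.2 hb; positivity)] at h2
  rw [Real.log_neg_iff (by have := abs_pos.2 hc; positivity)] at h3
  linarith

lemma log_linRes_bound {ζ : ℝ} {r₀ r₁ : ℤ} {a : Fin 3 → ℤ} (ha : val ζ a ≠ 0)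
    (hr : r₀ + r₁ * ζ ≠ 0) (hr1 : r₁ ≠ 0) (h : linRes r₀ r₁ a ≠ 0) :
    0 ≤ Real.log (4 * (2 + |ζ|)) + Real.log |val ζ a| +
        2 * Real.log (max |(r₀ : ℝ)| |(r₁ : ℝ)|) ∨
      0 ≤ Real.log (4 * (2 + |ζ|)) + Real.log |r₀ + r₁ * ζ| +
        Real.log (max |(r₀ : ℝ)| |(r₁ : ℝ)|) + Real.log ‖a‖ := by
  have hm : 0 < max |(r₀ : ℝ)| |(r₁ : ℝ)| :=
    lt_max_of_lt_right (abs_pos.2 (by exact_mod_cast hr1))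
  have k := one_le_of_linRes_ne_zero ζ (le_max_left |(r₀ : ℝ)| |(r₁ : ℝ)|)
    (le_max_right |(r₀ : ℝ)| |(r₁ : ℝ)|) h
  set m := max |(r₀ : ℝ)| |(r₁ : ℝ)|
  have na := one_pos.trans_le (norm_pos_of_val_ne_zero ha)
  have va := abs_pos.2 ha
  have vr := abs_pos.2 hr
  have hz : Real.log (2 * (2 + |ζ|)) ≤ Real.log (4 * (2 + |ζ|)) :=
    Real.log_le_log (by positivity) (by have := abs_nonneg ζ; linarith)
  have hz' : Real.log 2 ≤ Real.log (4 * (2 + |ζ|)) :=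
    Real.log_le_log (by positivity) (by have := abs_nonneg ζ; linarith)
  refine (log_nonneg_or_of_one_le_add k).imp (fun t => ?_) (fun t => ?_)
  · rw [Real.log_mul (by norm_num) (by positivity), Real.log_mul va.ne' (by positivity),
      Real.log_pow] at t
    push_cast at t
    linarith
  · rw [← mul_assoc, Real.log_mul (by positivity) (by positivity),
      Real.log_mul (by positivity) na.ne', Real.log_mul vr.ne' hm.ne'] at t
    linarith

lemma exists_log_linear_bound {ζ η : ℝ} (hζ : Transcendental ℚ ζ) (hη : 2 < η) (hu : Unif ζ η) :
    ∃ K, ∀ r₀ r₁ : ℤ, ¬ (r₀ = 0 ∧ r₁ = 0) → ∀ h : ℝ, |(r₀ : ℝ)| ≤ h → |(r₁ : ℝ)| ≤ h →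
      0 ≤ K + Real.log |r₀ + r₁ * ζ| + 2 * Real.log h := by
  obtain ⟨c, hc, H⟩ := exists_le_linear hζ hη hu
  refine ⟨-Real.log c, fun r₀ r₁ hr h h0 h1 => ?_⟩
  have hh : 0 < h := by
    by_contra! hcon
    apply hr
    have e0 := abs_eq_zero.1 (le_antisymm (h0.trans hcon) (abs_nonneg _))
    have e1 := abs_eq_zero.1 (le_antisymm (h1.trans hcon) (abs_nonneg _))
    exact ⟨by exact_mod_cast e0, by exact_mod_cast e1⟩
  have k := Real.log_le_log hc (H r₀ r₁ hr h h0 h1)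
  rw [Real.log_mul (abs_ne_zero.2 (linear_ne_zero hζ hr)) (by positivity), Real.log_pow] at k
  push_cast at k
  linarith

lemma exists_log_bound_of_res_eq_zero {ζ η : ℝ} (hζ : Transcendental ℚ ζ) (hη : 2 < η)
    (hu : Unif ζ η) : ∃ K, ∀ a b : Fin 3 → ℤ, ¬ Par a b → res a b = 0 → val ζ a ≠ 0 →
      val ζ b ≠ 0 →
      0 ≤ K + 2 * Real.log |val ζ a| + Real.log ‖a‖ + 3 * Real.log ‖b‖ ∨
      0 ≤ K + 2 * Real.log |val ζ b| + 3 * Real.log ‖a‖ + Real.log ‖b‖ := by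
  obtain ⟨c, hc, H⟩ := exists_le_of_res_eq_zero hζ hη hu
  refine ⟨Real.log (4 / c), fun a b hp h ha hb => ?_⟩
  have na := one_pos.trans_le (norm_pos_of_val_ne_zero ha)
  have nb := one_pos.trans_le (norm_pos_of_val_ne_zero hb)
  have va := abs_pos.2 ha
  have vb := abs_pos.2 hb
  have k := H a b hp h
  rcases le_total (|val ζ b| * ‖a‖) (|val ζ a| * ‖b‖) with t | t
  · left
    have k' : c ≤ 4 * |val ζ a| ^ 2 * ‖a‖ * ‖b‖ ^ 3 := calc
      c ≤ ‖a‖ * ‖b‖ * (|val ζ a| * ‖b‖ + |val ζ b| * ‖a‖) ^ 2 := k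
      _ ≤ ‖a‖ * ‖b‖ * (|val ζ a| * ‖b‖ + |val ζ a| * ‖b‖) ^ 2 := by gcongr
      _ = _ := by ring
    have k2 := Real.log_le_log hc k'
    rw [Real.log_mul (by positivity) (by positivity), Real.log_mul (by positivity) na.ne',
      Real.log_mul (by norm_num) (by positivity), Real.log_pow, Real.log_pow] at k2
    rw [Real.log_div (by norm_num) hc.ne']
    push_cast at k2
    linarith
  · right
    have k' : c ≤ 4 * |val ζ b| ^ 2 * ‖a‖ ^ 3 * ‖b‖ := calc
      c ≤ ‖a‖ * ‖b‖ * (|val ζ a| * ‖b‖ + |val ζ b| * ‖a‖) ^ 2 := k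
      _ ≤ ‖a‖ * ‖b‖ * (|val ζ b| * ‖a‖ + |val ζ b| * ‖a‖) ^ 2 := by gcongr
      _ = _ := by ring
    have k2 := Real.log_le_log hc k'
    rw [Real.log_mul (by positivity) nb.ne', Real.log_mul (by positivity) (by positivity),
      Real.log_mul (by norm_num) (by positivity), Real.log_pow, Real.log_pow] at k2
    rw [Real.log_div (by norm_num) hc.ne']
    push_cast at k2
    linarith

lemma not_factor {ζ K T p d M : ℝ} {a b c : Fin 3 → ℤ} {l₀ l₁ : ℤ} (hζ : Transcendental ℚ ζ)
    (hlin : ∀ r₀ r₁ : ℤ, ¬ (r₀ = 0 ∧ r₁ = 0) → ∀ h : ℝ, |(r₀ : ℝ)| ≤ h → |(r₁ : ℝ)| ≤ h →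
      0 ≤ K + Real.log |r₀ + r₁ * ζ| + 2 * Real.log h)
    (hK : Real.log (4 * (2 + |ζ|)) ≤ d) (hKd : K ≤ d) (hT : 0 < T) (hd : 1000 * d ≤ T)
    (hp : 1.618 * T ≤ p) (hp' : p ≤ 1.6181 * T) (hb : Real.log ‖b‖ = T)
    (ha : Real.log ‖a‖ ≤ p - T + d) (hva : Real.log |val ζ a| ≤ -p - T + d)
    (hvb : Real.log |val ζ b| ≤ -2 * p - T + d) (hc : Real.log ‖c‖ ≤ p + d)
    (hvc : Real.log |val ζ c| ≤ -2 * p - T + d) (hD : det3 a b c ≠ 0) (hres : res a b ≠ 0)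
    (ha2 : a 2 ≠ 0) (hl : l₁ ≠ 0) (hM : Real.log (3 * M) ≤ T + 3 * d)
    (h0 : |((l₀ * a 0 + b 0 : ℤ) : ℝ)| ≤ M)
    (h1 : |((l₀ * a 1 + l₁ * a 0 + b 1 : ℤ) : ℝ)| ≤ M)
    (h2 : |((l₀ * a 2 + l₁ * a 1 + b 2 : ℤ) : ℝ)| ≤ M) (h3 : |((l₁ * a 2 : ℤ) : ℝ)| ≤ M)
    (hv : |(l₀ + l₁ * ζ) * val ζ a + val ζ b| ≤ Real.exp (-3 * T + 2 * d))
    {r₀ r₁ : ℤ} {s : Fin 3 → ℤ} (e0 : r₀ * s 0 = l₀ * a 0 + b 0)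
    (e1 : r₀ * s 1 + r₁ * s 0 = l₀ * a 1 + l₁ * a 0 + b 1)
    (e2 : r₀ * s 2 + r₁ * s 1 = l₀ * a 2 + l₁ * a 1 + b 2) (e3 : r₁ * s 2 = l₁ * a 2) :
    False := by
  have hrs : r₁ * s 2 ≠ 0 := e3 ▸ mul_ne_zero hl ha2
  have hr1 := left_ne_zero_of_mul hrs
  have hs2 := right_ne_zero_of_mul hrs
  have ne {x : Fin 3 → ℤ} (hx : x ≠ 0) : val ζ x ≠ 0 := val_ne_zero hζ hx
  have na : val ζ a ≠ 0 := ne fun h => ha2 (by simp [h])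
  have nb : val ζ b ≠ 0 := ne fun h => hD (by simp [det3, h])
  have nc : val ζ c ≠ 0 := ne fun h => hD (by simp [det3, h])
  have ns : val ζ s ≠ 0 := ne fun h => hs2 (by simp [h])
  have nr : r₀ + r₁ * ζ ≠ 0 := linear_ne_zero hζ fun h => hr1 h.2
  have hid := mul_res_eq_linRes_mul_res ha2 e0 e1 e2 e3
  have hid0 : linRes r₀ r₁ a * res s a ≠ 0 := hid ▸ mul_ne_zero ha2 hres
  have hlr := log_linRes_bound na nr hr1 (left_ne_zero_of_mul hid0)
  have hrr := log_res_bound ns na (right_ne_zero_of_mul hid0)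
  have hlb := hlin r₀ r₁ (fun h => hr1 h.2) _ (le_max_left |(r₀ : ℝ)| |(r₁ : ℝ)|)
    (le_max_right |(r₀ : ℝ)| |(r₁ : ℝ)|)
  have hht := max_mul_norm_le (e0 ▸ h0) (e1 ▸ h1) (e2 ▸ h2) (e3 ▸ h3)
  have hm1 : 1 ≤ max |(r₀ : ℝ)| |(r₁ : ℝ)| := le_max_of_le_right (one_le_abs_cast hr1)
  set m := max |(r₀ : ℝ)| |(r₁ : ℝ)|
  have hs1 := norm_pos_of_val_ne_zero ns
  have hmul : (l₀ + l₁ * ζ) * val ζ a + val ζ b = (r₀ + r₁ * ζ) * val ζ s := by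
    have e0' : (r₀ * s 0 : ℝ) = l₀ * a 0 + b 0 := by exact_mod_cast e0
    have e1' : (r₀ * s 1 + r₁ * s 0 : ℝ) = l₀ * a 1 + l₁ * a 0 + b 1 := by exact_mod_cast e1
    have e2' : (r₀ * s 2 + r₁ * s 1 : ℝ) = l₀ * a 2 + l₁ * a 1 + b 2 := by exact_mod_cast e2
    have e3' : (r₁ * s 2 : ℝ) = l₁ * a 2 := by exact_mod_cast e3
    simp only [val]
    linear_combination -e0' - ζ * e1' - ζ ^ 2 * e2' - ζ ^ 3 * e3'
  rw [hmul, abs_mul, ← Real.log_le_iff_le_exp (mul_pos (abs_pos.2 nr) (abs_pos.2 ns)),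
    Real.log_mul (abs_ne_zero.2 nr) (abs_ne_zero.2 ns)] at hv
  have hht' := (Real.log_le_log (by positivity) hht).trans hM
  rw [Real.log_mul (by positivity) (by positivity)] at hht'
  have m0 := Real.log_nonneg hm1
  have s0 := Real.log_nonneg hs1
  have hl8 : Real.log 6 ≤ Real.log (4 * (2 + |ζ|)) :=
    Real.log_le_log (by norm_num) (by have := abs_nonneg ζ; linarith)
  have hlr' : 0 ≤ Real.log (4 * (2 + |ζ|)) + Real.log |r₀ + r₁ * ζ| + Real.log m + Real.log ‖a‖ :=
    hlr.resolve_left (by intro; linarith)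
  have hrr' : 0 ≤ Real.log (4 * (2 + |ζ|)) + Real.log |val ζ a| + 2 * Real.log ‖s‖ +
      Real.log ‖a‖ := hrr.resolve_left (by intro; linarith)
  have hm5 : Real.log m ≤ 5 * d := by linarith
  have hvs : Real.log |val ζ s| ≤ -3 * T + 14 * d := by linarith
  refine not_factor_of_det3_eq_zero hs2 hl hres hD ?_ ?_ e0 e1 e2 e3
  · by_contra h
    rcases log_det3_bound ns na nb h with t | t | t <;> linarith
  · by_contra h
    rcases log_det3_bound ns nb nc h with t | t | t <;> linarith

lemma exists_linear_form (ζ : ℝ) {Y : ℝ} (hY : 1 ≤ Y) : ∃ l₀ l₁ : ℤ, l₁ ≠ 0 ∧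
    |(l₀ : ℝ)| ≤ (1 + |ζ|) * Y ∧ |(l₁ : ℝ)| ≤ (1 + |ζ|) * Y ∧ |l₀ + l₁ * ζ| ≤ Y⁻¹ := by
  have hn : 0 < ⌊Y⌋₊ := Nat.floor_pos.2 hY
  obtain ⟨j, k, hk, hkn, hjk⟩ := Real.exists_int_int_abs_mul_sub_le ζ hn
  have hkY : |(k : ℝ)| ≤ Y := by
    rw [abs_of_pos (by exact_mod_cast hk)]
    exact le_trans (by exact_mod_cast hkn) (Nat.floor_le (by linarith))
  have hlin : |k * ζ - j| ≤ Y⁻¹ := by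
    refine hjk.trans ?_
    rw [one_div]
    exact inv_anti₀ (by linarith) (Nat.lt_floor_add_one Y).le
  have hz := abs_nonneg ζ
  refine ⟨-j, k, hk.ne', ?_, ?_, ?_⟩
  · have t := abs_sub (k * ζ - j) (k * ζ)
    rw [abs_mul, show (k * ζ - j - k * ζ : ℝ) = ((-j : ℤ) : ℝ) by push_cast; ring] at t
    have : |(k : ℝ)| * |ζ| ≤ Y * |ζ| := by gcongr
    have : Y⁻¹ ≤ 1 := inv_le_one_of_one_le₀ hY
    linarith
  · nlinarith
  · rwa [show ((-j : ℤ) : ℝ) + k * ζ = k * ζ - j by push_cast; ring]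

lemma exists_cubic {ζ g δ : ℝ} (hζ : Transcendental ℚ ζ) (hg : g ^ 2 = g + 1)
    (hg1 : 1.618 < g) (hg2 : g < 1.6181) (hu : ∀ η < g + 1, Unif ζ η) (hδ : 0 < δ)
    (hδ1 : δ ≤ 1 / 1000) (M : ℝ) :
    ∃ (H : ℝ) (a b : Fin 3 → ℤ) (l₀ l₁ : ℤ), M ≤ H ∧ a 2 ≠ 0 ∧ l₁ ≠ 0 ∧
      |((l₀ * a 0 + b 0 : ℤ) : ℝ)| ≤ H ^ (1 + 2 * δ) ∧
      |((l₀ * a 1 + l₁ * a 0 + b 1 : ℤ) : ℝ)| ≤ H ^ (1 + 2 * δ) ∧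
      |((l₀ * a 2 + l₁ * a 1 + b 2 : ℤ) : ℝ)| ≤ H ^ (1 + 2 * δ) ∧
      |((l₁ * a 2 : ℤ) : ℝ)| ≤ H ^ (1 + 2 * δ) ∧
      |(l₀ + l₁ * ζ) * val ζ a + val ζ b| ≤ H ^ (-3 + 2 * δ) ∧
      ∀ (r₀ r₁ : ℤ) (s : Fin 3 → ℤ), r₀ * s 0 = l₀ * a 0 + b 0 →
        r₀ * s 1 + r₁ * s 0 = l₀ * a 1 + l₁ * a 0 + b 1 →
        r₀ * s 2 + r₁ * s 1 = l₀ * a 2 + l₁ * a 1 + b 2 → r₁ * s 2 = l₁ * a 2 → False := by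
  obtain ⟨P, hP1, hP2, hP3⟩ := exists_next_seq (show (0 : ℝ) < 2 by norm_num)
    (hu 2 (by linarith))
  have hP : BestSeq ζ P := ⟨hP1, hP2, hP3⟩
  obtain ⟨η, hη, hη'⟩ := exists_between (show 2 < g + 1 by linarith)
  obtain ⟨K₁, hlin⟩ := exists_log_linear_bound hζ hη (hu η hη')
  obtain ⟨K₂, hpar⟩ := exists_log_bound_of_res_eq_zero hζ hη (hu η hη')
  set K₀ := Real.log (4 * (2 + |ζ|)) with hK₀
  obtain ⟨M', hM'⟩ := Filter.eventually_atTop.1 ((Filter.eventually_ge_atTop M).and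
    (Real.tendsto_log_atTop.eventually_ge_atTop ((K₀ + |K₁| + |K₂|) / δ)))
  obtain ⟨a, b, c, hb, hD, ha, hva, hvb, hc, hvc⟩ := hP.exists_triple hζ hg (by linarith)
    (by linarith) hu (show 0 < δ / 12 by positivity) (by linarith) M'
  rw [show 12 * (δ / 12) = δ by ring] at ha hva hvb hc hvc
  obtain ⟨hbM, hbK⟩ := hM' _ hb
  set H := ‖b‖ with hH
  rw [div_le_iff₀ hδ] at hbK
  have hz := abs_nonneg ζ
  have hl8 : Real.log 8 ≤ K₀ := Real.log_le_log (by norm_num) (by linarith)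
  have hl3 : Real.log 3 ≤ Real.log 8 := Real.log_le_log (by norm_num) (by norm_num)
  have hl0 : 0 < Real.log 8 := Real.log_pos (by norm_num)
  have hK1 := le_abs_self K₁
  have hK1' := abs_nonneg K₁
  have hK2 := le_abs_self K₂
  have hK2' := abs_nonneg K₂
  have ne {x : Fin 3 → ℤ} (hx : x ≠ 0) : val ζ x ≠ 0 := val_ne_zero hζ hx
  have a0 : a ≠ 0 := fun h => hD (by simp [det3, h])
  have na : val ζ a ≠ 0 := ne a0
  have nb : val ζ b ≠ 0 := ne fun h => hD (by simp [det3, h])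
  have nc : val ζ c ≠ 0 := ne fun h => hD (by simp [det3, h])
  have hH1 : 1 ≤ H := norm_pos_of_val_ne_zero nb
  have hH0 : 0 < H := by linarith
  have lg {x e : ℝ} (hx : 0 < x) (h : x ≤ H ^ e) : Real.log x ≤ e * Real.log H :=
    (Real.le_rpow_iff_log_le hx hH0).1 h
  have la := lg (one_pos.trans_le (norm_pos_of_val_ne_zero na)) ha
  have lc := lg (one_pos.trans_le (norm_pos_of_val_ne_zero nc)) hc
  have lva := lg (abs_pos.2 na) hva
  have lvb := lg (abs_pos.2 nb) hvb
  have lvc := lg (abs_pos.2 nc) hvc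
  have hT : 0 < Real.log H := by
    by_contra! hcon
    nlinarith
  have p1 : 1.618 * Real.log H ≤ g * Real.log H := by gcongr
  have p2 : g * Real.log H ≤ 1.6181 * Real.log H := by gcongr
  have p3 : δ * Real.log H ≤ 1 / 1000 * Real.log H := by gcongr
  have hres : res a b ≠ 0 := by
    intro h
    have hnp : ¬ Par a b := by
      rintro ⟨h1, h2, h3⟩
      apply hD
      simp only [det3]
      linear_combination c 2 * h1 - c 1 * h2 + c 0 * h3
    rcases hpar a b hnp h na nb with t | t <;> linarith
  have ha2 : a 2 ≠ 0 := by
    intro h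
    have h01 : ¬ (a 0 = 0 ∧ a 1 = 0) := by
      rintro ⟨h0, h1⟩
      apply a0
      ext i
      fin_cases i <;> simp [h0, h1, h]
    have t := hlin (a 0) (a 1) h01 ‖a‖ (abs_coord_le a 0) (abs_coord_le a 1)
    rw [show (a 0 : ℝ) + a 1 * ζ = val ζ a by simp [val, h]] at t
    linarith
  have hKH : 4 * (2 + |ζ|) ≤ H ^ δ := by
    rw [Real.le_rpow_iff_log_le (by positivity) hH0]
    linarith
  obtain ⟨l₀, l₁, hl1, hn0, hn1, hlv⟩ := exists_linear_form ζ
    (Real.one_le_rpow hH1 (show 0 ≤ 2 - g by linarith))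
  have hbH : H ≤ H ^ (1 + δ) := Real.self_le_rpow_of_one_le hH1 (by linarith)
  have hsplit : H ^ (1 + 2 * δ) = H ^ δ * H ^ (1 + δ) := by
    rw [← Real.rpow_add hH0]; congr 1; ring
  have hla {l : ℤ} (hl : |(l : ℝ)| ≤ (1 + |ζ|) * H ^ (2 - g)) (i : Fin 3) :
      |(l : ℝ) * a i| ≤ (1 + |ζ|) * H ^ (1 + δ) := by
    rw [abs_mul, show 1 + δ = (2 - g) + (g - 1 + δ) by ring, Real.rpow_add hH0, ← mul_assoc]
    exact mul_le_mul hl ((abs_coord_le a i).trans ha) (abs_nonneg _) (by positivity)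
  have hbi (i : Fin 3) : |(b i : ℝ)| ≤ H ^ (1 + δ) := (abs_coord_le b i).trans hbH
  have hcoef : (3 + 2 * |ζ|) * H ^ (1 + δ) ≤ H ^ (1 + 2 * δ) := by
    rw [hsplit]; gcongr; linarith
  have hpos : 0 ≤ |ζ| * H ^ (1 + δ) := by positivity
  have hpos' : 0 ≤ H ^ (1 + δ) := by positivity
  have q0 : |((l₀ * a 0 + b 0 : ℤ) : ℝ)| ≤ H ^ (1 + 2 * δ) := by
    push_cast
    have := abs_add_le (l₀ * a 0 : ℝ) (b 0)
    linarith [hla hn0 0, hbi 0]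
  have q1 : |((l₀ * a 1 + l₁ * a 0 + b 1 : ℤ) : ℝ)| ≤ H ^ (1 + 2 * δ) := by
    push_cast
    have := abs_add_three (l₀ * a 1 : ℝ) (l₁ * a 0) (b 1)
    linarith [hla hn0 1, hla hn1 0, hbi 1]
  have q2 : |((l₀ * a 2 + l₁ * a 1 + b 2 : ℤ) : ℝ)| ≤ H ^ (1 + 2 * δ) := by
    push_cast
    have := abs_add_three (l₀ * a 2 : ℝ) (l₁ * a 1) (b 2)
    linarith [hla hn0 2, hla hn1 1, hbi 2]
  have q3 : |((l₁ * a 2 : ℤ) : ℝ)| ≤ H ^ (1 + 2 * δ) := by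
    push_cast
    linarith [hla hn1 2]
  have qv : |(l₀ + l₁ * ζ) * val ζ a + val ζ b| ≤ H ^ (-3 + 2 * δ) := by
    have t1 : |(l₀ + l₁ * ζ) * val ζ a| ≤ H ^ (-3 + δ) := by
      rw [abs_mul, show -3 + δ = -(2 - g) + (-(g + 1) + δ) by ring, Real.rpow_add hH0]
      rw [← Real.rpow_neg hH0.le] at hlv
      exact mul_le_mul hlv hva (abs_nonneg _) (by positivity)
    have t2 : |val ζ b| ≤ H ^ (-3 + δ) :=
      hvb.trans (Real.rpow_le_rpow_of_exponent_le hH1 (by linarith))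
    have t3 : 2 * H ^ (-3 + δ) ≤ H ^ (-3 + 2 * δ) := by
      rw [show -3 + 2 * δ = δ + (-3 + δ) by ring, Real.rpow_add hH0 δ]
      gcongr
      linarith
    have := abs_add_le ((l₀ + l₁ * ζ) * val ζ a) (val ζ b)
    linarith
  refine ⟨H, a, b, l₀, l₁, hbM, ha2, hl1, q0, q1, q2, q3, qv, fun r₀ r₁ s e0 e1 e2 e3 => ?_⟩
  refine not_factor (p := g * Real.log H) (d := δ * Real.log H) hζ hlin (by linarith)
    (by linarith) hT (by linarith) p1 p2 rfl (by linarith) (by linarith) (by linarith)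
    (by linarith) (by linarith) hD hres ha2 hl1 ?_ q0 q1 q2 q3 ?_ e0 e1 e2 e3
  · rw [Real.log_mul (by norm_num) (by positivity), Real.log_rpow hH0]
    linarith
  · refine qv.trans_eq ?_
    rw [Real.rpow_def_of_pos hH0]
    congr 1
    ring

lemma abs_coeff_le_polyH (P : ℤ[X]) (i : ℕ) : |(P.coeff i : ℝ)| ≤ polyH P := by
  rw [polyH, ← Int.cast_abs, Int.abs_eq_natAbs, Int.cast_natCast, Nat.cast_le]
  by_cases h : i ∈ P.support
  · exact Finset.le_sup (f := fun i => (P.coeff i).natAbs) h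
  · simp [notMem_support_iff.1 h]

lemma polyH_le {P : ℤ[X]} {M : ℝ} (hM : 0 ≤ M) (h : ∀ i, |(P.coeff i : ℝ)| ≤ M) :
    polyH P ≤ M := by
  rw [polyH, ← Nat.le_floor_iff hM, Finset.sup_le_iff]
  intro i _
  rw [Nat.le_floor_iff hM]
  have := h i
  rwa [← Int.cast_abs, Int.abs_eq_natAbs, Int.cast_natCast] at this

lemma one_le_polyH {P : ℤ[X]} (h : P ≠ 0) : 1 ≤ polyH P :=
  (one_le_abs_cast (leadingCoeff_ne_zero.2 h)).trans (abs_coeff_le_polyH P _)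

lemma one_le_abs_content {P : ℤ[X]} (h : P ≠ 0) : 1 ≤ |(P.content : ℝ)| :=
  one_le_abs_cast (content_eq_zero_iff.not.2 h)

lemma coeff_eq_content_mul (P : ℤ[X]) (i : ℕ) :
    P.coeff i = P.content * P.primPart.coeff i := by
  conv_lhs => rw [P.eq_C_content_mul_primPart]
  rw [coeff_C_mul]

lemma polyH_primPart_le {P : ℤ[X]} (h : P ≠ 0) {M : ℝ} (hM : 0 ≤ M)
    (hP : ∀ i, |(P.coeff i : ℝ)| ≤ M) : polyH P.primPart ≤ M := by
  refine polyH_le hM fun i => le_trans ?_ (hP i)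
  rw [coeff_eq_content_mul P i]
  push_cast
  rw [abs_mul]
  exact le_mul_of_one_le_left (abs_nonneg _) (one_le_abs_content h)

lemma abs_pev_primPart_le (ζ : ℝ) {P : ℤ[X]} (h : P ≠ 0) : |pev ζ P.primPart| ≤ |pev ζ P| := by
  have e : pev ζ P = P.content * pev ζ P.primPart := by
    rw [pev, P.eq_C_content_mul_primPart, map_mul, aeval_C, ← P.eq_C_content_mul_primPart, pev]
    simp
  rw [e, abs_mul]
  exact le_mul_of_one_le_left (abs_nonneg _) (one_le_abs_content h)

lemma irreducible_primPart_of_natDegree_eq_three {P : ℤ[X]} (hP : P.natDegree = 3)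
    (h : ∀ (r₀ r₁ : ℤ) (s : Fin 3 → ℤ), r₀ * s 0 = P.coeff 0 →
      r₀ * s 1 + r₁ * s 0 = P.coeff 1 → r₀ * s 2 + r₁ * s 1 = P.coeff 2 →
      r₁ * s 2 = P.coeff 3 → False) : Irreducible P.primPart := by
  have hd : P.primPart.natDegree = 3 := by rw [natDegree_primPart, hP]
  have key (f g : ℤ[X]) (hfg : P.primPart = f * g) (hf : f.natDegree = 1)
      (hg : g.natDegree = 2) : False := by
    have hf' (i : ℕ) (hi : 1 < i) : f.coeff i = 0 := coeff_eq_zero_of_natDegree_lt (hf ▸ hi)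
    have hg' (i : ℕ) (hi : 2 < i) : g.coeff i = 0 := coeff_eq_zero_of_natDegree_lt (hg ▸ hi)
    refine h (f.coeff 0) (f.coeff 1) (fun i => P.content * g.coeff i) ?_ ?_ ?_ ?_ <;>
      rw [coeff_eq_content_mul P, hfg, coeff_mul] <;>
      simp [Finset.Nat.antidiagonal_succ, hf', hg'] <;> ring
  have unit (f g : ℤ[X]) (hfg : P.primPart = f * g) (hf : f.natDegree = 0) : IsUnit f := by
    rw [eq_C_of_natDegree_eq_zero hf]
    refine (P.isPrimitive_primPart _ ?_).map C
    rw [← eq_C_of_natDegree_eq_zero hf]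
    exact ⟨g, hfg⟩
  have h0 : P.primPart ≠ 0 := P.primPart_ne_zero
  refine ⟨fun hu => by rw [natDegree_eq_zero_of_isUnit hu] at hd; omega, fun f g hfg => ?_⟩
  have hsum : f.natDegree + g.natDegree = 3 := by
    rw [← hd, hfg, natDegree_mul (left_ne_zero_of_mul (hfg ▸ h0))
      (right_ne_zero_of_mul (hfg ▸ h0))]
  have hgf : P.primPart = g * f := by rw [hfg, mul_comm]
  rcases (show f.natDegree = 0 ∨ g.natDegree = 0 ∨ (f.natDegree = 1 ∧ g.natDegree = 2) ∨
    (g.natDegree = 1 ∧ f.natDegree = 2) by omega) with t | t | t | t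
  · exact Or.inl (unit f g hfg t)
  · exact Or.inr (unit g f hgf t)
  · exact (key f g hfg t.1 t.2).elim
  · exact (key g f hgf t.1 t.2).elim

lemma unif_of_lt_whExp {ζ η : ℝ} (hη : 0 ≤ η) (h : η < whExp 2 ζ) : Unif ζ η := by
  have hne : (whSet 2 ζ).Nonempty := by
    by_contra hcon
    rw [whExp, Set.not_nonempty_iff_eq_empty.1 hcon, Real.sSup_empty] at h
    linarith
  obtain ⟨η', ⟨X₀, hX⟩, hlt⟩ := exists_lt_of_lt_csSup hne h
  refine ⟨max X₀ 1, fun X hX' => ?_⟩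
  obtain ⟨P, hd, hH, h0, hv⟩ := hX X ((le_max_left _ _).trans hX')
  have e : val ζ ![P.coeff 0, P.coeff 1, P.coeff 2] = pev ζ P := by
    rw [pev, aeval_eq_sum_range' (show P.natDegree < 3 by omega)]
    simp [Finset.sum_range_succ, val]
  have hc (i : ℕ) : |(P.coeff i : ℝ)| ≤ X := (abs_coeff_le_polyH P i).trans hH
  refine ⟨![P.coeff 0, P.coeff 1, P.coeff 2], norm_le_of_abs (hc 0) (hc 1) (hc 2), ?_, ?_⟩
  · rw [e]; exact abs_pos.1 h0
  · rw [e]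
    exact hv.trans (Real.rpow_le_rpow_of_exponent_le ((le_max_right _ _).trans hX') (by linarith))

lemma exists_pos_le_abs_pev (ζ M : ℝ) (n : ℕ) : ∃ c > 0, ∀ P : ℤ[X], P.natDegree < n →
    polyH P ≤ M → pev ζ P ≠ 0 → c ≤ |pev ζ P| := by
  obtain ⟨c, hc, h⟩ := exists_pos_le_abs (fun v : Fin n → ℤ => ∑ i, (v i : ℝ) * ζ ^ (i : ℕ)) M
  refine ⟨c, hc, fun P hd hH h0 => ?_⟩
  have e : pev ζ P = ∑ i : Fin n, (P.coeff i : ℝ) * ζ ^ (i : ℕ) := by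
    rw [pev, aeval_eq_sum_range' hd, Fin.sum_univ_eq_sum_range fun i => (P.coeff i : ℝ) * ζ ^ i]
    simp
  rw [e] at h0 ⊢
  refine h (fun i => P.coeff i) ?_ h0
  refine (pi_norm_le_iff_of_nonneg (le_trans ?_ hH)).2 fun i => ?_
  · exact (abs_nonneg _).trans (abs_coeff_le_polyH P 0)
  · rw [Int.norm_eq_abs]
    exact (abs_coeff_le_polyH P i).trans hH

end ExtremalCubic

open ExtremalCubic in
theorem extremal_cubic_infinite (ζ : ℝ) (hζ : IsExtremal ζ) (ε : ℝ) (hε : 0 < ε) :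
    ∀ X₀ : ℝ, ∃ Q : Polynomial ℤ, Irreducible Q ∧ Q.natDegree = 3 ∧
      X₀ ≤ polyH Q ∧ |pev ζ Q| ≤ polyH Q ^ (-3 + ε) := by
  intro X₀
  obtain ⟨htr, hw⟩ := hζ
  have h5 : Real.sqrt 5 ^ 2 = 5 := Real.sq_sqrt (by norm_num)
  have h5l : 2.236 < Real.sqrt 5 := Real.lt_sqrt_of_sq_lt (by norm_num)
  have h5u : Real.sqrt 5 < 2.2362 := (Real.sqrt_lt' (by norm_num)).2 (by norm_num)
  set ε' := min ε 1
  have hε' : 0 < ε' := lt_min hε one_pos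
  have hε1 : ε' ≤ 1 := min_le_right _ _
  set δ := ε' / 1000 with hδ
  have hδ0 : 0 < δ := by positivity
  have hu : ∀ η < (1 + Real.sqrt 5) / 2 + 1, Unif ζ η := by
    intro η hη
    obtain ⟨X, hX⟩ := unif_of_lt_whExp (η := max η 0) (le_max_right _ _)
      (by rw [hw]; exact max_lt (by linarith) (by linarith))
    refine ⟨max X 1, fun Y hY => ?_⟩
    obtain ⟨a, h1, h2, h3⟩ := hX Y ((le_max_left _ _).trans hY)
    exact ⟨a, h1, h2, h3.trans (Real.rpow_le_rpow_of_exponent_le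
      ((le_max_right _ _).trans hY) (neg_le_neg (le_max_left _ _)))⟩
  obtain ⟨c, hc, hcP⟩ := exists_pos_le_abs_pev ζ X₀ 4
  obtain ⟨M, hM⟩ := Filter.eventually_atTop.1 ((Filter.eventually_ge_atTop 1).and
    (eventually_mul_rpow_neg_lt 1 (show 0 < 3 - 2 * δ by linarith) hc))
  obtain ⟨H, a, b, l₀, l₁, hHM, ha2, hl, q0, q1, q2, q3, qv, hfac⟩ := exists_cubic htr
    (g := (1 + Real.sqrt 5) / 2) (by linarith) (by linarith) (by linarith) hu hδ0
    (by linarith) M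
  obtain ⟨hH1, hHc⟩ := hM H hHM
  have hH0 : 0 < H := by linarith
  obtain ⟨P, hP⟩ : ∃ P, P = Cubic.toPoly ⟨l₁ * a 2, l₀ * a 2 + l₁ * a 1 + b 2,
    l₀ * a 1 + l₁ * a 0 + b 1, l₀ * a 0 + b 0⟩ := ⟨_, rfl⟩
  have c3 : P.coeff 3 = l₁ * a 2 := by rw [hP, Cubic.coeff_eq_a]
  have c2 : P.coeff 2 = l₀ * a 2 + l₁ * a 1 + b 2 := by rw [hP, Cubic.coeff_eq_b]
  have c1 : P.coeff 1 = l₀ * a 1 + l₁ * a 0 + b 1 := by rw [hP, Cubic.coeff_eq_c]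
  have c0 : P.coeff 0 = l₀ * a 0 + b 0 := by rw [hP, Cubic.coeff_eq_d]
  have hd : P.natDegree = 3 := by
    rw [hP]; exact Cubic.natDegree_of_a_ne_zero (mul_ne_zero hl ha2)
  have hP0 : P ≠ 0 := by rintro rfl; simp at hd
  have hdQ : P.primPart.natDegree = 3 := by rw [natDegree_primPart, hd]
  have hQ0 : P.primPart ≠ 0 := P.primPart_ne_zero
  have hcoef (i : ℕ) : |(P.coeff i : ℝ)| ≤ H ^ (1 + 2 * δ) := by
    rcases (show i = 0 ∨ i = 1 ∨ i = 2 ∨ i = 3 ∨ 3 < i by omega) with t | t | t | t | t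
    · rw [t, c0]; exact q0
    · rw [t, c1]; exact q1
    · rw [t, c2]; exact q2
    · rw [t, c3]; exact q3
    · rw [coeff_eq_zero_of_natDegree_lt (hd ▸ t)]
      simpa using Real.rpow_nonneg hH0.le _
  have hpev : pev ζ P = (l₀ + l₁ * ζ) * val ζ a + val ζ b := by
    rw [pev, aeval_eq_sum_range, hd]
    simp only [Finset.sum_range_succ, Finset.sum_range_zero, c0, c1, c2, c3, zsmul_eq_mul, val]
    push_cast
    ring
  have hpQ : |pev ζ P.primPart| ≤ H ^ (-3 + 2 * δ) :=
    (abs_pev_primPart_le ζ hP0).trans (hpev ▸ qv)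
  have hHQ := polyH_primPart_le hP0 (Real.rpow_nonneg hH0.le _) hcoef
  have hQ1 := one_le_polyH hQ0
  have hvne : pev ζ P.primPart ≠ 0 := fun h =>
    (htr.restrictScalars (algebraMap ℤ ℚ).injective_int) ⟨_, hQ0, h⟩
  refine ⟨P.primPart, irreducible_primPart_of_natDegree_eq_three hd fun r₀ r₁ s e0 e1 e2 e3 =>
    hfac r₀ r₁ s (e0.trans c0) (e1.trans c1) (e2.trans c2) (e3.trans c3), hdQ, ?_, ?_⟩
  · by_contra! hlt
    have := hcP _ (by omega) hlt.le hvne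
    rw [one_mul, show -(3 - 2 * δ) = -3 + 2 * δ by ring] at hHc
    linarith
  · calc |pev ζ P.primPart| ≤ H ^ (-3 + 2 * δ) := hpQ
      _ ≤ H ^ ((1 + 2 * δ) * (-3 + ε')) :=
        Real.rpow_le_rpow_of_exponent_le hH1 (by nlinarith)
      _ = (H ^ (1 + 2 * δ)) ^ (-3 + ε') := Real.rpow_mul hH0.le _ _
      _ ≤ polyH P.primPart ^ (-3 + ε') :=
        Real.rpow_le_rpow_of_nonpos (by linarith) hHQ (by linarith)
      _ ≤ polyH P.primPart ^ (-3 + ε) :=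
        Real.rpow_le_rpow_of_exponent_le hQ1 (by linarith [min_le_left ε 1])
end

section
/- Let ζ be an extremal number and ε > 0. Then the inequality |ζ − α| ≤ H(α)^{−4+ε} has solutions in real algebraic numbers α of degree exactly three with arbitrarily large height H(α). -/
open Polynomial

open Matrix Filter Topology

/-- The value at `ζ` of the quadratic polynomial with coefficient vector `a`. -/
def quadEval (ζ : ℝ) (a : Fin 3 → ℤ) : ℝ := a 0 + a 1 * ζ + a 2 * ζ ^ 2

/-- The maximum absolute value of the entries of an integer vector of length three. -/
def quadHeight (a : Fin 3 → ℤ) : ℕ := Finset.univ.sup fun i => (a i).natAbs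

theorem abs_le_quadHeight (a : Fin 3 → ℤ) (i : Fin 3) : |(a i : ℝ)| ≤ quadHeight a := by
  have h : (a i).natAbs ≤ quadHeight a :=
    Finset.le_sup (f := fun i => (a i).natAbs) (Finset.mem_univ i)
  rw [← Int.cast_abs, Int.abs_eq_natAbs]
  exact_mod_cast h

theorem exists_abs_eq_quadHeight (a : Fin 3 → ℤ) : ∃ i, |(a i : ℝ)| = quadHeight a := by
  obtain ⟨i, -, hi⟩ := Finset.exists_mem_eq_sup Finset.univ ⟨0, Finset.mem_univ _⟩
    (fun i => (a i).natAbs)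
  refine ⟨i, ?_⟩
  rw [← Int.cast_abs, Int.abs_eq_natAbs, quadHeight, hi]
  rfl

theorem quadHeight_pos {a : Fin 3 → ℤ} (ha : a ≠ 0) : 0 < quadHeight a := by
  obtain ⟨i, hi⟩ := Function.ne_iff.mp ha
  have h : (a i).natAbs ≤ quadHeight a :=
    Finset.le_sup (f := fun i => (a i).natAbs) (Finset.mem_univ i)
  have : (a i).natAbs ≠ 0 := by simpa using hi
  omega

theorem finite_quadHeight_le (B : ℕ) : {a : Fin 3 → ℤ | quadHeight a ≤ B}.Finite := by
  refine (Set.finite_Icc (fun _ => -(B : ℤ)) (fun _ : Fin 3 => (B : ℤ))).subset fun a ha => ?_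
  have h (i : Fin 3) : (a i).natAbs ≤ B :=
    (Finset.le_sup (f := fun i => (a i).natAbs) (Finset.mem_univ i)).trans ha
  constructor <;> intro i <;> have := h i <;> simp only <;> omega

/-- The resultant, up to sign, of two quadratics with cross product `n` of coefficient vectors. -/
def resOfCross (n : Fin 3 → ℤ) : ℤ := n 0 * n 2 - n 1 * n 1

section Bounds

variable {ζ X Y v w : ℝ} {a b c : Fin 3 → ℤ}

theorem abs_cross_le (ha : ∀ i, |(a i : ℝ)| ≤ X) (hb : ∀ i, |(b i : ℝ)| ≤ Y) (i : Fin 3) :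
    |(((a ⨯₃ b) i : ℤ) : ℝ)| ≤ 2 * X * Y := by
  have hX : 0 ≤ X := (abs_nonneg _).trans (ha 0)
  have key (i j : Fin 3) : |(a i : ℝ) * b j - a j * b i| ≤ 2 * X * Y := by
    have h1 : |(a i : ℝ) * b j| ≤ X * Y := by
      rw [abs_mul]; exact mul_le_mul (ha i) (hb j) (abs_nonneg _) hX
    have h2 : |(a j : ℝ) * b i| ≤ X * Y := by
      rw [abs_mul]; exact mul_le_mul (ha j) (hb i) (abs_nonneg _) hX
    have := abs_sub ((a i : ℝ) * b j) (a j * b i)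
    linarith
  fin_cases i <;> simp only [cross_apply] <;> push_cast <;> simpa using key _ _

theorem cross_fst_sub (ζ : ℝ) (a b : Fin 3 → ℤ) :
    (((a ⨯₃ b) 0 : ℤ) : ℝ) * ζ - ((a ⨯₃ b) 1 : ℤ) =
      b 2 * quadEval ζ a - a 2 * quadEval ζ b := by
  simp [cross_apply, quadEval]; ring

theorem cross_snd_sub (ζ : ℝ) (a b : Fin 3 → ℤ) :
    (((a ⨯₃ b) 1 : ℤ) : ℝ) * ζ - ((a ⨯₃ b) 2 : ℤ) =
      -(ζ * (b 2 * quadEval ζ a - a 2 * quadEval ζ b)) -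
        (b 1 * quadEval ζ a - a 1 * quadEval ζ b) := by
  simp [cross_apply, quadEval]; ring

theorem abs_combination_le (ha : ∀ i, |(a i : ℝ)| ≤ X) (hb : ∀ i, |(b i : ℝ)| ≤ Y)
    (hXY : X ≤ Y) (hva : |quadEval ζ a| ≤ v) (hvb : |quadEval ζ b| ≤ v) (i : Fin 3) :
    |b i * quadEval ζ a - a i * quadEval ζ b| ≤ 2 * Y * v := by
  have hX : 0 ≤ X := (abs_nonneg _).trans (ha 0)
  have h1 : |(b i : ℝ) * quadEval ζ a| ≤ Y * v := by
    rw [abs_mul]; exact mul_le_mul (hb i) hva (abs_nonneg _) (hX.trans hXY)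
  have h2 : |(a i : ℝ) * quadEval ζ b| ≤ Y * v := by
    rw [abs_mul]; exact mul_le_mul ((ha i).trans hXY) hvb (abs_nonneg _) (hX.trans hXY)
  have := abs_sub ((b i : ℝ) * quadEval ζ a) (a i * quadEval ζ b)
  linarith

theorem abs_cross_fst_sub_le (ha : ∀ i, |(a i : ℝ)| ≤ X) (hb : ∀ i, |(b i : ℝ)| ≤ Y)
    (hXY : X ≤ Y) (hva : |quadEval ζ a| ≤ v) (hvb : |quadEval ζ b| ≤ v) :
    |(((a ⨯₃ b) 0 : ℤ) : ℝ) * ζ - ((a ⨯₃ b) 1 : ℤ)| ≤ 2 * Y * v := by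
  rw [cross_fst_sub]
  exact abs_combination_le ha hb hXY hva hvb 2

theorem abs_cross_snd_sub_le (ha : ∀ i, |(a i : ℝ)| ≤ X) (hb : ∀ i, |(b i : ℝ)| ≤ Y)
    (hXY : X ≤ Y) (hva : |quadEval ζ a| ≤ v) (hvb : |quadEval ζ b| ≤ v) :
    |(((a ⨯₃ b) 1 : ℤ) : ℝ) * ζ - ((a ⨯₃ b) 2 : ℤ)| ≤ 2 * (1 + |ζ|) * Y * v := by
  rw [cross_snd_sub]
  have h1 := abs_combination_le ha hb hXY hva hvb 1
  have h2 := abs_combination_le ha hb hXY hva hvb 2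
  refine (abs_sub _ _).trans ?_
  rw [abs_neg, abs_mul]
  nlinarith [mul_le_mul_of_nonneg_left h2 (abs_nonneg ζ)]

/-- Two integer vectors are parallel. -/
def Parallel (m n : Fin 3 → ℤ) : Prop := ∀ i j, m i * n j = m j * n i

theorem Parallel.symm {m n : Fin 3 → ℤ} (h : Parallel m n) : Parallel n m := fun i j => by
  have := h j i
  linarith [mul_comm (n i) (m j), mul_comm (n j) (m i)]

theorem Parallel.trans {l m n : Fin 3 → ℤ} (h : Parallel l m) (h' : Parallel m n) (hm : m ≠ 0) :
    Parallel l n := fun i j => by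
  obtain ⟨k, hk⟩ := Function.ne_iff.mp hm
  have hk : m k ≠ 0 := hk
  apply mul_left_cancel₀ hk
  linear_combination n j * h i k + l k * h' i j + n i * h k j

theorem parallel_cross_cross (h : a ⬝ᵥ (b ⨯₃ c) = 0) : Parallel (a ⨯₃ b) (b ⨯₃ c) := by
  simp only [cross_apply, dotProduct, Fin.sum_univ_three] at h
  simp at h
  intro i j
  fin_cases i <;> fin_cases j <;> simp [cross_apply]
  all_goals first
    | ring1
    | linear_combination b 0 * h
    | linear_combination b 1 * h
    | linear_combination b 2 * h
    | linear_combination -b 0 * h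
    | linear_combination -b 1 * h
    | linear_combination -b 2 * h

theorem Parallel.polar_ne_zero {m n : Fin 3 → ℤ} (h : Parallel m n) (hm : m ≠ 0)
    (hn : resOfCross n ≠ 0) : m 0 * n 2 - m 1 * n 1 ≠ 0 := by
  intro h0
  apply hm
  funext j
  have : m j * resOfCross n = 0 := by
    unfold resOfCross
    linear_combination n j * h0 + n 2 * h j 0 - n 1 * h j 1
  simpa [hn] using this

theorem Parallel.polar_eq {m n : Fin 3 → ℤ} (h : Parallel m n) (ζ : ℝ) :
    ((m 0 * n 2 - m 1 * n 1 : ℤ) : ℝ) =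
      n 1 * (m 0 * ζ - m 1) - n 0 * (m 1 * ζ - m 2) := by
  have h1 : (m 0 : ℝ) * n 1 = m 1 * n 0 := by exact_mod_cast h 0 1
  have h2 : (m 0 : ℝ) * n 2 = m 2 * n 0 := by exact_mod_cast h 0 2
  push_cast
  linear_combination h2 - ζ * h1

theorem Parallel.abs_polar_le {m n : Fin 3 → ℤ} (h : Parallel m n) {N δ δ' : ℝ}
    (hn : ∀ i, |(n i : ℝ)| ≤ N) (h1 : |m 0 * ζ - m 1| ≤ δ) (h2 : |m 1 * ζ - m 2| ≤ δ') :
    |((m 0 * n 2 - m 1 * n 1 : ℤ) : ℝ)| ≤ N * (δ + δ') := by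
  have hN : 0 ≤ N := (abs_nonneg _).trans (hn 0)
  rw [h.polar_eq ζ]
  refine (abs_sub _ _).trans ?_
  rw [abs_mul, abs_mul]
  have := mul_le_mul (hn 1) h1 (abs_nonneg _) hN
  have := mul_le_mul (hn 0) h2 (abs_nonneg _) hN
  linarith

theorem one_le_abs_intCast {k : ℤ} (hk : k ≠ 0) : 1 ≤ |(k : ℝ)| := by
  exact_mod_cast Int.one_le_abs hk

theorem abs_resOfCross_le (ha : ∀ i, |(a i : ℝ)| ≤ X) (hb : ∀ i, |(b i : ℝ)| ≤ Y)
    (hXY : X ≤ Y) (hva : |quadEval ζ a| ≤ v) (hvb : |quadEval ζ b| ≤ v) :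
    |(resOfCross (a ⨯₃ b) : ℝ)| ≤ 8 * (1 + |ζ|) * v * X * Y ^ 2 := by
  have hX : 0 ≤ X := (abs_nonneg _).trans (ha 0)
  have hY : 0 ≤ Y := hX.trans hXY
  have hv : 0 ≤ v := (abs_nonneg _).trans hva
  have h : Parallel (a ⨯₃ b) (a ⨯₃ b) := fun i j => mul_comm _ _
  refine (h.abs_polar_le (abs_cross_le ha hb) (abs_cross_fst_sub_le ha hb hXY hva hvb)
    (abs_cross_snd_sub_le ha hb hXY hva hvb)).trans ?_
  nlinarith [mul_nonneg (abs_nonneg ζ) (by positivity : 0 ≤ v * X * Y ^ 2),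
    (by positivity : 0 ≤ v * X * Y ^ 2)]

theorem abs_triple_le (hc : ∀ i, |(c i : ℝ)| ≤ X) (ha : ∀ i, |(a i : ℝ)| ≤ X)
    (hb : ∀ i, |(b i : ℝ)| ≤ Y) (hXY : X ≤ Y) (hvc : |quadEval ζ c| ≤ v)
    (hva : |quadEval ζ a| ≤ v) (hvb : |quadEval ζ b| ≤ v) :
    |((c ⬝ᵥ (a ⨯₃ b) : ℤ) : ℝ)| ≤ 8 * (1 + |ζ|) * v * X * Y := by
  have hX : 0 ≤ X := (abs_nonneg _).trans (ha 0)
  have hY : 0 ≤ Y := hX.trans hXY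
  have hv : 0 ≤ v := (abs_nonneg _).trans hva
  have h0 := abs_cross_le ha hb 0
  have h1 := abs_cross_fst_sub_le ha hb hXY hva hvb
  have h2 := abs_cross_snd_sub_le ha hb hXY hva hvb
  set n := a ⨯₃ b
  have key : ((c ⬝ᵥ n : ℤ) : ℝ) = n 0 * quadEval ζ c - c 1 * (n 0 * ζ - n 1) -
      c 2 * (ζ * (n 0 * ζ - n 1)) - c 2 * (n 1 * ζ - n 2) := by
    simp only [dotProduct, Fin.sum_univ_three, quadEval]
    push_cast
    ring
  rw [key]
  have e0 : |(n 0 : ℝ) * quadEval ζ c| ≤ 2 * X * Y * v := by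
    rw [abs_mul]; exact mul_le_mul h0 hvc (abs_nonneg _) (by positivity)
  have e1 : |(c 1 : ℝ) * (n 0 * ζ - n 1)| ≤ X * (2 * Y * v) := by
    rw [abs_mul]; exact mul_le_mul (hc 1) h1 (abs_nonneg _) hX
  have e2 : |(c 2 : ℝ) * (ζ * (n 0 * ζ - n 1))| ≤ X * (|ζ| * (2 * Y * v)) := by
    rw [abs_mul, abs_mul]
    exact mul_le_mul (hc 2) (mul_le_mul_of_nonneg_left h1 (abs_nonneg _)) (by positivity) hX
  have e3 : |(c 2 : ℝ) * (n 1 * ζ - n 2)| ≤ X * (2 * (1 + |ζ|) * Y * v) := by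
    rw [abs_mul]; exact mul_le_mul (hc 2) h2 (abs_nonneg _) hX
  rw [abs_le] at *
  have : 0 ≤ |ζ| * (v * X * Y) := by positivity
  have : 0 ≤ v * X * Y := by positivity
  constructor <;> nlinarith

end Bounds

section Coprime

variable {ζ X d v : ℝ} {a c n : Fin 3 → ℤ}

theorem fst_ne_zero_of_small (hn : n ≠ 0) (h1 : |n 0 * ζ - n 1| < 1) (h2 : |n 1 * ζ - n 2| < 1) :
    n 0 ≠ 0 := by
  intro h0
  have e1 : n 1 = 0 := by
    by_contra h
    have := one_le_abs_intCast h
    rw [h0, Int.cast_zero, zero_mul, zero_sub, abs_neg] at h1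
    linarith
  have e2 : n 2 = 0 := by
    by_contra h
    have := one_le_abs_intCast h
    rw [e1, Int.cast_zero, zero_mul, zero_sub, abs_neg] at h2
    linarith
  apply hn
  funext i
  fin_cases i <;> assumption

/-- If `s * T - t` with `s`, `t` coprime divides the quadratic `a`, then `s` divides a nonzero
coefficient of `a`. -/
theorem abs_le_of_root (ha : a ≠ 0) (haX : ∀ i, |(a i : ℝ)| ≤ X) {s t : ℤ} (hs : s ≠ 0)
    (hst : IsCoprime s t) (h : a 0 * s ^ 2 + a 1 * s * t + a 2 * t ^ 2 = 0) : |(s : ℝ)| ≤ X := by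
  have key (i : Fin 3) (h0 : a i ≠ 0) (hd : s ∣ a i) : |(s : ℝ)| ≤ X := by
    refine le_trans ?_ (haX i)
    have := Int.le_of_dvd (abs_pos.mpr h0) ((abs_dvd _ _).mpr ((dvd_abs _ _).mpr hd))
    exact_mod_cast this
  by_cases h2 : a 2 = 0
  · have h' : a 0 * s + a 1 * t = 0 := by
      apply mul_left_cancel₀ hs
      rw [h2] at h
      linear_combination h
    by_cases h1 : a 1 = 0
    · exfalso
      apply ha
      have h0 : a 0 = 0 := by simpa [h1, hs] using h'
      funext i
      fin_cases i <;> assumption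
    · exact key 1 h1 (hst.dvd_of_dvd_mul_right ⟨-a 0, by linear_combination h'⟩)
  · exact key 2 h2 ((hst.pow_right (n := 2)).dvd_of_dvd_mul_right
      ⟨-(a 0 * s + a 1 * t), by linear_combination h⟩)

theorem resOfCross_ne_zero (ha : a ≠ 0) (haX : ∀ i, |(a i : ℝ)| ≤ X) (hcX : ∀ i, |(c i : ℝ)| ≤ X)
    (han : a ⬝ᵥ n = 0) (hcn : c ⬝ᵥ n ≠ 0) (h1 : |n 0 * ζ - n 1| ≤ d) (hd : d < 1)
    (h2 : |n 1 * ζ - n 2| < 1) (hv : |quadEval ζ c| ≤ v)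
    (hsmall : X ^ 2 * v + 2 * (1 + |ζ|) * X ^ 2 * d < 1) : resOfCross n ≠ 0 := by
  intro hres
  have hn : n ≠ 0 := by rintro rfl; simp at hcn
  have hn0 := fst_ne_zero_of_small hn (h1.trans_lt hd) h2
  obtain ⟨g, s, t, hg, hst, hs, ht⟩ : ∃ g s t : ℤ, g ≠ 0 ∧ IsCoprime s t ∧ n 0 = g * s ∧
      n 1 = g * t := by
    have hg : Int.gcd (n 0) (n 1) ≠ 0 := by simp [Int.gcd_eq_zero_iff, hn0]
    obtain ⟨s, t, hst, hs, ht⟩ := Int.exists_gcd_one (Nat.pos_of_ne_zero hg)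
    exact ⟨(Int.gcd (n 0) (n 1) : ℤ), s, t, by exact_mod_cast hg,
      Int.isCoprime_iff_gcd_eq_one.mpr hst, by rw [mul_comm]; exact hs, by rw [mul_comm]; exact ht⟩
  have hs0 : s ≠ 0 := by rintro rfl; simp [hs] at hn0
  have hquad (e : Fin 3 → ℤ) :
      n 0 * (e 0 * s ^ 2 + e 1 * s * t + e 2 * t ^ 2) = s ^ 2 * (e ⬝ᵥ n) := by
    have hst1 : n 1 * s = n 0 * t := by rw [hs, ht]; ring
    have hst2 : n 2 * s = n 1 * t := by
      apply mul_left_cancel₀ hn0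
      unfold resOfCross at hres
      linear_combination s * hres + n 1 * hst1
    simp only [dotProduct, Fin.sum_univ_three]
    linear_combination -e 1 * s * hst1 - e 2 * s * hst2 - e 2 * t * hst1
  have hsX : |(s : ℝ)| ≤ X := by
    refine abs_le_of_root ha haX hs0 hst ?_
    have := hquad a
    rw [han, mul_zero] at this
    exact (mul_eq_zero.mp this).resolve_left hn0
  have he : c 0 * s ^ 2 + c 1 * s * t + c 2 * t ^ 2 ≠ 0 := by
    intro h0
    have := hquad c
    rw [h0, mul_zero, eq_comm, mul_eq_zero] at this
    exact this.elim (pow_ne_zero 2 hs0) hcn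
  have hX : 1 ≤ X := (one_le_abs_intCast hs0).trans hsX
  have hd0 : 0 ≤ d := (abs_nonneg _).trans h1
  have hv0 : 0 ≤ v := (abs_nonneg _).trans hv
  have hδ : |s * ζ - t| ≤ d := by
    refine le_trans ?_ h1
    rw [hs, ht]
    push_cast
    rw [mul_assoc, ← mul_sub, abs_mul]
    exact le_mul_of_one_le_left (abs_nonneg _) (one_le_abs_intCast hg)
  have heq : ((c 0 * s ^ 2 + c 1 * s * t + c 2 * t ^ 2 : ℤ) : ℝ) =
      s ^ 2 * quadEval ζ c - (s * ζ - t) * (c 1 * s) -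
        (s * ζ - t) * (c 2 * (2 * (s * ζ) - (s * ζ - t))) := by
    unfold quadEval
    push_cast
    ring
  have hle := one_le_abs_intCast he
  rw [heq] at hle
  have e1 : |(s : ℝ) ^ 2 * quadEval ζ c| ≤ X ^ 2 * v := by
    rw [abs_mul, abs_pow]
    gcongr
  have e2 : |(s * ζ - t) * (c 1 * s)| ≤ d * (X * X) := by
    rw [abs_mul, abs_mul]
    gcongr
    exact hcX 1
  have e3 : |(s * ζ - t) * (c 2 * (2 * (s * ζ) - (s * ζ - t)))| ≤
      d * (X * (2 * (X * |ζ|) + 1)) := by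
    rw [abs_mul, abs_mul]
    gcongr
    · exact hcX 2
    · refine (abs_sub _ _).trans (add_le_add ?_ (hδ.trans hd.le))
      rw [abs_mul, abs_mul, abs_two]
      gcongr
  have e4 := abs_sub ((s : ℝ) ^ 2 * quadEval ζ c - (s * ζ - t) * (c 1 * s))
    ((s * ζ - t) * (c 2 * (2 * (s * ζ) - (s * ζ - t))))
  have e5 := abs_sub ((s : ℝ) ^ 2 * quadEval ζ c) ((s * ζ - t) * (c 1 * s))
  have e6 : d * X ≤ d * X * X := le_mul_of_one_le_right (by positivity) hX
  nlinarith

end Coprime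

/-- A sequence of nonzero integer quadratics with strictly decreasing absolute values at `ζ`, each
of which has the least height among those with a smaller value than its predecessor. -/
structure IsMinimalSeq (ζ : ℝ) (Q : ℕ → Fin 3 → ℤ) : Prop where
  ne_zero (k : ℕ) : Q k ≠ 0
  eval_lt (k : ℕ) : |quadEval ζ (Q (k + 1))| < |quadEval ζ (Q k)|
  height_le (k : ℕ) (R : Fin 3 → ℤ) (hR : R ≠ 0) (h : |quadEval ζ R| < |quadEval ζ (Q k)|) :
    quadHeight (Q (k + 1)) ≤ quadHeight R
  height_mono (k : ℕ) : quadHeight (Q k) ≤ quadHeight (Q (k + 1))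

theorem exists_isMinimalSeq {ζ : ℝ}
    (h : ∀ P : Fin 3 → ℤ, P ≠ 0 → ∃ R : Fin 3 → ℤ, R ≠ 0 ∧ |quadEval ζ R| < |quadEval ζ P|) :
    ∃ Q, IsMinimalSeq ζ Q := by
  have hnext (P : {P : Fin 3 → ℤ // P ≠ 0}) : ∃ R : {P : Fin 3 → ℤ // P ≠ 0},
      |quadEval ζ R| < |quadEval ζ P| ∧ ∀ S : Fin 3 → ℤ, S ≠ 0 →
        |quadEval ζ S| < |quadEval ζ P| → quadHeight R ≤ quadHeight S := by
    let S : Set (Fin 3 → ℤ) := {R | R ≠ 0 ∧ |quadEval ζ R| < |quadEval ζ P|}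
    have hS : S.Nonempty := h P P.2
    obtain ⟨hR, hRP⟩ : Function.argminOn quadHeight S hS ∈ S := Function.argminOn_mem _ _ _
    exact ⟨⟨_, hR⟩, hRP, fun T hT hTP => Function.argminOn_le quadHeight S ⟨hT, hTP⟩⟩
  choose next hlt hle using hnext
  let F : ℕ → {P : Fin 3 → ℤ // P ≠ 0} := fun k => next^[k] ⟨fun _ => 1, one_ne_zero⟩
  have hF (k : ℕ) : F (k + 1) = next (F k) := Function.iterate_succ_apply' next k _
  have hlt' (k : ℕ) : |quadEval ζ (F (k + 1))| < |quadEval ζ (F k)| := by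
    rw [hF]; exact hlt _
  have hle' (k : ℕ) (R : Fin 3 → ℤ) (hR : R ≠ 0) (h : |quadEval ζ R| < |quadEval ζ (F k)|) :
      quadHeight (F (k + 1)) ≤ quadHeight R := by
    rw [hF]; exact hle _ R hR h
  exact ⟨fun k => F (k + 1), fun k => (F (k + 1)).2, fun k => hlt' (k + 1),
    fun k => hle' (k + 1), fun k => hle' k _ (F (k + 2)).2 ((hlt' (k + 1)).trans (hlt' k))⟩

namespace IsMinimalSeq

variable {ζ : ℝ} {Q : ℕ → Fin 3 → ℤ}

theorem strictAnti (h : IsMinimalSeq ζ Q) : StrictAnti fun k => |quadEval ζ (Q k)| :=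
  strictAnti_nat_of_succ_lt h.eval_lt

theorem monotone (h : IsMinimalSeq ζ Q) : Monotone fun k => (quadHeight (Q k) : ℝ) :=
  monotone_nat_of_le_succ fun k => by exact_mod_cast h.height_mono k

theorem one_le_height (h : IsMinimalSeq ζ Q) (k : ℕ) : (1 : ℝ) ≤ quadHeight (Q k) := by
  exact_mod_cast quadHeight_pos (h.ne_zero k)

theorem tendsto_height (h : IsMinimalSeq ζ Q) :
    Tendsto (fun k => (quadHeight (Q k) : ℝ)) atTop atTop := by
  refine tendsto_natCast_atTop_atTop.comp (tendsto_atTop.mpr fun B => ?_)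
  have hinj : Function.Injective Q := fun i j hij =>
    h.strictAnti.injective (by simp only [hij])
  have := hinj.tendsto_cofinite.eventually (finite_quadHeight_le B).compl_mem_cofinite
  rw [Nat.cofinite_eq_atTop] at this
  filter_upwards [this] with k hk
  exact (not_le.mp hk).le

theorem cross_ne_zero_of_lt (h : IsMinimalSeq ζ Q) {k l : ℕ} (hkl : k < l) : Q k ⨯₃ Q l ≠ 0 := by
  intro h0
  obtain ⟨i, hi⟩ := exists_abs_eq_quadHeight (Q l)
  have hcomb : (Q l i : ℝ) * quadEval ζ (Q k) = Q k i * quadEval ζ (Q l) := by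
    have hc (l : Fin 3) := congrFun h0 l
    simp only [cross_apply] at hc
    have h12 : (Q k 1 * Q l 2 : ℝ) = Q k 2 * Q l 1 := by
      exact_mod_cast sub_eq_zero.mp (hc 0)
    have h20 : (Q k 2 * Q l 0 : ℝ) = Q k 0 * Q l 2 := by
      exact_mod_cast sub_eq_zero.mp (hc 1)
    have h01 : (Q k 0 * Q l 1 : ℝ) = Q k 1 * Q l 0 := by
      exact_mod_cast sub_eq_zero.mp (hc 2)
    unfold quadEval
    fin_cases i <;> simp only [Fin.zero_eta, Fin.mk_one, Fin.reduceFinMk]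
    · linear_combination -ζ * h01 + ζ ^ 2 * h20
    · linear_combination h01 - ζ ^ 2 * h12
    · linear_combination -h20 + ζ * h12
  have habs := congrArg abs hcomb
  rw [abs_mul, abs_mul, hi] at habs
  have h1 : |(Q k i : ℝ)| ≤ quadHeight (Q l) :=
    (abs_le_quadHeight _ i).trans (h.monotone hkl.le)
  have h2 := mul_le_mul_of_nonneg_right h1 (abs_nonneg (quadEval ζ (Q l)))
  have h3 := mul_lt_mul_of_pos_left (h.strictAnti hkl) (one_pos.trans_le (h.one_le_height l))
  linarith

theorem cross_ne_zero (h : IsMinimalSeq ζ Q) (k : ℕ) : Q k ⨯₃ Q (k + 1) ≠ 0 :=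
  h.cross_ne_zero_of_lt k.lt_succ_self

end IsMinimalSeq

/-- The logarithm of the height of an integer quadratic. -/
noncomputable def logHeight (a : Fin 3 → ℤ) : ℝ := Real.log (quadHeight a)

theorem exp_logHeight {a : Fin 3 → ℤ} (ha : a ≠ 0) : Real.exp (logHeight a) = quadHeight a :=
  Real.exp_log (by exact_mod_cast quadHeight_pos ha)

theorem logHeight_nonneg (a : Fin 3 → ℤ) : 0 ≤ logHeight a := Real.log_natCast_nonneg _

/-- Integer quadratics `a`, `b` of logarithmic heights at most `x ≤ y`, both of whose values at `ζ`
are at most `exp (-(η * y))`, with a constant to spare. -/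
structure ApproxPair (ζ η : ℝ) (a b : Fin 3 → ℤ) (x y : ℝ) : Prop where
  left_le (i : Fin 3) : |(a i : ℝ)| ≤ Real.exp x
  right_le (i : Fin 3) : |(b i : ℝ)| ≤ Real.exp y
  le : x ≤ y
  eval_le : 8 * (1 + |ζ|) * |quadEval ζ a| ≤ Real.exp (-(η * y))
  eval_anti : |quadEval ζ b| ≤ |quadEval ζ a|

namespace ApproxPair

variable {ζ η x y : ℝ} {a b : Fin 3 → ℤ}

theorem abs_eval_le (h : ApproxPair ζ η a b x y) : |quadEval ζ a| ≤ Real.exp (-(η * y)) := by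
  refine (le_mul_of_one_le_left (abs_nonneg _) ?_).trans h.eval_le
  linarith [abs_nonneg ζ]

theorem abs_resOfCross_le (h : ApproxPair ζ η a b x y) :
    |(resOfCross (a ⨯₃ b) : ℝ)| ≤ Real.exp (x + (2 - η) * y) := by
  have h1 := _root_.abs_resOfCross_le h.left_le h.right_le (Real.exp_le_exp.mpr h.le) le_rfl
    h.eval_anti
  have h2 := mul_le_mul_of_nonneg_right (mul_le_mul_of_nonneg_right h.eval_le
    (Real.exp_pos x).le) (sq_nonneg (Real.exp y))
  refine (h1.trans h2).trans_eq ?_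
  rw [sq, ← Real.exp_add, ← Real.exp_add, ← Real.exp_add]
  ring_nf

theorem height_mul_eval_le (h : ApproxPair ζ η a b x y) :
    8 * (1 + |ζ|) * (Real.exp y * |quadEval ζ a|) ≤ Real.exp ((1 - η) * y) := by
  have h2 := mul_le_mul_of_nonneg_right h.eval_le (Real.exp_pos y).le
  rw [← Real.exp_add] at h2
  refine le_trans (le_of_eq ?_) (h2.trans_eq ?_) <;> ring_nf

theorem cross_fst_le (h : ApproxPair ζ η a b x y) :
    |(((a ⨯₃ b) 0 : ℤ) : ℝ) * ζ - ((a ⨯₃ b) 1 : ℤ)| ≤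
      Real.exp ((1 - η) * y) / (4 * (1 + |ζ|)) := by
  have h1 := abs_cross_fst_sub_le h.left_le h.right_le (Real.exp_le_exp.mpr h.le) le_rfl
    h.eval_anti
  have h2 := h.height_mul_eval_le
  rw [le_div_iff₀ (by positivity)]
  nlinarith [abs_nonneg ζ]

theorem cross_snd_le (h : ApproxPair ζ η a b x y) :
    |(((a ⨯₃ b) 1 : ℤ) : ℝ) * ζ - ((a ⨯₃ b) 2 : ℤ)| ≤ Real.exp ((1 - η) * y) / 4 := by
  have h1 := abs_cross_snd_sub_le h.left_le h.right_le (Real.exp_le_exp.mpr h.le) le_rfl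
    h.eval_anti
  have h2 := h.height_mul_eval_le
  linarith

theorem abs_cross_le (h : ApproxPair ζ η a b x y) (i : Fin 3) :
    |(((a ⨯₃ b) i : ℤ) : ℝ)| ≤ 2 * Real.exp (x + y) := by
  rw [Real.exp_add, ← mul_assoc]
  exact _root_.abs_cross_le h.left_le h.right_le i

end ApproxPair

namespace IsMinimalSeq

variable {ζ η : ℝ} {Q : ℕ → Fin 3 → ℤ} {K k l : ℕ}

/-- From the index `K` on, each value is at most the height of the next quadratic to the power
`-η`, with a constant to spare. -/
def Decay (ζ η : ℝ) (Q : ℕ → Fin 3 → ℤ) (K : ℕ) : Prop :=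
  ∀ k, K ≤ k → 8 * (1 + |ζ|) * |quadEval ζ (Q k)| ≤ Real.exp (-(η * logHeight (Q (k + 1))))

/-- Three successive members of the sequence are linearly independent. -/
def Indep (Q : ℕ → Fin 3 → ℤ) (k : ℕ) : Prop := Q k ⬝ᵥ (Q (k + 1) ⨯₃ Q (k + 2)) ≠ 0

theorem abs_le_exp (h : IsMinimalSeq ζ Q) (k : ℕ) (i : Fin 3) :
    |(Q k i : ℝ)| ≤ Real.exp (logHeight (Q k)) := by
  rw [exp_logHeight (h.ne_zero k)]
  exact abs_le_quadHeight _ i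

theorem logHeight_mono (h : IsMinimalSeq ζ Q) : Monotone fun k => logHeight (Q k) := fun i _ hij =>
  Real.log_le_log (one_pos.trans_le (h.one_le_height i)) (h.monotone hij)

theorem exp_logHeight_le (h : IsMinimalSeq ζ Q) (hkl : k ≤ l) :
    Real.exp (logHeight (Q k)) ≤ Real.exp (logHeight (Q l)) :=
  Real.exp_le_exp.mpr (h.logHeight_mono hkl)

theorem eval_le (h : IsMinimalSeq ζ Q) (hkl : k ≤ l) :
    |quadEval ζ (Q l)| ≤ |quadEval ζ (Q k)| := h.strictAnti.antitone hkl

theorem Indep.logHeight_le (hg : Indep Q k) (h : IsMinimalSeq ζ Q) (hd : Decay ζ η Q K)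
    (hk : K ≤ k) : (η - 1) * logHeight (Q (k + 1)) ≤ logHeight (Q (k + 2)) := by
  have h1 := (one_le_abs_intCast hg).trans (abs_triple_le
    (fun i => (h.abs_le_exp k i).trans (h.exp_logHeight_le k.le_succ)) (h.abs_le_exp (k + 1))
    (h.abs_le_exp (k + 2)) (h.exp_logHeight_le (k + 1).le_succ) le_rfl (h.eval_le k.le_succ)
    (h.eval_le (by omega)))
  have h2 := mul_le_mul_of_nonneg_right (mul_le_mul_of_nonneg_right (hd k hk)
    (Real.exp_pos (logHeight (Q (k + 1)))).le) (Real.exp_pos (logHeight (Q (k + 2)))).le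
  rw [← Real.exp_add, ← Real.exp_add] at h2
  have := Real.one_le_exp_iff.mp (h1.trans h2)
  linarith

theorem approxPair (h : IsMinimalSeq ζ Q) (hd : Decay ζ η Q K) (hk : K ≤ k) :
    ApproxPair ζ η (Q k) (Q (k + 1)) (logHeight (Q k)) (logHeight (Q (k + 1))) where
  left_le := h.abs_le_exp k
  right_le := h.abs_le_exp (k + 1)
  le := h.logHeight_mono k.le_succ
  eval_le := hd k hk
  eval_anti := h.eval_le k.le_succ

theorem Indep.resOfCross_ne_zero (hg : Indep Q k) (h : IsMinimalSeq ζ Q) (hd : Decay ζ η Q K)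
    (hk : K ≤ k) (hη : 5 / 2 ≤ η) : resOfCross (Q (k + 1) ⨯₃ Q (k + 2)) ≠ 0 := by
  set x := logHeight (Q (k + 1)) with hx
  set y := logHeight (Q (k + 2)) with hy
  have hx0 : 0 ≤ x := logHeight_nonneg _
  have hxy : (η - 1) * x ≤ y := hg.logHeight_le h hd hk
  have hy0 : 0 ≤ y := logHeight_nonneg _
  have h1 := (h.approxPair hd (k := k + 1) (by omega)).cross_fst_le
  have h2 := (h.approxPair hd (k := k + 1) (by omega)).cross_snd_le
  have he : Real.exp ((1 - η) * y) ≤ 1 := Real.exp_le_one_iff.mpr (by nlinarith)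
  have hκ := abs_nonneg ζ
  have hdle : Real.exp ((1 - η) * y) / (4 * (1 + |ζ|)) ≤ 1 / 4 := by
    rw [div_le_div_iff₀ (by positivity) (by positivity)]
    nlinarith
  refine _root_.resOfCross_ne_zero (h.ne_zero (k + 1)) (h.abs_le_exp (k + 1))
    (fun i => (h.abs_le_exp k i).trans (h.exp_logHeight_le k.le_succ)) (by simp) hg h1
    (by linarith) (by linarith) le_rfl ?_
  have hX : Real.exp x ^ 2 = Real.exp (2 * x) := by rw [sq, ← Real.exp_add]; ring_nf
  rw [← hx, hX, ← hy]
  have e1 : Real.exp (2 * x) * |quadEval ζ (Q k)| ≤ 1 / 8 := by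
    have a1 := mul_le_mul_of_nonneg_left (hd k hk) (Real.exp_pos (2 * x)).le
    rw [← Real.exp_add] at a1
    have a2 : Real.exp (2 * x + -(η * logHeight (Q (k + 1)))) ≤ 1 :=
      Real.exp_le_one_iff.mpr (by rw [← hx]; nlinarith)
    have : 0 ≤ |ζ| * (Real.exp (2 * x) * |quadEval ζ (Q k)|) := by positivity
    linarith
  have e2 : 2 * (1 + |ζ|) * Real.exp (2 * x) * (Real.exp ((1 - η) * y) / (4 * (1 + |ζ|))) ≤
      1 / 2 := by
    have a1 : Real.exp (2 * x) * Real.exp ((1 - η) * y) ≤ 1 := by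
      rw [← Real.exp_add]
      apply Real.exp_le_one_iff.mpr
      nlinarith [mul_le_mul_of_nonneg_left hxy (by linarith : 0 ≤ η - 1)]
    have a2 : 2 * (1 + |ζ|) * Real.exp (2 * x) * (Real.exp ((1 - η) * y) / (4 * (1 + |ζ|))) =
        Real.exp (2 * x) * Real.exp ((1 - η) * y) / 2 := by
      field_simp
      norm_num
    rw [a2]
    linarith
  linarith

theorem parallel_of_not_indep (h : IsMinimalSeq ζ Q) (hkl : k ≤ l)
    (hn : ∀ j, k ≤ j → j < l → ¬ Indep Q j) : Parallel (Q l ⨯₃ Q (l + 1)) (Q k ⨯₃ Q (k + 1)) := by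
  induction l, hkl using Nat.le_induction with
  | base => exact fun i j => mul_comm _ _
  | succ l hl ih =>
    refine Parallel.trans ?_ (ih fun j hj hjl => hn j hj (by omega)) (h.cross_ne_zero l)
    exact (parallel_cross_cross (not_not.mp (hn l hl (by omega)))).symm

theorem Indep.logHeight_next_le (hg : Indep Q k) (h : IsMinimalSeq ζ Q) (hd : Decay ζ η Q K)
    (hk : K ≤ k) (hη : 5 / 2 ≤ η) (hkl : k < l) (hn : ∀ j, k < j → j < l → ¬ Indep Q j) :
    (η - 1) * logHeight (Q (l + 1)) ≤ logHeight (Q (k + 1)) + logHeight (Q (k + 2)) := by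
  have hpar := h.parallel_of_not_indep (k := k + 1) hkl fun j hj hjl => hn j hj hjl
  have h1 := one_le_abs_intCast (hpar.polar_ne_zero (h.cross_ne_zero l)
    (hg.resOfCross_ne_zero h hd hk hη))
  have hb := h1.trans (hpar.abs_polar_le 
    (h.approxPair hd (by omega)).abs_cross_le (h.approxPair hd (by omega)).cross_fst_le
    (h.approxPair hd (by omega)).cross_snd_le)
  set E := Real.exp ((1 - η) * logHeight (Q (l + 1))) with hE
  have hE0 : 0 < E := Real.exp_pos _
  have hdle : E / (4 * (1 + |ζ|)) ≤ E / 4 := by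
    apply div_le_div_of_nonneg_left hE0.le (by positivity)
    linarith [abs_nonneg ζ]
  have hle : 1 ≤ Real.exp (logHeight (Q (k + 1)) + logHeight (Q (k + 2))) * E := by
    refine hb.trans ?_
    have := Real.exp_pos (logHeight (Q (k + 1)) + logHeight (Q (k + 2)))
    nlinarith
  rw [hE, ← Real.exp_add] at hle
  have := Real.one_le_exp_iff.mp hle
  linarith

theorem exists_indep (h : IsMinimalSeq ζ Q) (hζ : Irrational ζ) (hd : Decay ζ η Q K)
    (hη : 1 < η) (M : ℕ) : ∃ k, M ≤ k ∧ Indep Q k := by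
  by_contra! hcon
  have hlim : Tendsto (fun k => Real.exp ((1 - η) * logHeight (Q (k + 1)))) atTop (𝓝 0) := by
    refine Real.tendsto_exp_atBot.comp ?_
    refine Tendsto.const_mul_atTop_of_neg (by linarith) ?_
    exact (Real.tendsto_log_atTop.comp h.tendsto_height).comp (tendsto_add_atTop_nat 1)
  set n := Q M ⨯₃ Q (M + 1) with hn
  have hn_ne : n ≠ 0 := h.cross_ne_zero M
  have hsmall (δ : ℝ) (hδ : 0 < δ) : ∃ m : Fin 3 → ℤ, m ≠ 0 ∧ Parallel m n ∧
      |m 0 * ζ - m 1| < δ ∧ |m 1 * ζ - m 2| < δ := by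
    obtain ⟨k, hkδ, hk⟩ := ((hlim.eventually_lt_const hδ).and
      (eventually_ge_atTop (max K M))).exists
    have hE := Real.exp_pos ((1 - η) * logHeight (Q (k + 1)))
    refine ⟨_, h.cross_ne_zero k, h.parallel_of_not_indep (le_of_max_le_right hk)
      fun j hj _ => hcon j hj, (h.approxPair hd (le_of_max_le_left hk)).cross_fst_le.trans_lt
        (lt_of_le_of_lt ?_ hkδ), (h.approxPair hd (le_of_max_le_left hk)).cross_snd_le.trans_lt
        (by linarith)⟩
    apply div_le_self hE.le
    linarith [abs_nonneg ζ]
  have hn0 : n 0 ≠ 0 := by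
    obtain ⟨m, hm, hpar, h1, h2⟩ := hsmall 1 one_pos
    have hm0 := fst_ne_zero_of_small hm h1 h2
    intro h0
    apply hn_ne
    funext j
    have := hpar 0 j
    rw [h0, mul_zero] at this
    exact (mul_eq_zero.mp this).resolve_left hm0
  have hpos : 0 < |n 0 * ζ - n 1| := by
    rw [abs_pos, sub_ne_zero]
    exact ((hζ.intCast_mul hn0).ne_int _)
  have hn0' : (0 : ℝ) < |(n 0 : ℝ)| := abs_pos.mpr (by exact_mod_cast hn0)
  obtain ⟨m, hm, hpar, h1, h2⟩ := hsmall (min 1 (|n 0 * ζ - n 1| / |(n 0 : ℝ)|))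
    (lt_min one_pos (div_pos hpos hn0'))
  have hm0 := fst_ne_zero_of_small hm (h1.trans_le (min_le_left _ _))
    (h2.trans_le (min_le_left _ _))
  have hlt := h1.trans_le (min_le_right _ _)
  rw [lt_div_iff₀ hn0', ← abs_mul] at hlt
  have h01 : (m 0 : ℝ) * n 1 = m 1 * n 0 := by exact_mod_cast hpar 0 1
  have heq : ((m 0 : ℝ) * ζ - m 1) * n 0 = m 0 * (n 0 * ζ - n 1) := by
    linear_combination h01
  rw [heq, abs_mul] at hlt
  nlinarith [one_le_abs_intCast hm0]

end IsMinimalSeq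

theorem parallel_cross {a b n : Fin 3 → ℤ} (ha : a ⬝ᵥ n = 0) (hb : b ⬝ᵥ n = 0) :
    Parallel (a ⨯₃ b) n := by
  simp only [dotProduct, Fin.sum_univ_three] at ha hb
  intro i j
  fin_cases i <;> fin_cases j <;> simp [cross_apply]
  all_goals first
    | linear_combination a 0 * hb - b 0 * ha
    | linear_combination a 1 * hb - b 1 * ha
    | linear_combination a 2 * hb - b 2 * ha
    | linear_combination b 0 * ha - a 0 * hb
    | linear_combination b 1 * ha - a 1 * hb
    | linear_combination b 2 * ha - a 2 * hb

theorem Parallel.dotProduct_eq_zero {m n b : Fin 3 → ℤ} (h : Parallel m n) (hm : m ≠ 0)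
    (hb : b ⬝ᵥ m = 0) : b ⬝ᵥ n = 0 := by
  obtain ⟨j, hj⟩ := Function.ne_iff.mp hm
  have hj : m j ≠ 0 := hj
  apply mul_left_cancel₀ hj
  simp only [dotProduct, Fin.sum_univ_three] at hb ⊢
  linear_combination n j * hb + b 0 * h j 0 + b 1 * h j 1 + b 2 * h j 2

theorem Parallel.resOfCross_ne_zero {m n : Fin 3 → ℤ} (h : Parallel m n) (hm : m ≠ 0)
    (hn : resOfCross n ≠ 0) : resOfCross m ≠ 0 := by
  obtain ⟨j, hj⟩ := Function.ne_iff.mp hm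
  have hj : m j ≠ 0 := hj
  intro h0
  have : m j * m j * resOfCross n = resOfCross m * (n j * n j) := by
    unfold resOfCross
    linear_combination m j * n 2 * h j 0 + n j * m 0 * h j 2 - m j * n 1 * h j 1 -
      n j * m 1 * h j 1
  rw [h0, zero_mul] at this
  simp [hj, hn] at this

/-- A sequence of integer quadratics with the approximation properties shared, up to arbitrarily
small losses in the exponent `η`, by those attached to an extremal number. -/
structure IsRoySeq (ζ η : ℝ) (P : ℕ → Fin 3 → ℤ) (p : ℕ → ℝ) : Prop where
  approxPair (i : ℕ) : ApproxPair ζ η (P i) (P (i + 1)) (p i) (p (i + 1))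
  growth (i : ℕ) : (η - 1) * p i ≤ p (i + 1)
  res_ne_zero (i : ℕ) : resOfCross (P i ⨯₃ P (i + 1)) ≠ 0

namespace IsMinimalSeq

variable {ζ η θ : ℝ} {Q : ℕ → Fin 3 → ℤ} {K : ℕ}

theorem exists_isRoySeq (h : IsMinimalSeq ζ Q) (hζ : Irrational ζ) (hd : Decay ζ η Q K)
    (hη : 5 / 2 ≤ η) (hθη : θ ≤ η) (hθ : θ ≤ (η - 1) ^ 2) (B : ℝ) :
    ∃ P p, IsRoySeq ζ θ P p ∧ B ≤ p 0 := by
  have hlim : Tendsto (fun k => logHeight (Q k)) atTop atTop :=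
    Real.tendsto_log_atTop.comp h.tendsto_height
  obtain ⟨M, hM⟩ := (hlim.eventually_ge_atTop B).exists_forall_of_atTop
  let good : ℕ → Prop := fun k => max K M ≤ k ∧ Indep Q k
  have hinf : {k | good k}.Infinite := by
    refine Set.infinite_of_not_bddAbove fun ⟨b, hb⟩ => ?_
    obtain ⟨k, hk, hg⟩ := h.exists_indep hζ hd (by linarith) (max (b + 1) (max K M))
    have := hb (show good k from ⟨le_of_max_le_right hk, hg⟩)
    have := le_of_max_le_left hk
    omega
  let g := Nat.nth good
  have hg (i : ℕ) : good (g i) := Nat.nth_mem_of_infinite hinf i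
  have hKg (i : ℕ) : K ≤ g i := le_of_max_le_left (hg i).1
  have hlt (i : ℕ) : g i < g (i + 1) := Nat.nth_strictMono hinf i.lt_succ_self
  have hnot (i j : ℕ) (hj : g i < j) (hj' : j < g (i + 1)) : ¬ Indep Q j := fun hI => by
    have := Nat.le_nth_of_lt_nth_succ hj' (show good j from ⟨(hg i).1.trans hj.le, hI⟩)
    exact absurd this (not_le.mpr hj)
  have hgrow (i : ℕ) : (η - 1) * logHeight (Q (g i + 1)) ≤ logHeight (Q (g i + 2)) :=
    (hg i).2.logHeight_le h hd (hKg i)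
  have hle (i : ℕ) : logHeight (Q (g i + 2)) ≤ logHeight (Q (g (i + 1) + 1)) :=
    h.logHeight_mono (by have := hlt i; omega)
  refine ⟨fun i => Q (g i + 1), fun i => logHeight (Q (g i + 1)), ⟨fun i => ⟨h.abs_le_exp _,
    h.abs_le_exp _, h.logHeight_mono (by have := hlt i; omega), ?_,
    h.eval_le (by have := hlt i; omega)⟩, fun i => ?_, fun i => ?_⟩, ?_⟩
  · refine (hd _ ((hKg i).trans (Nat.le_succ _))).trans (Real.exp_le_exp.mpr ?_)
    have hnext := (hg i).2.logHeight_next_le h hd (hKg i) hη (hlt i) (hnot i)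
    have h1 := hgrow i
    have h0 := logHeight_nonneg (Q (g i + 1))
    have h2 := logHeight_nonneg (Q (g (i + 1) + 1))
    have h3 := mul_le_mul_of_nonneg_left hnext (by linarith : 0 ≤ η - 1)
    have h4 := mul_le_mul_of_nonneg_right hθ h2
    change -(η * logHeight (Q (g i + 2))) ≤ -(θ * logHeight (Q (g (i + 1) + 1)))
    nlinarith
  · refine le_trans ?_ ((hgrow i).trans (hle i))
    exact mul_le_mul_of_nonneg_right (by linarith) (logHeight_nonneg _)
  · have hpar := h.parallel_of_not_indep (k := g i + 1) (hlt i) fun j hj hj' => hnot i j hj hj'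
    have hb : Q (g (i + 1) + 1) ⬝ᵥ (Q (g i + 1) ⨯₃ Q (g i + 1 + 1)) = 0 :=
      hpar.dotProduct_eq_zero (h.cross_ne_zero _) (by simp)
    exact (parallel_cross (by simp) hb).resOfCross_ne_zero
      (h.cross_ne_zero_of_lt (by have := hlt i; omega))
      ((hg i).2.resOfCross_ne_zero h hd (hKg i) hη)
  · exact hM _ ((le_of_max_le_right (hg 0).1).trans (Nat.le_succ _))

end IsMinimalSeq

section Extremal

variable {ζ η : ℝ}

theorem abs_coeff_le_polyH (P : ℤ[X]) (i : ℕ) : |(P.coeff i : ℝ)| ≤ polyH P := by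
  rw [← Int.cast_abs, Int.abs_eq_natAbs, polyH]
  by_cases hi : i ∈ P.support
  · exact_mod_cast Finset.le_sup (f := fun i => (P.coeff i).natAbs) hi
  · simp [notMem_support_iff.mp hi]

theorem exists_quad_of_lt_whExp (hw : 0 < whExp 2 ζ) (hη : η < whExp 2 ζ) :
    ∃ X₀ : ℝ, 1 ≤ X₀ ∧ ∀ X, X₀ ≤ X → ∃ a : Fin 3 → ℤ, a ≠ 0 ∧ (quadHeight a : ℝ) ≤ X ∧
      |quadEval ζ a| ≤ X ^ (-η) := by
  have hne : (whSet 2 ζ).Nonempty := by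
    by_contra hne
    rw [whExp, Set.not_nonempty_iff_eq_empty.mp hne, Real.sSup_empty] at hw
    exact hw.false
  obtain ⟨θ, ⟨X₀, hX₀⟩, hηθ⟩ := exists_lt_of_lt_csSup hne hη
  refine ⟨max 1 X₀, le_max_left _ _, fun X hX => ?_⟩
  obtain ⟨P, hdeg, hP, hpos, hle⟩ := hX₀ X (le_of_max_le_right hX)
  have hev : quadEval ζ (fun i => P.coeff i) = pev ζ P := by
    rw [quadEval, pev, aeval_eq_sum_range' (Nat.lt_succ_of_le hdeg)]
    simp [Finset.sum_range_succ]
  refine ⟨fun i => P.coeff i, ?_, ?_, ?_⟩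
  · intro h0
    rw [← hev, h0] at hpos
    simp [quadEval] at hpos
  · obtain ⟨i, hi⟩ := exists_abs_eq_quadHeight fun i => P.coeff i
    rw [← hi]
    exact (abs_coeff_le_polyH P i).trans hP
  · rw [hev]
    exact hle.trans (Real.rpow_le_rpow_of_exponent_le (le_of_max_le_left hX) (by linarith))

theorem quadEval_ne_zero (hζ : Transcendental ℚ ζ) {a : Fin 3 → ℤ} (ha : a ≠ 0) :
    quadEval ζ a ≠ 0 := by
  intro h0
  have hζ' : Transcendental ℤ ζ := hζ.restrictScalars (Int.cast_injective (α := ℚ))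
  have := (transcendental_iff.mp hζ') (C (a 0) + C (a 1) * X + C (a 2) * X ^ 2)
    (by simpa [quadEval] using h0)
  apply ha
  funext i
  have hc := congrArg (fun P : ℤ[X] => P.coeff i) this
  fin_cases i <;> simpa [coeff_X, coeff_C, -eq_intCast] using hc

theorem IsExtremal.exists_isMinimalSeq (hζ : IsExtremal ζ) : ∃ Q, IsMinimalSeq ζ Q := by
  have hw : (1 : ℝ) < whExp 2 ζ := by
    rw [hζ.2]
    linarith [Real.sqrt_nonneg 5]
  refine _root_.exists_isMinimalSeq fun P hP => ?_
  obtain ⟨X₀, -, hX₀⟩ := exists_quad_of_lt_whExp (by linarith) hw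
  have hlim := tendsto_rpow_neg_atTop one_pos
  obtain ⟨X, hX, hX'⟩ := ((hlim.eventually_lt_const (abs_pos.mpr (quadEval_ne_zero hζ.1 hP))).and
    (eventually_ge_atTop X₀)).exists
  obtain ⟨a, ha, -, hle⟩ := hX₀ X hX'
  exact ⟨a, ha, hle.trans_lt hX⟩

theorem IsMinimalSeq.exists_decay {Q : ℕ → Fin 3 → ℤ} (h : IsMinimalSeq ζ Q)
    (hw : 0 < whExp 2 ζ) (hη : η < whExp 2 ζ) : ∃ K, IsMinimalSeq.Decay ζ η Q K := by
  obtain ⟨θ, hηθ, hθ⟩ := exists_between hη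
  obtain ⟨X₀, hX₀, hex⟩ := exists_quad_of_lt_whExp hw hθ
  have hlim : Tendsto (fun k => (quadHeight (Q (k + 1)) : ℝ)) atTop atTop :=
    h.tendsto_height.comp (tendsto_add_atTop_nat 1)
  have hlim' := (tendsto_rpow_neg_atTop (sub_pos.mpr hηθ)).comp hlim
  have hc : 0 < (8 * (1 + |ζ|) * (2 : ℝ) ^ θ)⁻¹ := by positivity
  obtain ⟨K, hK⟩ := ((hlim.eventually_ge_atTop (2 * X₀)).and
    (hlim'.eventually_lt_const hc)).exists_forall_of_atTop
  refine ⟨K, fun k hk => ?_⟩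
  obtain ⟨h1, h2⟩ := hK k hk
  simp only [Function.comp_apply] at h2
  set H := (quadHeight (Q (k + 1)) : ℝ) with hH
  have hH0 : 0 < H := by linarith
  obtain ⟨a, ha, haH, hle⟩ := hex (H / 2) (by linarith)
  have hQa : |quadEval ζ (Q k)| ≤ |quadEval ζ a| := by
    by_contra! hlt
    have : H ≤ quadHeight a := Nat.cast_le.mpr (h.height_le k a ha hlt)
    linarith
  have hexp : Real.exp (-(η * logHeight (Q (k + 1)))) = H ^ (-η) := by
    rw [Real.rpow_def_of_pos hH0, logHeight, ← hH, mul_neg, mul_comm]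
  have hsplit : (H / 2) ^ (-θ) = 2 ^ θ * H ^ (-(θ - η)) * H ^ (-η) := by
    rw [mul_assoc, ← Real.rpow_add hH0, Real.div_rpow hH0.le zero_le_two,
      Real.rpow_neg zero_le_two, div_inv_eq_mul, mul_comm]
    ring_nf
  rw [lt_inv_comm₀ (by positivity) (by positivity), ← one_div, lt_div_iff₀ (by positivity)] at h2
  rw [hexp]
  calc 8 * (1 + |ζ|) * |quadEval ζ (Q k)|
      ≤ 8 * (1 + |ζ|) * (2 ^ θ * H ^ (-(θ - η)) * H ^ (-η)) := by
        rw [← hsplit]; gcongr; exact hQa.trans hle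
    _ = (8 * (1 + |ζ|) * 2 ^ θ * H ^ (-(θ - η))) * H ^ (-η) := by ring
    _ ≤ 1 * H ^ (-η) := by gcongr
    _ = H ^ (-η) := one_mul _

end Extremal

theorem IsExtremal.exists_isRoySeq {ζ θ : ℝ} (hζ : IsExtremal ζ) (hθ : 5 / 2 ≤ θ)
    (hθ' : θ < (3 + √5) / 2) (B : ℝ) : ∃ P p, IsRoySeq ζ θ P p ∧ B ≤ p 0 := by
  have h5 : √5 ^ 2 = 5 := Real.sq_sqrt (by norm_num)
  have h0 : 0 ≤ √5 := Real.sqrt_nonneg 5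
  have hlt : √5 < 3 := by nlinarith
  obtain ⟨Q, hQ⟩ := hζ.exists_isMinimalSeq
  set g := (3 + √5) / 2 with hg
  obtain ⟨K, hK⟩ := hQ.exists_decay (η := g - (g - θ) / 4) (by rw [hζ.2]; positivity)
    (by rw [hζ.2]; linarith)
  refine hQ.exists_isRoySeq hζ.1.irrational hK (by linarith) (by linarith) ?_ B
  nlinarith [sq_nonneg (g - θ)]

/-- The exponent estimates, valid for `η` close to `(3 + √5) / 2`, under which the approximations
attached to an extremal number yield cubics with loss `ε`. -/
structure GoodExponent (η ε : ℝ) : Prop where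
  five_halves_le : 5 / 2 ≤ η
  height : (η - 1)⁻¹ + (η - 1)⁻¹ ^ 3 + (η - 1)⁻¹ ^ 4 ≤ 1 + ε / 2
  value : 3 - ε ≤ (η - 1) * (η - 2) ^ 3 + η
  det : (η - 1)⁻¹ + (2 - η) ≤ ε / 2
  three_le : 3 ≤ η * (η - 1)

theorem exists_goodExponent {ε : ℝ} (hε : 0 < ε) : ∃ η < (3 + √5) / 2, GoodExponent η ε := by
  have h5 : √5 ^ 2 = 5 := Real.sq_sqrt (by norm_num)
  have h0 : 0 ≤ √5 := Real.sqrt_nonneg 5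
  have hgt : 2 < √5 := by nlinarith
  set g := (3 + √5) / 2 with hg
  have hinv : (g - 1)⁻¹ = g - 2 := by
    rw [inv_eq_one_div, div_eq_iff (by linarith), hg]
    linear_combination -h5 / 4
  have hg2 : g ^ 2 = 3 * g - 1 := by rw [hg]; linear_combination h5 / 4
  have hev (f : ℝ → ℝ) (hf : ContinuousAt f g) (c : ℝ) (hc : f g < c) : ∀ᶠ η in 𝓝[<] g, f η < c :=
    (hf.tendsto.mono_left nhdsWithin_le_nhds).eventually_lt_const hc
  have hne : g - 1 ≠ 0 := by linarith
  have h1 := hev (fun η => -η) (by fun_prop) (-(5 / 2)) (by linarith)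
  have h2 := hev (fun η => (η - 1)⁻¹ + (η - 1)⁻¹ ^ 3 + (η - 1)⁻¹ ^ 4)
    (by fun_prop (disch := assumption)) (1 + ε / 2) (by
      have : (g - 2) + (g - 2) ^ 3 + (g - 2) ^ 4 = 1 := by
        linear_combination (g ^ 2 - 4 * g + 5) * hg2
      simp only [hinv]
      linarith)
  have h3 := hev (fun η => -((η - 1) * (η - 2) ^ 3 + η)) (by fun_prop) (-(3 - ε)) (by
    have : (g - 1) * (g - 2) ^ 3 + g = 3 := by
      linear_combination (g ^ 2 - 4 * g + 5) * hg2
    linarith)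
  have h4 := hev (fun η => (η - 1)⁻¹ + (2 - η)) (by fun_prop (disch := assumption)) (ε / 2) (by
    simp only [hinv]
    linarith)
  have h5 := hev (fun η => -(η * (η - 1))) (by fun_prop) (-3) (by nlinarith)
  obtain ⟨η, h1, h2, h3, h4, h5, h6⟩ := (h1.and (h2.and (h3.and (h4.and (h5.and
    self_mem_nhdsWithin))))).exists
  exact ⟨η, h6, by linarith, h2.le, by linarith, h4.le, by linarith⟩

/-- Coefficients of the cubics `R`, `T * R`, `(n 0 * T - n 1) * Q`, `(n 1 * T - n 2) * Q`. -/
def cubicMatrix (R Q n : Fin 3 → ℤ) : Matrix (Fin 4) (Fin 4) ℤ :=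
  !![R 0, R 1, R 2, 0;
    0, R 0, R 1, R 2;
    -n 1 * Q 0, n 0 * Q 0 - n 1 * Q 1, n 0 * Q 1 - n 1 * Q 2, n 0 * Q 2;
    -n 2 * Q 0, n 1 * Q 0 - n 2 * Q 1, n 1 * Q 1 - n 2 * Q 2, n 1 * Q 2]

theorem det_cubicMatrix (R Q n : Fin 3 → ℤ) :
    (cubicMatrix R Q n).det = -(resOfCross n * resOfCross (Q ⨯₃ R)) := by
  simp [cubicMatrix, Matrix.det_succ_row_zero, Fin.sum_univ_succ, Fin.succAbove, resOfCross,
    cross_apply]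
  ring

theorem exists_cubicMatrix {ζ : ℝ} (hζ : IsExtremal ζ) {ε : ℝ} (hε : 0 < ε) (B : ℝ) :
    ∃ y, B ≤ y ∧ ∃ M : Matrix (Fin 4) (Fin 4) ℤ, M.det ≠ 0 ∧ |(M.det : ℝ)| ≤ Real.exp (ε * y) ∧
      (∀ i j, |(M i j : ℝ)| ≤ Real.exp ((1 + ε) * y)) ∧
      ∀ i, |∑ j, (M i j : ℝ) * ζ ^ (j : ℕ)| ≤ Real.exp ((-3 + ε) * y) := by
  obtain ⟨η, hη, hg⟩ := exists_goodExponent hε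
  obtain ⟨P, p, h, hB⟩ := hζ.exists_isRoySeq hg.five_halves_le hη
    (max 0 (max B (2 / ε * Real.log 4)))
  have hη0 := hg.five_halves_le
  have hu : 0 < η - 1 := by linarith
  have hp0 : 0 ≤ p 0 := le_of_max_le_left hB
  have hmono (i : ℕ) : p i ≤ p (i + 1) := (h.approxPair i).le
  have hup (i : ℕ) : p i ≤ (η - 1)⁻¹ * p (i + 1) := by
    rw [inv_mul_eq_div, le_div_iff₀ hu, mul_comm]
    exact h.growth i
  have hdown (i : ℕ) : (η - 2) * p (i + 1) ≤ p i := by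
    have := (one_le_abs_intCast (h.res_ne_zero i)).trans (h.approxPair i).abs_resOfCross_le
    rw [Real.one_le_exp_iff] at this
    linarith
  have h01 := hmono 0
  have h12 := hmono 1
  have h23 := hmono 2
  have h34 := hmono 3
  set y := p 4 with hy
  have hBy : max 0 (max B (2 / ε * Real.log 4)) ≤ y := by
    simp only [Nat.reduceAdd] at *
    linarith
  have hlog : Real.log 4 ≤ ε / 2 * y := by
    have := le_of_max_le_right (le_of_max_le_right hBy)
    rw [div_mul_eq_mul_div, div_le_iff₀ hε] at this
    linarith
  have hy0 : 0 ≤ y := le_of_max_le_left hBy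
  have hp3 : p 3 ≤ (η - 1)⁻¹ * y := hup 3
  have hp1 : p 1 ≤ (η - 1)⁻¹ ^ 3 * y := calc
    p 1 ≤ (η - 1)⁻¹ * ((η - 1)⁻¹ * p 3) := (hup 1).trans (by gcongr; exact hup 2)
    _ ≤ (η - 1)⁻¹ * ((η - 1)⁻¹ * ((η - 1)⁻¹ * y)) := by gcongr
    _ = (η - 1)⁻¹ ^ 3 * y := by ring
  have hp0' : p 0 ≤ (η - 1)⁻¹ ^ 4 * y := calc
    p 0 ≤ (η - 1)⁻¹ * ((η - 1)⁻¹ ^ 3 * y) := (hup 0).trans (by gcongr)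
    _ = (η - 1)⁻¹ ^ 4 * y := by ring
  refine ⟨y, le_of_max_le_left (le_of_max_le_right hBy),
    cubicMatrix (P 4) (P 3) (P 0 ⨯₃ P 1), ?_, ?_, ?_, ?_⟩
  · rw [det_cubicMatrix]
    exact neg_ne_zero.mpr (mul_ne_zero (h.res_ne_zero 0) (h.res_ne_zero 3))
  · have h1 := (h.approxPair 0).abs_resOfCross_le
    have h2 := (h.approxPair 3).abs_resOfCross_le
    rw [det_cubicMatrix]
    push_cast
    rw [abs_neg, abs_mul]
    refine (mul_le_mul h1 h2 (abs_nonneg _) (Real.exp_nonneg _)).trans ?_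
    rw [← Real.exp_add, Real.exp_le_exp]
    have e0 := hup 0
    have e3 := hup 3
    simp only [zero_add, Nat.reduceAdd] at *
    have hd := hg.det
    have hp1 : 0 ≤ p 1 := by linarith
    nlinarith [mul_le_mul_of_nonneg_right hd hp1, mul_le_mul_of_nonneg_right hd hy0]
  · have hn := (h.approxPair 0).abs_cross_le
    have hR (i) := ((h.approxPair 3).right_le i).trans
      (Real.exp_le_exp.mpr (show p (3 + 1) ≤ (1 + ε) * y by nlinarith))
    have hz := Real.exp_nonneg ((1 + ε) * y)
    have hnQ (i j) : |((P 0 ⨯₃ P 1) i * P 3 j : ℝ)| ≤ Real.exp ((1 + ε) * y) / 2 := by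
      rw [abs_mul]
      calc |((P 0 ⨯₃ P 1) i : ℝ)| * |(P 3 j : ℝ)|
          ≤ 2 * Real.exp (p 0 + p 1) * Real.exp (p 3) := by
            gcongr
            · exact hn i
            · exact (h.approxPair 3).left_le j
        _ = 4 * Real.exp (p 0 + p 1 + p 3) / 2 := by rw [Real.exp_add _ (p 3)]; ring
        _ = Real.exp (Real.log 4 + (p 0 + p 1 + p 3)) / 2 := by
            rw [Real.exp_add (Real.log 4), Real.exp_log (by norm_num)]
        _ ≤ Real.exp ((1 + ε) * y) / 2 := by
            gcongr
            linarith [mul_le_mul_of_nonneg_right hg.height hy0]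
    have hnQ' (i j k l) : |((P 0 ⨯₃ P 1) i * P 3 j - (P 0 ⨯₃ P 1) k * P 3 l : ℝ)| ≤
        Real.exp ((1 + ε) * y) :=
      (abs_sub _ _).trans ((add_le_add (hnQ i j) (hnQ k l)).trans_eq (add_halves _))
    have hnQ'' (i j) : |((P 0 ⨯₃ P 1) i * P 3 j : ℝ)| ≤ Real.exp ((1 + ε) * y) :=
      (hnQ i j).trans (half_le_self hz)
    intro i j
    fin_cases i <;> fin_cases j <;>
      simp only [cubicMatrix, Matrix.of_apply, Matrix.cons_val, Fin.reduceFinMk, Fin.zero_eta,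
        Fin.isValue, Fin.mk_one, Int.cast_zero, abs_zero, Int.cast_sub, Int.cast_mul,
        Int.cast_neg, neg_mul, abs_neg, Matrix.cons_val_zero, Matrix.cons_val_one] <;>
      first | exact hz | exact hR _ | exact hnQ'' _ _ | exact hnQ' _ _ _ _
  · have hQ := (h.approxPair 3).abs_eval_le
    have hR := (h.approxPair 4).eval_le
    have hf := (h.approxPair 0).cross_fst_le
    have hs := (h.approxPair 0).cross_snd_le
    have hζ0 := abs_nonneg ζ
    have hRy : Real.exp (-(η * p 5)) ≤ Real.exp ((-3 + ε) * y) := by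
      have : y * (η - 1) ≤ p 5 := by linarith [h.growth 4]
      rw [Real.exp_le_exp]
      nlinarith [mul_le_mul_of_nonneg_left this (by linarith : 0 ≤ η),
        mul_le_mul_of_nonneg_right hg.three_le hy0]
    have hQy : Real.exp ((1 - η) * p 1) * Real.exp (-(η * y)) ≤ Real.exp ((-3 + ε) * y) := by
      have : (η - 2) ^ 3 * y ≤ p 1 := calc
        (η - 2) ^ 3 * y = (η - 2) * ((η - 2) * ((η - 2) * y)) := by ring
        _ ≤ (η - 2) * ((η - 2) * p 3) := by gcongr <;> linarith [hdown 3]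
        _ ≤ (η - 2) * p 2 := by gcongr <;> linarith [hdown 2]
        _ ≤ p 1 := hdown 1
      rw [← Real.exp_add, Real.exp_le_exp]
      nlinarith [mul_le_mul_of_nonneg_left this hu.le, mul_le_mul_of_nonneg_right hg.value hy0]
    have hR0 := abs_nonneg (quadEval ζ (P 4))
    have hz (c : ℝ) (hc : |c| ≤ Real.exp ((1 - η) * p 1)) :
        |c * quadEval ζ (P 3)| ≤ Real.exp ((-3 + ε) * y) := by
      rw [abs_mul]
      exact (mul_le_mul hc hQ (abs_nonneg _) (Real.exp_nonneg _)).trans hQy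
    intro i
    fin_cases i
    · have : ∑ j, (cubicMatrix (P 4) (P 3) (P 0 ⨯₃ P 1) 0 j : ℝ) * ζ ^ (j : ℕ) =
          quadEval ζ (P 4) := by
        simp [cubicMatrix, Fin.sum_univ_four, quadEval]
      exact this ▸ (by nlinarith)
    · have : ∑ j, (cubicMatrix (P 4) (P 3) (P 0 ⨯₃ P 1) 1 j : ℝ) * ζ ^ (j : ℕ) =
          ζ * quadEval ζ (P 4) := by
        simp [cubicMatrix, Fin.sum_univ_four, quadEval]
        ring
      refine (this ▸ abs_mul _ _).trans_le (by nlinarith)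
    · have : ∑ j, (cubicMatrix (P 4) (P 3) (P 0 ⨯₃ P 1) 2 j : ℝ) * ζ ^ (j : ℕ) =
          ((P 0 ⨯₃ P 1) 0 * ζ - (P 0 ⨯₃ P 1) 1) * quadEval ζ (P 3) := by
        simp [cubicMatrix, Fin.sum_univ_four, quadEval]
        ring
      exact this ▸ hz _ (hf.trans (div_le_self (Real.exp_nonneg _) (by linarith)))
    · have : ∑ j, (cubicMatrix (P 4) (P 3) (P 0 ⨯₃ P 1) 3 j : ℝ) * ζ ^ (j : ℕ) =
          ((P 0 ⨯₃ P 1) 1 * ζ - (P 0 ⨯₃ P 1) 2) * quadEval ζ (P 3) := by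
        simp [cubicMatrix, Fin.sum_univ_four, quadEval]
        ring
      exact this ▸ hz _ (hs.trans (div_le_self (Real.exp_nonneg _) (by norm_num)))

section Eisenstein

variable {p : ℕ} {M : Matrix (Fin 4) (Fin 4) ℤ} {ζ D H v : ℝ}

theorem exists_not_dvd_col_zero (h : ¬ (p : ℤ) ∣ M.det) : ∃ i, ¬ (p : ℤ) ∣ M i 0 := by
  contrapose! h
  rw [Matrix.det_succ_column_zero]
  exact Finset.dvd_sum fun i _ => (dvd_mul_of_dvd_right (h i) _).mul_right _

theorem exists_round (h : ¬ (p : ℤ) ∣ M.det) (θ : Fin 4 → ℝ) :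
    ∃ n : Fin 4 → ℤ, (∀ i, |n i - θ i| ≤ 1) ∧ ¬ (p : ℤ) ∣ (n ᵥ* M) 0 := by
  by_cases h0 : (p : ℤ) ∣ ((fun i => ⌊θ i⌋) ᵥ* M) 0
  · obtain ⟨k, hk⟩ := exists_not_dvd_col_zero h
    refine ⟨(fun i => ⌊θ i⌋) + Pi.single k 1, fun i => ?_, ?_⟩
    · have h1 := Int.floor_le (θ i)
      have h2 := Int.lt_floor_add_one (θ i)
      by_cases hi : i = k
      · subst hi
        simp only [Pi.add_apply, Pi.single_eq_same, Int.cast_add, Int.cast_one]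
        rw [abs_le]
        constructor <;> linarith
      · simp only [Pi.add_apply, Pi.single_eq_of_ne hi, add_zero]
        rw [abs_le]
        constructor <;> linarith
    · rw [Matrix.add_vecMul, Pi.add_apply, Matrix.single_one_vecMul, dvd_add_right h0]
      exact hk
  · refine ⟨_, fun i => ?_, h0⟩
    have h1 := Int.floor_le (θ i)
    have h2 := Int.lt_floor_add_one (θ i)
    rw [abs_le]
    constructor <;> linarith

/-- The lattice spanned by the rows of `M` contains, after scaling by `p` and adding `T ^ 3`, a
cubic close to `D * (T - ζ)` that satisfies the divisibility conditions of Eisenstein's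
criterion. -/
theorem exists_eisenstein_vector (hp : p.Prime) (h : ¬ (p : ℤ) ∣ M.det)
    (hM : ∀ i j, |(M i j : ℝ)| ≤ H) (hv : ∀ i, |∑ j, (M i j : ℝ) * ζ ^ (j : ℕ)| ≤ v) (D : ℝ) :
    ∃ f : Fin 4 → ℤ, (∀ j ≠ 3, (p : ℤ) ∣ f j) ∧ ¬ (p : ℤ) ^ 2 ∣ f 0 ∧ ¬ (p : ℤ) ∣ f 3 ∧
      (∀ j, |f j - ![-(D * ζ), D, 0, 0] j| ≤ 4 * p * H) ∧
      |∑ j, (f j : ℝ) * ζ ^ (j : ℕ)| ≤ 4 * p * v := by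
  have hp0 : (p : ℝ) ≠ 0 := by exact_mod_cast hp.ne_zero
  have hpZ : (p : ℤ) ≠ 0 := by exact_mod_cast hp.ne_zero
  set A : Matrix (Fin 4) (Fin 4) ℝ := M.map (Int.cast) with hA
  have hdet : IsUnit A.det := by
    have : A.det = (M.det : ℝ) := (Int.cast_det M).symm
    rw [this, isUnit_iff_ne_zero, Int.cast_ne_zero]
    rintro h0
    exact h (h0 ▸ dvd_zero _)
  let w : Fin 4 → ℝ := fun j => (![-(D * ζ), D, 0, 0] j - (Pi.single 3 1 : Fin 4 → ℝ) j) / p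
  obtain ⟨n, hn, hn0⟩ := exists_round h (w ᵥ* A⁻¹)
  set θ := w ᵥ* A⁻¹
  have hθ (j : Fin 4) : ∑ i, θ i * M i j = w j := by
    have : θ ᵥ* A = w := by
      rw [Matrix.vecMul_vecMul, Matrix.nonsing_inv_mul _ hdet, Matrix.vecMul_one]
    rw [← this]
    simp [Matrix.vecMul, dotProduct, hA]
  let f : Fin 4 → ℤ := Pi.single 3 1 + fun j => p * (n ᵥ* M) j
  have hf (j : Fin 4) (hj : j ≠ 3) : f j = p * (n ᵥ* M) j := by simp [f, hj]
  have hdiff (j : Fin 4) : f j - ![-(D * ζ), D, 0, 0] j = p * ∑ i, (n i - θ i) * M i j := by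
    have e : p * w j = ![-(D * ζ), D, 0, 0] j - (Pi.single 3 1 : Fin 4 → ℝ) j :=
      mul_div_cancel₀ _ hp0
    have e' : (((Pi.single 3 1 : Fin 4 → ℤ) j : ℤ) : ℝ) = (Pi.single 3 1 : Fin 4 → ℝ) j := by
      simp [Pi.single_apply]
    simp only [sub_mul, Finset.sum_sub_distrib, hθ, mul_sub, e]
    simp only [f, Pi.add_apply, Int.cast_add, e', Matrix.vecMul, dotProduct, Int.cast_mul,
      Int.cast_sum, Int.cast_natCast]
    ring
  refine ⟨f, fun j hj => ⟨_, hf j hj⟩, ?_, ?_, fun j => ?_, ?_⟩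
  · rw [hf 0 (by decide), pow_two, mul_dvd_mul_iff_left hpZ]
    exact hn0
  · simp only [f, Pi.add_apply, Pi.single_eq_same, dvd_add_left (dvd_mul_right (p : ℤ) _)]
    exact (Nat.prime_iff_prime_int.mp hp).not_dvd_one
  · rw [hdiff, abs_mul, Nat.abs_cast, mul_assoc, mul_left_comm]
    gcongr
    refine (Finset.abs_sum_le_sum_abs _ _).trans
      ((Finset.sum_le_card_nsmul _ _ H fun i _ => ?_).trans_eq (by simp))
    rw [abs_mul]
    exact (mul_le_of_le_one_left (abs_nonneg _) (hn i)).trans (hM i j)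
  · have : ∑ j, (f j : ℝ) * ζ ^ (j : ℕ) =
        p * ∑ i, (n i - θ i) * ∑ j, (M i j : ℝ) * ζ ^ (j : ℕ) := by
      have e : ∑ j, ![-(D * ζ), D, 0, 0] j * ζ ^ (j : ℕ) = 0 := by
        simp [Fin.sum_univ_four]
      rw [← sub_zero (∑ j, (f j : ℝ) * ζ ^ (j : ℕ)), ← e, ← Finset.sum_sub_distrib]
      simp_rw [← sub_mul, hdiff, Finset.mul_sum, Finset.sum_mul]
      rw [Finset.sum_comm]
      refine Finset.sum_congr rfl fun i _ => Finset.sum_congr rfl fun j _ => by ring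
    rw [this, abs_mul, Nat.abs_cast, mul_assoc, mul_left_comm]
    gcongr
    refine (Finset.abs_sum_le_sum_abs _ _).trans
      ((Finset.sum_le_card_nsmul _ _ v fun i _ => ?_).trans_eq (by simp))
    rw [abs_mul]
    exact (mul_le_of_le_one_left (abs_nonneg _) (hn i)).trans (hv i)

end Eisenstein

/-- The integer cubic with the given coefficients. -/
noncomputable def cubicOf (f : Fin 4 → ℤ) : ℤ[X] := ∑ j : Fin 4, C (f j) * X ^ (j : ℕ)

theorem coeff_cubicOf (f : Fin 4 → ℤ) (j : Fin 4) : (cubicOf f).coeff j = f j := by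
  fin_cases j <;> simp [cubicOf, Fin.sum_univ_four, coeff_X, coeff_C, -eq_intCast]

theorem natDegree_cubicOf {f : Fin 4 → ℤ} (h : f 3 ≠ 0) : (cubicOf f).natDegree = 3 := by
  have : cubicOf f = C (f 3) * X ^ 3 + C (f 2) * X ^ 2 + C (f 1) * X + C (f 0) := by
    simp [cubicOf, Fin.sum_univ_four]
    ring
  rw [this]
  exact Polynomial.natDegree_cubic h

theorem pev_cubicOf (x : ℝ) (f : Fin 4 → ℤ) : pev x (cubicOf f) = ∑ j, (f j : ℝ) * x ^ (j : ℕ) := by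
  simp [pev, cubicOf]

theorem polyH_nonneg (P : ℤ[X]) : 0 ≤ polyH P := Nat.cast_nonneg _

theorem polyH_le {P : ℤ[X]} {B : ℝ} (hB : 0 ≤ B) (h : ∀ i, |(P.coeff i : ℝ)| ≤ B) :
    polyH P ≤ B := by
  rw [polyH, ← Nat.le_floor_iff hB]
  refine Finset.sup_le fun i _ => Nat.le_floor ?_
  rw [Nat.cast_natAbs, Int.cast_abs]
  exact h i

theorem one_le_polyH {P : ℤ[X]} (h : P ≠ 0) : 1 ≤ polyH P :=
  (one_le_abs_intCast (leadingCoeff_ne_zero.mpr h)).trans (abs_coeff_le_polyH P _)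

theorem polyH_primPart_le {P : ℤ[X]} (h : P ≠ 0) : polyH P.primPart ≤ polyH P := by
  refine polyH_le (polyH_nonneg P) fun i => le_trans ?_ (abs_coeff_le_polyH P i)
  conv_rhs => rw [P.eq_C_content_mul_primPart, coeff_C_mul]
  push_cast
  rw [abs_mul]
  exact le_mul_of_one_le_left (abs_nonneg _) (one_le_abs_intCast (content_eq_zero_iff.not.mpr h))

theorem irreducible_primPart_cubicOf {p : ℕ} (hp : p.Prime) {f : Fin 4 → ℤ}
    (hdvd : ∀ j ≠ 3, (p : ℤ) ∣ f j) (h0 : ¬ (p : ℤ) ^ 2 ∣ f 0) (h3 : ¬ (p : ℤ) ∣ f 3) :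
    Irreducible (cubicOf f).primPart := by
  have hpZ : Prime (p : ℤ) := Nat.prime_iff_prime_int.mp hp
  have hf3 : f 3 ≠ 0 := fun h => h3 (h ▸ dvd_zero _)
  have hcoeff (j : Fin 4) : (cubicOf f).content * (cubicOf f).primPart.coeff j = f j := by
    rw [← coeff_C_mul, ← eq_C_content_mul_primPart, coeff_cubicOf]
  have hc : ¬ (p : ℤ) ∣ (cubicOf f).content := fun h =>
    h3 (hcoeff 3 ▸ h.mul_right _)
  have hdeg : (cubicOf f).primPart.natDegree = 3 := by
    rw [natDegree_primPart, natDegree_cubicOf hf3]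
  have hI : (Ideal.span {(p : ℤ)}).IsPrime := (Ideal.span_singleton_prime hpZ.ne_zero).mpr hpZ
  refine irreducible_of_eisenstein_criterion hI ?_ ?_ ?_ ?_ (isPrimitive_primPart _)
  · rw [Ideal.mem_span_singleton, leadingCoeff, hdeg]
    exact fun h => h3 (hcoeff 3 ▸ h.mul_left _)
  · intro n hn
    have hn3 : n < 3 := by
      rw [degree_eq_natDegree (primPart_ne_zero _), hdeg] at hn
      exact_mod_cast hn
    have hd := hdvd ⟨n, by omega⟩ (by simp [Fin.ext_iff]; omega)
    rw [← hcoeff] at hd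
    exact Ideal.mem_span_singleton.mpr ((hpZ.dvd_or_dvd hd).resolve_left hc)
  · rw [degree_eq_natDegree (primPart_ne_zero _), hdeg]
    norm_num
  · rw [Ideal.span_singleton_pow, Ideal.mem_span_singleton]
    exact fun h => h0 (hcoeff 0 ▸ h.mul_left _)

theorem exists_root_near {f : Fin 4 → ℤ} {ζ D E v : ℝ} (hE : 0 ≤ E) (hv : 0 ≤ v)
    (hf : ∀ j, |f j - ![-(D * ζ), D, 0, 0] j| ≤ E) (hfv : |∑ j, (f j : ℝ) * ζ ^ (j : ℕ)| ≤ v)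
    (hD : 12 * (1 + |ζ|) ^ 2 * E ≤ D) (hD0 : 0 < D) (hvD : 2 * v ≤ D) :
    ∃ α, |ζ - α| ≤ 2 * v / D ∧ ∑ j, (f j : ℝ) * α ^ (j : ℕ) = 0 := by
  set h := 2 * v / D with hh
  have hh0 : 0 ≤ h := by positivity
  have hh1 : h ≤ 1 := (div_le_one hD0).mpr hvD
  have hDh : D * h = 2 * v := by rw [hh]; field_simp
  have hz := abs_nonneg ζ
  let F : ℝ → ℝ := fun x => ∑ j, (f j : ℝ) * x ^ (j : ℕ)
  have hF (t : ℝ) (ht : |t| ≤ 1) : |F (ζ + t) - F ζ - D * t| ≤ D / 2 * |t| := by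
    have e : F (ζ + t) - F ζ - D * t = t * ((f 1 - D) + f 2 * (2 * ζ + t) +
        f 3 * (3 * ζ ^ 2 + 3 * ζ * t + t ^ 2)) := by
      simp only [F, Fin.sum_univ_four]
      simp
      ring
    have h1 : |f 1 - D| ≤ E := by simpa using hf 1
    have h2 : |(f 2 : ℝ)| ≤ E := by simpa using hf 2
    have h3 : |(f 3 : ℝ)| ≤ E := by simpa using hf 3
    have e2 : |2 * ζ + t| ≤ 2 * (1 + |ζ|) ^ 2 := by
      refine (abs_add_le _ _).trans ?_
      rw [abs_mul, abs_two]
      nlinarith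
    have e3 : |3 * ζ ^ 2 + 3 * ζ * t + t ^ 2| ≤ 3 * (1 + |ζ|) ^ 2 := by
      refine (abs_add_three _ _ _).trans ?_
      rw [abs_mul, abs_mul, abs_mul, abs_pow, abs_pow, Nat.abs_ofNat]
      nlinarith [mul_le_mul_of_nonneg_left ht hz, abs_nonneg t]
    rw [e, abs_mul, mul_comm]
    gcongr
    refine (abs_add_three _ _ _).trans ?_
    rw [abs_mul, abs_mul]
    have := mul_le_mul h2 e2 (abs_nonneg _) hE
    have := mul_le_mul h3 e3 (abs_nonneg _) hE
    nlinarith [mul_nonneg hE hz, mul_nonneg hE (mul_nonneg hz hz)]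
  have hFζ : |F ζ| ≤ v := hfv
  have habs : |h| = h := abs_of_nonneg hh0
  have hpos := hF h (habs.trans_le hh1)
  have hneg := hF (-h) (by rwa [abs_neg, habs])
  rw [abs_neg] at hneg
  rw [habs, abs_le] at hpos hneg
  rw [abs_le] at hFζ
  have hcont : ContinuousOn F (Set.Icc (ζ - h) (ζ + h)) := by
    apply Continuous.continuousOn
    fun_prop
  obtain ⟨α, hα, hα0⟩ := intermediate_value_Icc (by linarith) hcont
    (show (0 : ℝ) ∈ Set.Icc (F (ζ - h)) (F (ζ + h)) by
      rw [sub_eq_add_neg]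
      constructor <;> linarith)
  refine ⟨α, ?_, hα0⟩
  rw [abs_le]
  constructor <;> linarith [hα.1, hα.2]

theorem exists_le_polyH_of_root_near {ζ : ℝ} (hζ : Transcendental ℚ ζ) (d : ℕ) (X₀ : ℝ) :
    ∃ δ > 0, ∀ (P : ℤ[X]) (α : ℝ), P ≠ 0 → P.natDegree ≤ d → pev α P = 0 → |ζ - α| < δ →
      X₀ ≤ polyH P := by
  have hfin := bUnion_roots_finite (algebraMap ℤ ℝ) d
    (Set.finite_Icc (-⌈X₀⌉) ⌈X₀⌉)
  set S := ⋃ (f : ℤ[X]) (_ : f.natDegree ≤ d ∧ ∀ i, f.coeff i ∈ Set.Icc (-⌈X₀⌉) ⌈X₀⌉),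
    ((f.map (algebraMap ℤ ℝ)).roots.toFinset : Set ℝ)
  have hmem (P : ℤ[X]) (α : ℝ) (hP : P ≠ 0) : α ∈ (P.map (algebraMap ℤ ℝ)).roots.toFinset ↔
      pev α P = 0 := by
    rw [Multiset.mem_toFinset,
      mem_roots ((Polynomial.map_ne_zero_iff (algebraMap ℤ ℝ).injective_int).mpr hP), IsRoot.def,
      eval_map_algebraMap, pev]
  have hζS : ζ ∉ S := by
    intro hS
    simp only [S, Set.mem_iUnion] at hS
    obtain ⟨P, -, hP⟩ := hS
    have hP0 : P ≠ 0 := by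
      rintro rfl
      simp at hP
    exact hP0 (transcendental_iff.mp (hζ.restrictScalars (Int.cast_injective (α := ℚ))) P
      ((hmem P ζ hP0).mp hP))
  obtain ⟨δ, hδ, hball⟩ := Metric.isOpen_iff.mp hfin.isClosed.isOpen_compl ζ hζS
  refine ⟨δ, hδ, fun P α hP hd hα hζα => ?_⟩
  by_contra! hlt
  refine hball (show α ∈ Metric.ball ζ δ by rwa [Metric.mem_ball, dist_comm, Real.dist_eq]) ?_
  simp only [S, Set.mem_iUnion]
  refine ⟨P, ⟨hd, fun i => ?_⟩, (hmem P α hP).mpr hα⟩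
  have := ((abs_coeff_le_polyH P i).trans hlt.le).trans (Int.le_ceil X₀)
  rw [← Int.cast_abs, Int.cast_le, abs_le] at this
  exact this

theorem IsExtremal.exists_cubic {ζ : ℝ} (hζ : IsExtremal ζ) {ε : ℝ} (hε : 0 < ε) (B : ℝ) :
    ∃ y, B ≤ y ∧ ∃ (α : ℝ) (P : ℤ[X]), Irreducible P ∧ P.natDegree = 3 ∧ pev α P = 0 ∧
      polyH P ≤ 104 * (1 + |ζ|) ^ 3 * Real.exp ((1 + 2 * ε) * y) ∧
      |ζ - α| ≤ Real.exp (-(4 * y)) := by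
  obtain ⟨y, hy, M, hM0, hdet, hM, hv⟩ := exists_cubicMatrix hζ hε (max 0 B)
  have hy0 : 0 ≤ y := le_of_max_le_left hy
  have hz := abs_nonneg ζ
  set H := Real.exp ((1 + ε) * y) with hH
  set v := Real.exp ((-3 + ε) * y) with hvdef
  have hvH : v = H * Real.exp (-(4 * y)) := by
    rw [hvdef, hH, ← Real.exp_add]
    ring_nf
  have hvH' : v ≤ H := Real.exp_le_exp.mpr (by linarith)
  have hH0 : 0 < H := Real.exp_pos _
  have hv0 : 0 < v := Real.exp_pos _
  obtain ⟨p, hp, hlt, hle⟩ :=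
    Nat.exists_prime_lt_and_le_two_mul M.det.natAbs (Int.natAbs_ne_zero.mpr hM0)
  have hpdet : ¬ (p : ℤ) ∣ M.det := fun h =>
    hlt.not_ge (Nat.le_of_dvd (Int.natAbs_pos.mpr hM0) (Int.natCast_dvd.mp h))
  have hp1 : (0 : ℝ) < p := by exact_mod_cast hp.pos
  have hpε : (p : ℝ) ≤ 2 * Real.exp (ε * y) := by
    refine le_trans (b := 2 * (M.det.natAbs : ℝ)) (by exact_mod_cast hle) ?_
    rw [Nat.cast_natAbs, Int.cast_abs]
    gcongr
  set D := 48 * (1 + |ζ|) ^ 2 * (p * H) with hD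
  obtain ⟨f, hdvd, h0, h3, hf, hfv⟩ := exists_eisenstein_vector hp hpdet hM hv D
  have hpH : 0 < p * H := by positivity
  have hone : 1 ≤ (1 + |ζ|) ^ 2 := one_le_pow₀ (by linarith)
  have hDle : 48 * (p * H) ≤ D := by nlinarith
  have hpv : p * v ≤ p * H := by gcongr
  obtain ⟨α, hα, hα0⟩ := exists_root_near (by positivity) (by positivity) hf hfv
    (by rw [hD]; linarith) (by positivity) (by linarith)
  have hf3 : f 3 ≠ 0 := fun h => h3 (h ▸ dvd_zero _)
  have hcub : cubicOf f ≠ 0 :=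
    ne_zero_of_natDegree_gt (n := 2) (by rw [natDegree_cubicOf hf3]; norm_num)
  refine ⟨y, le_of_max_le_right hy, α, (cubicOf f).primPart,
    irreducible_primPart_cubicOf hp hdvd h0 h3,
    by rw [natDegree_primPart, natDegree_cubicOf hf3], ?_, (polyH_primPart_le hcub).trans ?_, ?_⟩
  · have hroot : pev α (cubicOf f) = 0 := by rw [pev_cubicOf, hα0]
    rw [eq_C_content_mul_primPart (cubicOf f)] at hroot
    simpa [pev, content_eq_zero_iff, hcub] using hroot
  · have hbound (j : Fin 4) : |(f j : ℝ)| ≤ D * (1 + |ζ|) + 4 * p * H := by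
      have hj : |![-(D * ζ), D, 0, 0] j| ≤ D * (1 + |ζ|) := by
        have hD0 : 0 ≤ D := by positivity
        fin_cases j <;> simp [abs_mul, abs_of_nonneg hD0] <;> nlinarith
      calc |(f j : ℝ)| = |(f j - ![-(D * ζ), D, 0, 0] j) + ![-(D * ζ), D, 0, 0] j| := by
            rw [sub_add_cancel]
        _ ≤ _ := (abs_add_le _ _).trans (by linarith [hf j])
    have hall : polyH (cubicOf f) ≤ D * (1 + |ζ|) + 4 * p * H := by
      refine polyH_le (by positivity) fun i => ?_
      rcases lt_or_ge i 4 with hi | hi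
      · exact coeff_cubicOf f ⟨i, hi⟩ ▸ hbound ⟨i, hi⟩
      · rw [coeff_eq_zero_of_natDegree_lt (by rw [natDegree_cubicOf hf3]; omega)]
        simp only [Int.cast_zero, abs_zero]
        positivity
    calc polyH (cubicOf f) ≤ 48 * (1 + |ζ|) ^ 3 * (p * H) + 4 * (p * H) := by
          refine hall.trans_eq ?_
          rw [hD]
          ring
      _ ≤ 52 * (1 + |ζ|) ^ 3 * (p * H) := by
          nlinarith [one_le_pow₀ (n := 3) (by linarith : 1 ≤ 1 + |ζ|)]
      _ ≤ 52 * (1 + |ζ|) ^ 3 * (2 * Real.exp (ε * y) * H) := by gcongr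
      _ = 104 * (1 + |ζ|) ^ 3 * Real.exp ((1 + 2 * ε) * y) := by
          rw [show (1 + 2 * ε) * y = ε * y + (1 + ε) * y by ring, Real.exp_add]
          ring
  · refine hα.trans ?_
    rw [div_le_iff₀ (by positivity), hvH]
    have := mul_le_mul_of_nonneg_right hDle (Real.exp_nonneg (-(4 * y)))
    have : 0 ≤ p * H * Real.exp (-(4 * y)) := by positivity
    linarith

theorem extremal_cubic_alg_infinite (ζ : ℝ) (hζ : IsExtremal ζ) (ε : ℝ) (hε : 0 < ε) :
    ∀ X₀ : ℝ, ∃ α : ℝ, ∃ P : Polynomial ℤ, Irreducible P ∧ P.natDegree = 3 ∧ pev α P = 0 ∧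
      X₀ ≤ polyH P ∧ |ζ - α| ≤ polyH P ^ (-4 + ε) := by
  intro X₀
  set ε₀ := min ε 1 with hε₀
  have hε₀0 : 0 < ε₀ := lt_min hε one_pos
  obtain ⟨δ, hδ, hheight⟩ := exists_le_polyH_of_root_near hζ.1 3 X₀
  have hlim : Tendsto (fun y : ℝ => Real.exp (-(4 * y))) atTop (𝓝 0) :=
    Real.tendsto_exp_neg_atTop_nhds_zero.comp (tendsto_id.const_mul_atTop (by norm_num))
  obtain ⟨B, hB⟩ := (hlim.eventually_lt_const hδ).exists_forall_of_atTop
  have hK : 0 < 104 * (1 + |ζ|) ^ 3 := by positivity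
  set K := 104 * (1 + |ζ|) ^ 3 with hKdef
  have hK1 : 1 ≤ K := by
    have := one_le_pow₀ (n := 3) (by linarith [abs_nonneg ζ] : 1 ≤ 1 + |ζ|)
    linarith
  obtain ⟨y, hy, α, P, hirr, hdeg, hroot, hH, hα⟩ :=
    hζ.exists_cubic (ε := ε₀ / 16) (by positivity) (max (max 0 B) (8 * Real.log K / ε₀))
  have hy0 : 0 ≤ y := le_of_max_le_left (le_of_max_le_left hy)
  have hyK : 8 * Real.log K ≤ y * ε₀ := (div_le_iff₀ hε₀0).mp (le_of_max_le_right hy)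
  have hP1 := one_le_polyH hirr.ne_zero
  refine ⟨α, P, hirr, hdeg, hroot, hheight P α hirr.ne_zero hdeg.le hroot
    (hα.trans_lt (hB y (le_of_max_le_right (le_of_max_le_left hy)))), ?_⟩
  have hlog : Real.log (polyH P) ≤ Real.log K + (1 + 2 * (ε₀ / 16)) * y := by
    rw [← Real.log_exp ((1 + 2 * (ε₀ / 16)) * y), ← Real.log_mul hK.ne' (Real.exp_ne_zero _)]
    exact Real.log_le_log (by linarith) hH
  calc |ζ - α| ≤ Real.exp (-(4 * y)) := hα
    _ ≤ polyH P ^ (-4 + ε₀) := by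
        rw [Real.rpow_def_of_pos (by linarith), Real.exp_le_exp]
        have h1 : ε₀ ≤ 1 := min_le_right _ _
        have := mul_le_mul_of_nonneg_right hlog (by linarith : 0 ≤ 4 - ε₀)
        nlinarith [Real.log_nonneg hK1, mul_nonneg hy0 (sq_nonneg ε₀),
          mul_nonneg hε₀0.le (Real.log_nonneg hK1)]
    _ ≤ polyH P ^ (-4 + ε) :=
        Real.rpow_le_rpow_of_exponent_le hP1 (by linarith [min_le_left ε 1])
end
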